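/- Let Q and Q′ be normal coordinates for germs at 0 of real-analytic hypersurfaces M, M′ ⊂ ℂ², both of finite type at 0. Then there exist an open neighborhood D of the set {(0,0)} × T²(ℂ²) × conj(T²(ℂ²)) in ℂ² × ℂ¹⁰ × ℂ¹⁰ and a holomorphic map Θ : D → ℂ², depending only on Q and Q′, such that every local biholomorphism H : (ℂ²,0) → (ℂ²,0) satisfying the mapping identity for (Q,Q′) obeys H(z,w) = Θ(z, w, j²₀H, conj(j²₀H)) for all (z,w) ∈ ℂ² near 0. -/

import Mathlib

open Filter Topology Matrix

noncomputable section

/-- Complex conjugation as a plain function. -/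
def cj : ℂ → ℂ := (starRingEnd ℂ)

/-- Iterated partial derivative `∂_z^i ∂_w^j F (z, w)` of `F : ℂ → ℂ → ℂ`. -/
def pd (F : ℂ → ℂ → ℂ) (i j : ℕ) (z w : ℂ) : ℂ :=
  deriv^[i] (fun z' => deriv^[j] (F z') w) z

/-- `Q` is a normal-coordinates defining function (near `0`) of a germ of a
real-analytic hypersurface in `ℂ²`. -/
def IsNormalCoord (Q : ℂ → ℂ → ℂ → ℂ) : Prop :=
  AnalyticAt ℂ (fun p : ℂ × ℂ × ℂ => Q p.1 p.2.1 p.2.2) 0 ∧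
  (∀ᶠ p : ℂ × ℂ in 𝓝 0, Q p.1 0 p.2 = p.2) ∧
  (∀ᶠ p : ℂ × ℂ in 𝓝 0, Q 0 p.1 p.2 = p.2) ∧
  (∀ᶠ p : ℂ × ℂ × ℂ in 𝓝 0, Q p.1 p.2.1 (cj (Q (cj p.2.1) (cj p.1) (cj p.2.2))) = p.2.2)

/-- The mapping identity expressing that the germ at `0` of the holomorphic map
`H = (F, G)` (with `H(0) = 0`) sends the hypersurface defined by `Q` into the one
defined by `Q'`. -/
def SendsInto (Q Q' : ℂ → ℂ → ℂ → ℂ) (F G : ℂ → ℂ → ℂ) : Prop :=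
  AnalyticAt ℂ (fun p : ℂ × ℂ => F p.1 p.2) 0 ∧
  AnalyticAt ℂ (fun p : ℂ × ℂ => G p.1 p.2) 0 ∧
  F 0 0 = 0 ∧ G 0 0 = 0 ∧
  ∀ᶠ p : ℂ × ℂ × ℂ in 𝓝 0,
    G p.1 (Q p.1 p.2.1 p.2.2) =
      Q' (F p.1 (Q p.1 p.2.1 p.2.2)) (cj (F (cj p.2.1) (cj p.2.2))) (cj (G (cj p.2.1) (cj p.2.2)))

/-- Determinant of the Jacobian matrix of `H = (F, G)` at `0`. -/
def JacDet (F G : ℂ → ℂ → ℂ) : ℂ :=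
  pd F 1 0 0 0 * pd G 0 1 0 0 - pd F 0 1 0 0 * pd G 1 0 0 0

/-- The hypersurface defined by `Q` is not Levi-flat near `0`, i.e. `Q(z,χ,τ) ≢ τ`. -/
def NotLeviFlat (Q : ℂ → ℂ → ℂ → ℂ) : Prop :=
  ¬ ∀ᶠ p : ℂ × ℂ × ℂ in 𝓝 0, Q p.1 p.2.1 p.2.2 = p.2.2

/-- The hypersurface defined by `Q` is of finite type at `0`, i.e. `Q(z,χ,0) ≢ 0`. -/
def FiniteTypeAt (Q : ℂ → ℂ → ℂ → ℂ) : Prop :=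
  ¬ ∀ᶠ p : ℂ × ℂ in 𝓝 0, Q p.1 p.2 0 = 0

/-- `q_{αμ}(χ) = ∂_z^α ∂_τ^μ Q(0, χ, 0)`. -/
def qd (Q : ℂ → ℂ → ℂ → ℂ) (α μ : ℕ) (χ : ℂ) : ℂ :=
  deriv^[α] (fun z => deriv^[μ] (fun τ => Q z χ τ) 0) 0

/-- The hypersurface (germ) defined by `Q` as a subset of `ℂ²`. -/
def MSet (Q : ℂ → ℂ → ℂ → ℂ) : Set (ℂ × ℂ) := {p | p.2 = Q p.1 (cj p.1) (cj p.2)}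


/-- The `2`-jet at `0` of `H = (F, G)` (derivatives of orders `1` and `2`) as a point
of `ℂ¹⁰`: `(F_z, F_w, G_z, G_w, F_zz, F_zw, F_ww, G_zz, G_zw, G_ww)` at `0`. -/
def jet10 (F G : ℂ → ℂ → ℂ) : Fin 10 → ℂ :=
  ![pd F 1 0 0 0, pd F 0 1 0 0, pd G 1 0 0 0, pd G 0 1 0 0,
    pd F 2 0 0 0, pd F 1 1 0 0, pd F 0 2 0 0, pd G 2 0 0 0, pd G 1 1 0 0, pd G 0 2 0 0]

/-- `T²(ℂ²)`: the set of `2`-jets whose linear part is an invertible upper-triangular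
matrix (i.e. `G_z(0) = 0` and `F_z(0)·G_w(0) ≠ 0`). -/
def T2Set : Set (Fin 10 → ℂ) := {Λ | Λ 2 = 0 ∧ Λ 0 ≠ 0 ∧ Λ 3 ≠ 0}

/-- The image of `T²(ℂ²)` under componentwise complex conjugation. -/
def T2SetConj : Set (Fin 10 → ℂ) := (fun Λ i => cj (Λ i)) '' T2Set

section Nemytskii

variable {K V W : Type*} [TopologicalSpace K] [CompactSpace K]
  [NormedAddCommGroup V] [NormedSpace ℂ V] [NormedAddCommGroup W] [NormedSpace ℂ W]

/-- The pointwise action of a continuous multilinear map on continuous functions. -/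
def pointwiseMultilinear {n : ℕ} (p : ContinuousMultilinearMap ℂ (fun _ : Fin n => V) W) :
    ContinuousMultilinearMap ℂ (fun _ : Fin n => C(K, V)) C(K, W) :=
  MultilinearMap.mkContinuous
    { toFun := fun u => ⟨fun x => p fun i => u i x, by fun_prop⟩
      map_update_add' := by
        intro _ u i a b
        ext x
        have h : ∀ c : C(K, V), (fun j => (Function.update u i c) j x)
            = Function.update (fun j => u j x) i (c x) := by
          intro c
          ext j
          by_cases hj : j = i
          · subst hj; simp
          · simp [hj]
        change p (fun j => (Function.update u i (a + b) j) x) = p (fun j => (Function.update u i a j) x)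
          + p (fun j => (Function.update u i b j) x)
        simp only [h]
        exact p.map_update_add _ _ _ _
      map_update_smul' := by
        intro _ u i c a
        ext x
        have h : ∀ c : C(K, V), (fun j => (Function.update u i c) j x)
            = Function.update (fun j => u j x) i (c x) := by
          intro c
          ext j
          by_cases hj : j = i
          · subst hj; simp
          · simp [hj]
        change p (fun j => (Function.update u i (c • a) j) x) = c • p (fun j => (Function.update u i a j) x)
        simp only [h]
        exact p.map_update_smul _ _ _ _ }
    ‖p‖ (by
      intro u
      rw [ContinuousMap.norm_le _ (by positivity)]
      intro x
      refine (p.le_opNorm _).trans ?_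
      gcongr with i
      exact (u i).norm_coe_le_norm x)

lemma norm_pointwiseMultilinear_le {n : ℕ}
    (p : ContinuousMultilinearMap ℂ (fun _ : Fin n => V) W) :
    ‖(pointwiseMultilinear p : ContinuousMultilinearMap ℂ (fun _ : Fin n => C(K, V)) C(K, W))‖
      ≤ ‖p‖ :=
  MultilinearMap.mkContinuous_norm_le _ (norm_nonneg _) _

/-- Superposition with an analytic function is analytic on spaces of continuous functions. -/
lemma exists_superposition [CompleteSpace W] {f : V → W} {p : FormalMultilinearSeries ℂ V W}
    {v : V} {r : ENNReal} (hf : HasFPowerSeriesOnBall f p v r) :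
    ∃ S : C(K, V) → C(K, W), AnalyticOnNhd ℂ S (Metric.eball (ContinuousMap.const K v) r) ∧
      ∀ u ∈ Metric.eball (ContinuousMap.const K v) r, ∀ x, S u x = f (u x) := by
  let q : FormalMultilinearSeries ℂ C(K, V) C(K, W) := fun n => pointwiseMultilinear (p n)
  have hq : r ≤ q.radius := by
    refine hf.r_le.trans ?_
    refine ENNReal.le_of_forall_nnreal_lt fun s hs => ?_
    obtain ⟨C, -, hC⟩ := p.norm_mul_pow_le_of_lt_radius hs
    refine q.le_radius_of_bound C fun n => le_trans ?_ (hC n)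
    gcongr
    exact norm_pointwiseMultilinear_le (p n)
  have h0 : 0 < q.radius := hf.r_pos.trans_le hq
  have hS := (q.hasFPowerSeriesOnBall h0).comp_sub (ContinuousMap.const K v)
  rw [zero_add] at hS
  have hS' := hS.mono hf.r_pos hq
  refine ⟨_, hS'.analyticOnNhd, fun u hu x => ?_⟩
  have hs := hS'.hasSum_sub hu
  have hs1 := hs.map (ContinuousMap.evalCLM (M := W) ℂ x) (ContinuousMap.evalCLM (M := W) ℂ x).continuous
  have hux : u x ∈ Metric.eball v r := by
    rw [Metric.mem_eball] at hu ⊢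
    refine lt_of_le_of_lt ?_ hu
    rw [edist_dist, edist_dist]
    exact ENNReal.ofReal_le_ofReal (ContinuousMap.dist_apply_le_dist (g := ContinuousMap.const K v) x)
  have hs2 := hf.hasSum_sub hux
  exact hs1.unique hs2

end Nemytskii

section Projections

variable {E F G : Type*} [NormedAddCommGroup E] [NormedSpace ℂ E] [NormedAddCommGroup F]
  [NormedSpace ℂ F] [NormedAddCommGroup G] [NormedSpace ℂ G]

@[fun_prop]
lemma AnalyticAt.fst_comp {f : E → F × G} {x : E} (hf : AnalyticAt ℂ f x) :
    AnalyticAt ℂ (fun x => (f x).1) x :=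
  AnalyticAt.comp (g := fun p : F × G => p.1) analyticAt_fst hf

@[fun_prop]
lemma AnalyticAt.snd_comp {f : E → F × G} {x : E} (hf : AnalyticAt ℂ f x) :
    AnalyticAt ℂ (fun x => (f x).2) x :=
  AnalyticAt.comp (g := fun p : F × G => p.2) analyticAt_snd hf

end Projections

section Kernel

open Complex Real in
/-- The circle as a continuous function on its parameter interval. -/
def circleFun (r : ℝ) : C(Set.Icc (0 : ℝ) (2 * π), ℂ) :=
  ⟨fun θ => circleMap 0 r θ, (continuous_circleMap 0 r).comp continuous_subtype_val⟩

open Complex Real in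
/-- Integration along a circle as a continuous linear functional. -/
def circleIntegralCLM (r : ℝ) : C(Set.Icc (0 : ℝ) (2 * π), ℂ) →L[ℂ] ℂ :=
  LinearMap.mkContinuous
    { toFun := fun φ => ∫ θ in (0 : ℝ)..2 * π,
        deriv (circleMap 0 r) θ * Set.IccExtend two_pi_pos.le φ θ
      map_add' := by
        intro φ ψ
        rw [← intervalIntegral.integral_add]
        · refine intervalIntegral.integral_congr fun θ _ => ?_
          simp only [Set.IccExtend_apply, ContinuousMap.add_apply]
          ring
        all_goals
          refine Continuous.intervalIntegrable ?_ _ _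
          have : Continuous (deriv (circleMap 0 r)) := by
            rw [funext (deriv_circleMap 0 r)]; fun_prop
          have h2 : ∀ φ : C(Set.Icc (0 : ℝ) (2 * π), ℂ),
            Continuous (Set.IccExtend two_pi_pos.le φ) := fun φ => φ.continuous.Icc_extend'
          exact this.mul (h2 _)
      map_smul' := by
        intro c φ
        simp only [RingHom.id_apply, smul_eq_mul]
        rw [← intervalIntegral.integral_const_mul]
        refine intervalIntegral.integral_congr fun θ _ => ?_
        simp only [Set.IccExtend_apply, ContinuousMap.smul_apply, smul_eq_mul]
        ring }
    (|r| * |2 * π - 0|) (by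
      intro φ
      have := intervalIntegral.norm_integral_le_of_norm_le_const (a := (0 : ℝ)) (b := 2 * π)
        (C := |r| * ‖φ‖)
        (f := fun θ => deriv (circleMap 0 r) θ * Set.IccExtend two_pi_pos.le φ θ) (by
          intro θ _
          rw [norm_mul]
          gcongr
          · simp [deriv_circleMap]
          · exact φ.norm_coe_le_norm _)
      refine this.trans (le_of_eq ?_)
      ring)

lemma circleIntegralCLM_eq {r : ℝ} (φ : C(Set.Icc (0 : ℝ) (2 * Real.pi), ℂ)) (f : ℂ → ℂ)
    (h : ∀ θ, φ θ = f (circleFun r θ)) : circleIntegralCLM r φ = ∮ ξ in C(0, r), f ξ := by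
  rw [circleIntegral]
  change (∫ θ in (0 : ℝ)..2 * Real.pi, _) = _
  refine intervalIntegral.integral_congr fun θ hθ => ?_
  rw [Set.uIcc_of_le Real.two_pi_pos.le] at hθ
  simp only [smul_eq_mul]
  rw [Set.IccExtend_of_mem _ _ hθ, h]
  rfl

lemma norm_circleFun {r : ℝ} (hr : 0 < r) (θ : Set.Icc (0 : ℝ) (2 * Real.pi)) :
    ‖circleFun r θ‖ = r := by
  simp [circleFun, abs_of_pos hr]

variable {E : Type*} [NormedAddCommGroup E] [NormedSpace ℂ E]

/-- The linear part of `(s, ζ, y) ↦ (ξ ↦ (s / ξ ^ a, ξ, y))`. -/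
def twistCLM (a : ℕ) {r : ℝ} (hr : 0 < r) :
    (ℂ × ℂ × E) →L[ℂ] C(Set.Icc (0 : ℝ) (2 * Real.pi), ℂ × ℂ × E) :=
  LinearMap.mkContinuous
    { toFun := fun x => ⟨fun θ => (x.1 / circleFun r θ ^ a, 0, x.2.2), by
        have : ∀ θ, circleFun r θ ^ a ≠ 0 := fun θ => pow_ne_zero _ (by
          rw [← norm_pos_iff, norm_circleFun hr]; exact hr)
        fun_prop (disch := assumption)⟩
      map_add' := by
        intro x y
        ext θ <;> simp [add_div]
      map_smul' := by
        intro c x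
        ext θ <;> simp [mul_div_assoc] }
    (max (r ^ a)⁻¹ 1) (by
      intro x
      rw [ContinuousMap.norm_le _ (by positivity)]
      intro θ
      have h1 : ‖x.1‖ ≤ ‖x‖ := norm_fst_le x
      have h2 : ‖x.2.2‖ ≤ ‖x‖ := (norm_snd_le x.2).trans (norm_snd_le x)
      change ‖(x.1 / circleFun r θ ^ a, (0 : ℂ), x.2.2)‖ ≤ _
      rw [Prod.norm_mk, Prod.norm_mk, norm_div, norm_pow, norm_circleFun hr, norm_zero]
      refine max_le ?_ (max_le (by positivity) ?_)
      · rw [div_eq_inv_mul]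
        gcongr
        exact le_max_left _ _
      · calc ‖x.2.2‖ ≤ 1 * ‖x‖ := by rwa [one_mul]
          _ ≤ _ := by gcongr; exact le_max_right _ _)

set_option maxHeartbeats 1000000 in
lemma analyticAt_circleIntegral_kernel {Ψ : ℂ × ℂ × E → ℂ} {y₀ : E} {ρ r : ℝ}
    {p : FormalMultilinearSeries ℂ (ℂ × ℂ × E) ℂ}
    (hΨ : HasFPowerSeriesOnBall Ψ p (0, 0, y₀) (ENNReal.ofReal ρ)) (hr : 0 < r) (hrρ : r < ρ)
    (a b : ℕ) {c : ℂ → ℂ} (hc : ContinuousOn c (Metric.sphere 0 r)) :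
    AnalyticAt ℂ (fun x : ℂ × ℂ × E => ∮ ξ in C(0, r),
      Ψ (x.1 / ξ ^ a, ξ, x.2.2) * (c ξ * (ξ ^ b - x.2.1)⁻¹)) (0, 0, y₀) := by
  obtain ⟨S, hS, hSe⟩ := exists_superposition (K := Set.Icc (0 : ℝ) (2 * Real.pi)) hΨ
  have hne : ∀ θ, circleFun r θ ≠ 0 := fun θ => by
    rw [← norm_pos_iff, norm_circleFun hr]; exact hr
  let γ : C(Set.Icc (0 : ℝ) (2 * Real.pi), ℂ × ℂ × E) :=
    ⟨fun θ => (0, circleFun r θ, 0), by fun_prop⟩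
  let u : ℂ × ℂ × E → C(Set.Icc (0 : ℝ) (2 * Real.pi), ℂ × ℂ × E) :=
    fun x => twistCLM a hr x + γ
  have hu : AnalyticAt ℂ u (0, 0, y₀) :=
    AnalyticAt.fun_add (f := fun x => twistCLM a hr x) (g := fun _ => γ)
      (ContinuousLinearMap.analyticAt (𝕜 := ℂ) (twistCLM a hr) (0, 0, y₀)) analyticAt_const
  have hu0 : u (0, 0, y₀) ∈ Metric.eball
      (ContinuousMap.const (Set.Icc (0 : ℝ) (2 * Real.pi)) ((0 : ℂ), (0 : ℂ), y₀))
      (ENNReal.ofReal ρ) := by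
    rw [Metric.eball_ofReal, Metric.mem_ball, dist_eq_norm]
    refine lt_of_le_of_lt ?_ hrρ
    rw [ContinuousMap.norm_le _ hr.le]
    intro θ
    have : (u (0, 0, y₀) - ContinuousMap.const (Set.Icc (0 : ℝ) (2 * Real.pi))
        ((0 : ℂ), (0 : ℂ), y₀)) θ = (0, circleFun r θ, 0) := by
      change ((0 : ℂ) / circleFun r θ ^ a, (0 : ℂ), y₀) + (0, circleFun r θ, 0) - (0, 0, y₀) = _
      simp
    rw [this, Prod.norm_mk, Prod.norm_mk, norm_circleFun hr]
    simp [hr.le]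
  let cc : C(Set.Icc (0 : ℝ) (2 * Real.pi), ℂ) :=
    ⟨fun θ => c (circleFun r θ), hc.comp_continuous (by fun_prop) (fun θ => by
      simp [norm_circleFun hr])⟩
  let d : ℂ × ℂ × E → C(Set.Icc (0 : ℝ) (2 * Real.pi), ℂ) :=
    fun x => circleFun r ^ b - algebraMap ℂ _ x.2.1
  have hd : AnalyticAt ℂ d (0, 0, y₀) := by
    have h : AnalyticAt ℂ (fun x : ℂ × ℂ × E =>
        algebraMapCLM ℂ C(Set.Icc (0 : ℝ) (2 * Real.pi), ℂ) x.2.1) (0, 0, y₀) :=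
      ((algebraMapCLM ℂ C(Set.Icc (0 : ℝ) (2 * Real.pi), ℂ)).analyticAt _).comp
      (f := fun x : ℂ × ℂ × E => x.2.1) (by fun_prop)
    exact AnalyticAt.fun_sub (f := fun _ => circleFun r ^ b) analyticAt_const h
  have hd0 : IsUnit (d (0, 0, y₀)) := by
    rw [ContinuousMap.isUnit_iff_forall_ne_zero]
    intro θ
    change circleFun r θ ^ b - (0 : ℂ) ≠ 0
    rw [sub_zero]
    exact pow_ne_zero _ (hne θ)
  have hinv : AnalyticAt ℂ (fun x => Ring.inverse (d x)) (0, 0, y₀) := by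
    obtain ⟨e, he⟩ := hd0
    exact (analyticAt_inverse (𝕜 := ℂ) e).comp_of_eq hd he.symm
  have hSu : AnalyticAt ℂ (fun x => S (u x)) (0, 0, y₀) := (hS _ hu0).comp hu
  have hprod : AnalyticAt ℂ (fun x => S (u x) * (cc * Ring.inverse (d x))) (0, 0, y₀) :=
    hSu.fun_mul (analyticAt_const.fun_mul hinv)
  have hall : AnalyticAt ℂ (fun x => circleIntegralCLM r (S (u x) * (cc * Ring.inverse (d x))))
      (0, 0, y₀) :=
    ((circleIntegralCLM r).analyticAt _).comp hprod
  refine hall.congr ?_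
  have e1 : ∀ᶠ x in 𝓝 ((0 : ℂ), (0 : ℂ), y₀), u x ∈ Metric.eball
      (ContinuousMap.const (Set.Icc (0 : ℝ) (2 * Real.pi)) ((0 : ℂ), (0 : ℂ), y₀))
      (ENNReal.ofReal ρ) := hu.continuousAt (Metric.isOpen_eball.mem_nhds hu0)
  have e2 : ∀ᶠ x in 𝓝 ((0 : ℂ), (0 : ℂ), y₀), IsUnit (d x) :=
    hd.continuousAt (Units.isOpen.mem_nhds hd0)
  filter_upwards [e1, e2] with x h1 h2
  have key : ∀ θ, (S (u x) * (cc * Ring.inverse (d x))) θ =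
      (fun ξ => Ψ (x.1 / ξ ^ a, ξ, x.2.2) * (c ξ * (ξ ^ b - x.2.1)⁻¹)) (circleFun r θ) := by
    intro θ
    have h3 : (Ring.inverse (d x)) θ = (circleFun r θ ^ b - x.2.1)⁻¹ := by
      have h4 : (d x * Ring.inverse (d x)) θ = 1 := by rw [Ring.mul_inverse_cancel _ h2]; rfl
      exact eq_inv_of_mul_eq_one_right h4
    have h5 : u x θ = (x.1 / circleFun r θ ^ a, circleFun r θ, x.2.2) := by
      change (x.1 / circleFun r θ ^ a, (0 : ℂ), x.2.2) + (0, circleFun r θ, 0) = _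
      simp
    rw [ContinuousMap.mul_apply, ContinuousMap.mul_apply, h3, hSe _ h1, h5]
    rfl
  exact circleIntegralCLM_eq _ _ key

end Kernel

section Descent

open Complex Real in
lemma circleIntegral_comp_pow_mul {r : ℝ} (hr : 0 < r) {b : ℕ} (hb : b ≠ 0) {g : ℂ → ℂ}
    (hg : ContinuousOn g (Metric.sphere 0 (r ^ b))) :
    ∮ ξ in C(0, r), g (ξ ^ b) * ξ ^ (b - 1) = ∮ w in C(0, r ^ b), g w := by
  have hpow : ∀ θ : ℝ, circleMap 0 r θ ^ b = circleMap 0 (r ^ b) (b * θ) := fun θ => by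
    simp only [circleMap, zero_add, mul_pow, ← Complex.exp_nat_mul]
    push_cast
    ring_nf
  have hcont : Continuous fun θ : ℝ => deriv (circleMap 0 (r ^ b)) θ • g (circleMap 0 (r ^ b) θ) := by
    rw [funext (deriv_circleMap 0 (r ^ b))]
    have h1 : Continuous fun θ : ℝ => g (circleMap 0 (r ^ b) θ) :=
      hg.comp_continuous (continuous_circleMap 0 _)
        fun θ => circleMap_mem_sphere 0 (by positivity) θ
    have h2 : Continuous fun θ : ℝ => circleMap 0 (r ^ b) θ * I := by fun_prop
    exact h2.smul h1
  have hper : Function.Periodic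
      (fun θ : ℝ => deriv (circleMap 0 (r ^ b)) θ • g (circleMap 0 (r ^ b) θ)) (2 * π) := by
    intro θ
    simp only [deriv_circleMap, periodic_circleMap 0 (r ^ b) θ]
  have h1 := hper.intervalIntegral_add_zsmul_eq b 0
    (fun _ _ => hcont.intervalIntegrable _ _)
  have h2 := intervalIntegral.integral_comp_mul_left (a := 0) (b := 2 * π)
    (fun θ : ℝ => deriv (circleMap 0 (r ^ b)) θ • g (circleMap 0 (r ^ b) θ))
    (c := (b : ℝ)) (by exact_mod_cast hb)
  have hb' : (b : ℂ) ≠ 0 := by exact_mod_cast hb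
  simp only [zero_add, zsmul_eq_mul, Int.cast_natCast] at h1
  rw [mul_zero, h1, Complex.real_smul] at h2
  push_cast at h2
  rw [inv_mul_cancel_left₀ hb'] at h2
  rw [circleIntegral, circleIntegral, ← h2]
  refine intervalIntegral.integral_congr fun θ _ => ?_
  simp only [deriv_circleMap, smul_eq_mul, ← hpow]
  rw [← Nat.sub_add_cancel (Nat.one_le_iff_ne_zero.mpr hb), pow_succ]
  simp only [Nat.add_sub_cancel]
  ring

variable {E : Type*} [NormedAddCommGroup E] [NormedSpace ℂ E]

/-- The Cauchy-type integral recovering `h` from `(x, y) ↦ h (x * y ^ a, y ^ b)`. -/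
def descentIntegral (a b : ℕ) (Ψ : ℂ × ℂ × E → ℂ) (r : ℝ) (x : ℂ × ℂ × E) : ℂ :=
  (2 * Real.pi * Complex.I)⁻¹ * ∮ ξ in C(0, r),
    Ψ (x.1 / ξ ^ a, ξ, x.2.2) * (ξ ^ (b - 1) * (ξ ^ b - x.2.1)⁻¹)

/-- Radii for which `descentIntegral` computes the descent. -/
def DescentAdmissible (a b : ℕ) (Ψ : ℂ × ℂ × E → ℂ) (x : ℂ × ℂ × E) (r : ℝ) : Prop :=
  0 < r ∧ ‖x.1‖ < r ^ (a + 1) ∧ ‖x.2.1‖ < r ^ b ∧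
    ∀ s t : ℂ, ‖s‖ ≤ r → ‖t‖ ≤ r → AnalyticAt ℂ (fun q : ℂ × ℂ => Ψ (q.1, q.2, x.2.2)) (s, t)

lemma DescentAdmissible.descentIntegral_eq_of_le {E : Type*} {a b : ℕ} {Ψ : ℂ × ℂ × E → ℂ}
    {x : ℂ × ℂ × E}
    {r R : ℝ} (hr : DescentAdmissible a b Ψ x r) (hR : DescentAdmissible a b Ψ x R)
    (hle : r ≤ R) : descentIntegral a b Ψ R x = descentIntegral a b Ψ r x := by
  rw [descentIntegral, descentIntegral]
  congr 1
  have key : ∀ ξ : ℂ, r ≤ ‖ξ‖ → ‖ξ‖ ≤ R → AnalyticAt ℂ (fun ξ =>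
      Ψ (x.1 / ξ ^ a, ξ, x.2.2) * (ξ ^ (b - 1) * (ξ ^ b - x.2.1)⁻¹)) ξ := by
    intro ξ h1 h2
    have hξ : ξ ≠ 0 := norm_pos_iff.mp (hr.1.trans_le h1)
    have h3 : ξ ^ b - x.2.1 ≠ 0 := by
      intro h
      rw [sub_eq_zero] at h
      have := hr.2.2.1
      rw [← h, norm_pow] at this
      exact absurd (pow_le_pow_left₀ hr.1.le h1 b) (not_le.mpr this)
    have h4 : ‖x.1 / ξ ^ a‖ ≤ R := by
      rw [norm_div, norm_pow, div_le_iff₀ (pow_pos (hr.1.trans_le h1) a)]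
      calc ‖x.1‖ ≤ r * r ^ a := by rw [← pow_succ']; exact hr.2.1.le
        _ ≤ R * ‖ξ‖ ^ a := by exact mul_le_mul hle (pow_le_pow_left₀ hr.1.le h1 a) (pow_nonneg hr.1.le a) hR.1.le
    have h5 : AnalyticAt ℂ (fun ξ : ℂ => (x.1 / ξ ^ a, ξ)) ξ :=
      (AnalyticAt.fun_div (g := fun ξ : ℂ => ξ ^ a) analyticAt_const (by fun_prop)
        (pow_ne_zero _ hξ)).prod analyticAt_id
    have h6 := (hR.2.2.2 _ _ h4 h2).comp (f := fun ξ : ℂ => (x.1 / ξ ^ a, ξ)) h5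
    refine AnalyticAt.fun_mul h6 (AnalyticAt.fun_mul (by fun_prop) (AnalyticAt.fun_inv (by fun_prop) h3))
  refine Complex.circleIntegral_eq_of_differentiable_on_annulus_off_countable hr.1 hle
    Set.countable_empty ?_ ?_
  · intro ξ hξ
    simp only [Set.mem_sdiff, Metric.mem_closedBall, dist_zero_right, Metric.mem_ball, not_lt] at hξ
    exact (key ξ hξ.2 hξ.1).continuousAt.continuousWithinAt
  · intro ξ hξ
    simp only [Set.mem_sdiff, Metric.mem_closedBall, dist_zero_right, Metric.mem_ball, not_le] at hξ
    exact (key ξ hξ.1.2.le hξ.1.1.le).differentiableAt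

lemma DescentAdmissible.descentIntegral_eq {a b : ℕ} {Ψ : ℂ × ℂ × E → ℂ} {x : ℂ × ℂ × E}
    {r R : ℝ} (hr : DescentAdmissible a b Ψ x r) (hR : DescentAdmissible a b Ψ x R) :
    descentIntegral a b Ψ R x = descentIntegral a b Ψ r x := by
  rcases le_total r R with h | h
  · exact hr.descentIntegral_eq_of_le hR h
  · exact (hR.descentIntegral_eq_of_le hr h).symm

open Classical in
/-- The function `h` with `h (x * y ^ a, y ^ b) = Ψ (x, y)`, depending on parameters. -/
def descent (a b : ℕ) (Ψ : ℂ × ℂ × E → ℂ) (x : ℂ × ℂ × E) : ℂ :=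
  if h : ∃ r, DescentAdmissible a b Ψ x r then descentIntegral a b Ψ h.choose x else 0

lemma DescentAdmissible.descent_eq {a b : ℕ} {Ψ : ℂ × ℂ × E → ℂ} {x : ℂ × ℂ × E}
    {r : ℝ} (hr : DescentAdmissible a b Ψ x r) : descent a b Ψ x = descentIntegral a b Ψ r x := by
  have h : ∃ r, DescentAdmissible a b Ψ x r := ⟨r, hr⟩
  rw [descent, dif_pos h]
  exact hr.descentIntegral_eq h.choose_spec

lemma eventually_descentAdmissible {a b : ℕ} {Ψ : ℂ × ℂ × E → ℂ} {y₀ : E} {ρ r : ℝ}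
    (hΨ : ∀ x ∈ Metric.ball ((0 : ℂ), (0 : ℂ), y₀) ρ, AnalyticAt ℂ Ψ x) (hr : 0 < r)
    (hrρ : r < ρ) : ∀ᶠ x in 𝓝 ((0 : ℂ), (0 : ℂ), y₀), DescentAdmissible a b Ψ x r := by
  have e1 : ∀ᶠ x : ℂ × ℂ × E in 𝓝 (0, 0, y₀), ‖x.1‖ < r ^ (a + 1) :=
    ContinuousAt.eventually_lt (by fun_prop) continuousAt_const (by simp; positivity)
  have e2 : ∀ᶠ x : ℂ × ℂ × E in 𝓝 (0, 0, y₀), ‖x.2.1‖ < r ^ b :=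
    ContinuousAt.eventually_lt (by fun_prop) continuousAt_const (by simp; positivity)
  have e3 : ∀ᶠ x : ℂ × ℂ × E in 𝓝 (0, 0, y₀), dist x.2.2 y₀ < ρ :=
    ContinuousAt.eventually_lt (by fun_prop) continuousAt_const (by simp; linarith)
  filter_upwards [e1, e2, e3] with x h1 h2 h3
  refine ⟨hr, h1, h2, fun s t hs ht => ?_⟩
  refine (hΨ (s, t, x.2.2) ?_).comp (f := fun q : ℂ × ℂ => (q.1, q.2, x.2.2)) (by fun_prop)
  simp only [Metric.mem_ball, Prod.dist_eq, dist_zero_right]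
  exact max_lt (by linarith) (max_lt (by linarith) h3)

lemma analyticAt_descent (a b : ℕ) {Ψ : ℂ × ℂ × E → ℂ} {y₀ : E}
    [CompleteSpace E]
    (hΨ : AnalyticAt ℂ Ψ (0, 0, y₀)) : AnalyticAt ℂ (descent a b Ψ) (0, 0, y₀) := by
  obtain ⟨p, R, hp⟩ := hΨ
  obtain ⟨ρ, hρ0, hρR⟩ := ENNReal.lt_iff_exists_nnreal_btwn.mp hp.r_pos
  have hρ : (0 : ℝ) < ρ := by exact_mod_cast hρ0
  have hp' : HasFPowerSeriesOnBall Ψ p (0, 0, y₀) (ENNReal.ofReal ρ) :=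
    hp.mono (by simpa using hρ0) (by simpa using hρR.le)
  have h1 := analyticAt_circleIntegral_kernel hp' (half_pos hρ) (half_lt_self hρ) a b
    (c := fun ξ => ξ ^ (b - 1)) (by fun_prop)
  refine (AnalyticAt.fun_mul (f := fun _ => (2 * Real.pi * Complex.I)⁻¹)
    analyticAt_const h1).congr ?_
  have hA : ∀ x ∈ Metric.ball ((0 : ℂ), (0 : ℂ), y₀) ρ, AnalyticAt ℂ Ψ x := fun x hx =>
    hp'.analyticAt_of_mem (by rwa [Metric.eball_ofReal])
  filter_upwards [eventually_descentAdmissible (a := a) (b := b) hA (half_pos hρ)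
    (half_lt_self hρ)] with x hx
  rw [hx.descent_eq, descentIntegral]

lemma eventually_eq_descent {a b : ℕ} (hb : b ≠ 0) {Ψ : ℂ × ℂ × E → ℂ} {y₀ : E}
    (hΨ : AnalyticAt ℂ Ψ (0, 0, y₀)) {h : ℂ × ℂ → ℂ} (hh : AnalyticAt ℂ h 0)
    (heq : ∀ᶠ q : ℂ × ℂ in 𝓝 0, h (q.1 * q.2 ^ a, q.2 ^ b) = Ψ (q.1, q.2, y₀)) :
    ∀ᶠ q : ℂ × ℂ in 𝓝 0, h q = descent a b Ψ (q.1, q.2, y₀) := by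
  have hΨ' : AnalyticAt ℂ (fun q : ℂ × ℂ => Ψ (q.1, q.2, y₀)) 0 :=
    hΨ.comp_of_eq (f := fun q : ℂ × ℂ => (q.1, q.2, y₀)) (by fun_prop) rfl
  obtain ⟨ε, hε, hball⟩ := Metric.eventually_nhds_iff_ball.mp
    (heq.and (hΨ'.eventually_analyticAt.and hh.eventually_analyticAt))
  let r := min (ε / 2) (1 / 2)
  have hr : 0 < r := by positivity
  have hrε : r < ε := (min_le_left _ _).trans_lt (half_lt_self hε)
  have hr1 : r ≤ 1 := (min_le_right _ _).trans (by norm_num)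
  have hmem : ∀ s t : ℂ, ‖s‖ ≤ r → ‖t‖ ≤ r → (s, t) ∈ Metric.ball (0 : ℂ × ℂ) ε := by
    intro s t hs ht
    rw [mem_ball_zero_iff, Prod.norm_mk]
    exact max_lt (hs.trans_lt hrε) (ht.trans_lt hrε)
  have hrpow : ∀ n ≠ 0, r ^ n ≤ r := fun n hn => pow_le_of_le_one hr.le hr1 hn
  have e1 : ∀ᶠ q : ℂ × ℂ in 𝓝 0, ‖q.1‖ < r ^ (a + 1) :=
    ContinuousAt.eventually_lt (by fun_prop) continuousAt_const (by simp; positivity)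
  have e2 : ∀ᶠ q : ℂ × ℂ in 𝓝 0, ‖q.2‖ < r ^ b :=
    ContinuousAt.eventually_lt (by fun_prop) continuousAt_const (by simp; positivity)
  filter_upwards [e1, e2] with q h1 h2
  have hadm : DescentAdmissible a b Ψ (q.1, q.2, y₀) r :=
    ⟨hr, h1, h2, fun s t hs ht => (hball _ (hmem s t hs ht)).2.1⟩
  have hq1 : ‖q.1‖ ≤ r := h1.le.trans (hrpow _ (by omega))
  have hd : ∀ w ∈ Metric.closedBall (0 : ℂ) (r ^ b), DifferentiableAt ℂ (fun w => h (q.1, w)) w := by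
    intro w hw
    rw [mem_closedBall_zero_iff] at hw
    have h3 := (hball _ (hmem q.1 w hq1 (hw.trans (hrpow b hb)))).2.2
    exact (h3.comp (f := fun w => (q.1, w)) (by fun_prop)).differentiableAt
  have hcauchy := DifferentiableOn.circleIntegral_sub_inv_smul (f := fun w => h (q.1, w))
    (w := q.2) (fun w hw => (hd w hw).differentiableWithinAt) (by simpa using h2)
  have hsub := circleIntegral_comp_pow_mul hr hb (g := fun w => (w - q.2)⁻¹ • h (q.1, w)) (by
    intro w hw
    have hw' : ‖w‖ = r ^ b := by simpa using hw
    have hne : w - q.2 ≠ 0 := by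
      intro h0
      rw [sub_eq_zero] at h0
      rw [← h0, hw'] at h2
      exact lt_irrefl _ h2
    have := (hd w (by simp [hw'])).continuousAt
    have h3 : ContinuousAt (fun w => (w - q.2)⁻¹) w := ContinuousAt.inv₀ (by fun_prop) hne
    exact (h3.smul this).continuousWithinAt)
  rw [hadm.descent_eq, descentIntegral]
  have hintegral : (∮ ξ in C(0, r), Ψ (q.1 / ξ ^ a, ξ, y₀) * (ξ ^ (b - 1) * (ξ ^ b - q.2)⁻¹)) =
      ∮ ξ in C(0, r), (ξ ^ b - q.2)⁻¹ • h (q.1, ξ ^ b) * ξ ^ (b - 1) := by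
    refine circleIntegral.integral_congr hr.le fun ξ hξ => ?_
    have hξ' : ‖ξ‖ = r := by simpa using hξ
    have hξ0 : ξ ≠ 0 := norm_pos_iff.mp (hξ' ▸ hr)
    have h4 : ‖q.1 / ξ ^ a‖ ≤ r := by
      rw [norm_div, norm_pow, hξ', div_le_iff₀ (by positivity), ← pow_succ']
      exact h1.le
    have h5 := (hball _ (hmem _ _ h4 hξ'.le)).1
    simp only at h5
    rw [div_mul_cancel₀ _ (pow_ne_zero _ hξ0)] at h5
    simp only [← h5, smul_eq_mul]
    ring
  rw [hintegral, hsub, hcauchy, smul_eq_mul, inv_mul_cancel_left₀ Complex.two_pi_I_ne_zero]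

end Descent

section Quotient

variable {E : Type*} [NormedAddCommGroup E] [NormedSpace ℂ E]

/-- The quotient `(f (z, y) - f (0, y)) / z`, extended to `z = 0`. -/
def firstQuot (f : ℂ × E → ℂ) (x : ℂ × E) : ℂ := dslope (fun z => f (z, x.2)) 0 x.1

lemma eq_add_mul_firstQuot {E : Type*} (f : ℂ × E → ℂ) (z : ℂ) (y : E) :
    f (z, y) = f (0, y) + z * firstQuot f (z, y) := by
  have := sub_smul_dslope (fun z => f (z, y)) 0 z
  rw [sub_zero, smul_eq_mul] at this
  rw [firstQuot, this]
  ring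

lemma analyticAt_firstQuot {f : ℂ × E → ℂ} {y₀ : E} (hf : AnalyticAt ℂ f (0, y₀)) :
    AnalyticAt ℂ (firstQuot f) (0, y₀) := by
  let Ψ : ℂ × ℂ × E → ℂ := fun x => f (x.2.1, x.2.2) - f (0, x.2.2)
  have hΨ : AnalyticAt ℂ Ψ (0, 0, y₀) :=
    (hf.comp_of_eq (f := fun x : ℂ × ℂ × E => (x.2.1, x.2.2)) (by fun_prop) rfl).fun_sub
      (hf.comp_of_eq (f := fun x : ℂ × ℂ × E => ((0 : ℂ), x.2.2)) (by fun_prop) rfl)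
  obtain ⟨p, R, hp⟩ := hΨ
  obtain ⟨ρ, hρ0, hρR⟩ := ENNReal.lt_iff_exists_nnreal_btwn.mp hp.r_pos
  have hρ : (0 : ℝ) < ρ := by exact_mod_cast hρ0
  have hp' : HasFPowerSeriesOnBall Ψ p (0, 0, y₀) (ENNReal.ofReal ρ) :=
    hp.mono (by simpa using hρ0) (by simpa using hρR.le)
  have h1 := analyticAt_circleIntegral_kernel hp' (half_pos hρ) (half_lt_self hρ) 0 1
    (c := fun ξ => ξ⁻¹) (continuousOn_inv₀.mono fun ξ hξ => by
      have : ‖ξ‖ = ρ / 2 := by simpa using hξ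
      exact norm_pos_iff.mp (this ▸ half_pos hρ))
  have h2 := h1.comp_of_eq (f := fun x : ℂ × E => ((0 : ℂ), x.1, x.2)) (x := (0, y₀))
    (by fun_prop) rfl
  refine (AnalyticAt.fun_mul (f := fun _ => (2 * Real.pi * Complex.I)⁻¹)
    analyticAt_const h2).congr ?_
  have e1 : ∀ᶠ x : ℂ × E in 𝓝 (0, y₀), ‖x.1‖ < ρ / 2 :=
    ContinuousAt.eventually_lt (by fun_prop) continuousAt_const (by simpa using hρ)
  have e2 : ∀ᶠ x : ℂ × E in 𝓝 (0, y₀), dist x.2 y₀ < ρ :=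
    ContinuousAt.eventually_lt (by fun_prop) continuousAt_const (by simpa using hρ)
  filter_upwards [e1, e2] with x hx1 hx2
  have hd : DifferentiableOn ℂ (fun z => f (z, x.2)) (Metric.closedBall 0 (ρ / 2)) := by
    intro z hz
    rw [mem_closedBall_zero_iff] at hz
    have h3 : AnalyticAt ℂ Ψ (0, z, x.2) := hp'.analyticAt_of_mem (by
      rw [Metric.eball_ofReal, Metric.mem_ball]
      simp only [Prod.dist_eq, dist_zero_right, norm_zero]
      exact max_lt hρ (max_lt (by linarith) hx2))
    have h4 : DifferentiableAt ℂ (fun z => Ψ (0, z, x.2) + f (0, x.2)) z :=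
      (h3.comp (f := fun z : ℂ => ((0 : ℂ), z, x.2)) (by fun_prop)).differentiableAt.add_const _
    refine (h4.congr_of_eventuallyEq (Eventually.of_forall fun z => ?_)).differentiableWithinAt
    simp [Ψ]
  have h5 := (Complex.differentiableOn_dslope
    (Metric.closedBall_mem_nhds (0 : ℂ) (half_pos hρ))).mpr hd
  have h6 := h5.circleIntegral_sub_inv_smul (w := x.1) (by simpa using hx1)
  have h7 : (∮ ξ in C(0, ρ / 2), Ψ (0 / ξ ^ 0, ξ, x.2) * (ξ⁻¹ * (ξ ^ 1 - x.1)⁻¹)) =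
      ∮ ξ in C(0, ρ / 2), (ξ - x.1)⁻¹ • dslope (fun z => f (z, x.2)) 0 ξ := by
    refine circleIntegral.integral_congr (half_pos hρ).le fun ξ hξ => ?_
    have hξ' : ‖ξ‖ = ρ / 2 := by simpa using hξ
    have hξ0 : ξ ≠ 0 := norm_pos_iff.mp (hξ' ▸ half_pos hρ)
    simp only [Ψ, smul_eq_mul, pow_one, dslope_of_ne _ hξ0, slope_def_field, sub_zero]
    ring
  simp only [Function.comp_def] at h7 ⊢
  rw [h7, h6, firstQuot, smul_eq_mul, inv_mul_cancel_left₀ Complex.two_pi_I_ne_zero]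

lemma firstQuot_mul_eq {E : Type*} {f : ℂ × E → ℂ} {g : ℂ → ℂ} {y : E} (hg : ContinuousAt g 0)
    (h : ∀ᶠ z in 𝓝 (0 : ℂ), f (z, y) = z * g z) :
    ∀ᶠ z in 𝓝 (0 : ℂ), firstQuot f (z, y) = g z := by
  have h0 : f (0, y) = 0 := by simpa using h.self_of_nhds
  filter_upwards [h] with z hz
  rcases eq_or_ne z 0 with rfl | hz0
  · simp only [firstQuot, dslope_same]
    refine HasDerivAt.deriv ?_
    rw [hasDerivAt_iff_tendsto_slope]
    refine (hg.tendsto.mono_left nhdsWithin_le_nhds).congr' ?_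
    filter_upwards [h.filter_mono nhdsWithin_le_nhds, self_mem_nhdsWithin] with w hw hw0
    have hw0' : w ≠ 0 := hw0
    rw [slope_def_field, hw, h0, sub_zero, sub_zero, mul_div_cancel_left₀ _ hw0']
  · have := eq_add_mul_firstQuot f z y
    rw [h0, zero_add, hz] at this
    exact (mul_left_cancel₀ hz0 this).symm

/-- The coefficient function of `z ^ m` in the expansion of `f`. -/
def coeffAt (m : ℕ) (f : ℂ × E → ℂ) (y : E) : ℂ := (firstQuot^[m] f) (0, y)

lemma analyticAt_iterate_firstQuot {f : ℂ × E → ℂ} {y₀ : E} (hf : AnalyticAt ℂ f (0, y₀)) (m : ℕ) :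
    AnalyticAt ℂ (firstQuot^[m] f) (0, y₀) := by
  induction m with
  | zero => exact hf
  | succ m ih =>
    rw [Function.iterate_succ_apply']
    exact analyticAt_firstQuot ih

lemma analyticAt_coeffAt {f : ℂ × E → ℂ} {y₀ : E} (hf : AnalyticAt ℂ f (0, y₀)) (m : ℕ) :
    AnalyticAt ℂ (coeffAt m f) y₀ :=
  (analyticAt_iterate_firstQuot hf m).comp (f := fun y : E => ((0 : ℂ), y)) (by fun_prop)

lemma coeffAt_eq {E : Type*} {m : ℕ} {f : ℂ × E → ℂ} {g : ℂ → ℂ} {y : E} (hg : ContinuousAt g 0)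
    (h : ∀ᶠ z in 𝓝 (0 : ℂ), f (z, y) = z ^ m * g z) : coeffAt m f y = g 0 := by
  induction m generalizing f with
  | zero => simpa [coeffAt] using h.self_of_nhds
  | succ m ih =>
    rw [coeffAt, Function.iterate_succ_apply]
    refine ih (firstQuot_mul_eq (g := fun z => z ^ m * g z) (by fun_prop) ?_)
    filter_upwards [h] with z hz
    rw [hz]
    ring

end Quotient

section LocalInverse

lemma exists_analytic_inverse {α β : ℂ × ℂ → ℂ} (hα : AnalyticAt ℂ α 0) (hβ : AnalyticAt ℂ β 0)
    (hα0 : α 0 ≠ 0) (hβ0 : β 0 ≠ 0) :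
    ∃ κ : ℂ × ℂ → ℂ × ℂ, AnalyticAt ℂ κ 0 ∧ κ 0 = 0 ∧
      (∀ᶠ p in 𝓝 (0 : ℂ × ℂ), κ (p.1 * α p, p.2 * β p) = p) ∧
      ∀ᶠ p in 𝓝 (0 : ℂ × ℂ), ((κ p).1 * α (κ p), (κ p).2 * β (κ p)) = p := by
  let Φ : ℂ × ℂ → ℂ × ℂ := fun p => (p.1 * α p, p.2 * β p)
  have hΦ : AnalyticAt ℂ Φ 0 := by
    refine AnalyticAt.prod ?_ ?_ <;> fun_prop
  let i : (ℂ × ℂ) ≃L[ℂ] (ℂ × ℂ) :=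
    (ContinuousLinearEquiv.unitsEquivAut ℂ (.mk0 _ hα0)).prodCongr
      (ContinuousLinearEquiv.unitsEquivAut ℂ (.mk0 _ hβ0))
  have hfd : fderiv ℂ Φ 0 = i := by
    refine HasFDerivAt.fderiv ?_
    have h1 := (hasFDerivAt_fst (𝕜 := ℂ) (E := ℂ) (F := ℂ) (p := 0)).mul
      hα.differentiableAt.hasFDerivAt
    have h2 := (hasFDerivAt_snd (𝕜 := ℂ) (E := ℂ) (F := ℂ) (p := 0)).mul
      hβ.differentiableAt.hasFDerivAt
    refine (h1.prodMk h2).congr_fderiv ?_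
    ext <;> simp [i, ContinuousLinearEquiv.unitsEquivAut]
  have hs : HasStrictFDerivAt Φ (i : (ℂ × ℂ) →L[ℂ] (ℂ × ℂ)) 0 := by
    rw [← hfd]
    exact hΦ.hasStrictFDerivAt
  have hΦ0 : Φ 0 = 0 := by simp [Φ]
  refine ⟨hs.localInverse Φ i 0, ?_, ?_, hs.eventually_left_inverse, ?_⟩
  · have := (hs.toOpenPartialHomeomorph Φ).analyticAt_symm' (i := i)
      hs.mem_toOpenPartialHomeomorph_source hΦ hfd
    rw [hs.toOpenPartialHomeomorph_coe, hΦ0] at this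
    exact this
  · have := hs.localInverse_apply_image
    rwa [hΦ0] at this
  · have := hs.eventually_right_inverse
    rw [hΦ0] at this
    exact this

/-- Inversion in the first variable of `(Y, χ) ↦ Y * h (Y, χ)`. -/
lemma exists_inverse_fst {h : ℂ × ℂ → ℂ} (hh : AnalyticAt ℂ h 0) (h0 : h 0 = 1) :
    ∃ s : ℂ × ℂ → ℂ, AnalyticAt ℂ s 0 ∧ s 0 = 1 ∧
      ∀ᶠ p in 𝓝 (0 : ℂ × ℂ), p.1 * h p * s (p.1 * h p, p.2) = p.1 := by
  obtain ⟨κ, hκ, hκ0, hl, -⟩ := exists_analytic_inverse hh (β := fun _ => 1) analyticAt_const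
    (by simp [h0]) one_ne_zero
  simp only [mul_one] at hl
  have hσ : AnalyticAt ℂ (fun p => (κ p).1) (0, 0) := hκ.fst_comp
  refine ⟨firstQuot fun p => (κ p).1, analyticAt_firstQuot hσ, ?_, ?_⟩
  · have hc : ContinuousAt (fun t : ℂ => h (t, 0) * firstQuot (fun p => (κ p).1) (t * h (t, 0), 0)) 0 := by
      have c1 : ContinuousAt (fun t : ℂ => h (t, 0)) 0 :=
        hh.continuousAt.comp_of_eq (f := fun t : ℂ => (t, (0 : ℂ))) (by fun_prop) rfl
      refine c1.mul ((analyticAt_firstQuot hσ).continuousAt.comp_of_eq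
        (f := fun t : ℂ => (t * h (t, 0), (0 : ℂ))) (by fun_prop) (by simp))
    have key : ∀ᶠ t in 𝓝[≠] (0 : ℂ),
        h (t, 0) * firstQuot (fun p => (κ p).1) (t * h (t, 0), 0) = 1 := by
      have hl' : ∀ᶠ t in 𝓝 (0 : ℂ), κ (t * h (t, 0), 0) = (t, 0) :=
        (Continuous.tendsto' (f := fun t : ℂ => (t, (0 : ℂ))) (by fun_prop) _ _ rfl).eventually hl
      filter_upwards [hl'.filter_mono nhdsWithin_le_nhds, self_mem_nhdsWithin] with t ht ht0
      have ht0' : t ≠ 0 := ht0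
      have := eq_add_mul_firstQuot (fun p => (κ p).1) (t * h (t, 0)) 0
      rw [ht, show ((0 : ℂ), (0 : ℂ)) = 0 from rfl, hκ0] at this
      simp only [Prod.fst_zero, zero_add] at this
      rw [mul_assoc] at this
      refine mul_left_cancel₀ ht0' ?_
      rw [mul_one]
      exact this.symm
    have := tendsto_nhds_unique (hc.tendsto.mono_left nhdsWithin_le_nhds)
      ((tendsto_const_nhds (x := (1 : ℂ))).congr' (key.mono fun t ht => ht.symm))
    simpa [h0, show ((0 : ℂ), (0 : ℂ)) = 0 from rfl] using this
  · have h0' : ∀ᶠ p : ℂ × ℂ in 𝓝 0, κ (0, p.2) = (0, p.2) := by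
      have := (Continuous.tendsto' (f := fun p : ℂ × ℂ => ((0 : ℂ), p.2)) (by fun_prop)
        0 0 rfl).eventually hl
      simpa using this
    filter_upwards [hl, h0'] with p hp hp0
    have := eq_add_mul_firstQuot (fun p => (κ p).1) (p.1 * h p) p.2
    rw [hp, hp0, zero_add] at this
    exact this.symm

end LocalInverse

section Roots

/-- The branch of the `n`-th root near `1`. -/
def rootNear (n : ℕ) (x : ℂ) : ℂ := x ^ ((n : ℂ)⁻¹)

lemma rootNear_one (n : ℕ) : rootNear n 1 = 1 := by simp [rootNear]

lemma rootNear_pow {n : ℕ} (hn : n ≠ 0) (x : ℂ) : rootNear n x ^ n = x :=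
  Complex.cpow_nat_inv_pow x hn

lemma AnalyticAt.rootNear {E : Type*} [NormedAddCommGroup E] [NormedSpace ℂ E] {f : E → ℂ} {x : E}
    (n : ℕ) (hf : AnalyticAt ℂ f x) (h1 : f x = 1) : AnalyticAt ℂ (fun y => rootNear n (f y)) x :=
  hf.cpow analyticAt_const (by simp [h1])

lemma eventually_eq_of_pow_eq {X : Type*} [TopologicalSpace X] {x : X} {n : ℕ} (hn : n ≠ 0)
    {f g : X → ℂ} (hf : ContinuousAt f x) (hg : ContinuousAt g x) (hfx : f x = 1) (hgx : g x = 1)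
    (h : ∀ᶠ y in 𝓝 x, f y ^ n = g y ^ n) : ∀ᶠ y in 𝓝 x, f y = g y := by
  have hd : HasStrictDerivAt (fun z : ℂ => z ^ n) (n * 1 ^ (n - 1)) 1 := hasStrictDerivAt_pow n 1
  have hne : ((n : ℂ) * 1 ^ (n - 1)) ≠ 0 := by simpa using hn
  have hl := hd.eventually_left_inverse hne
  have h1 := (hfx ▸ hf.tendsto : Tendsto f (𝓝 x) (𝓝 1)).eventually hl
  have h2 := (hgx ▸ hg.tendsto : Tendsto g (𝓝 x) (𝓝 1)).eventually hl
  filter_upwards [h, h1, h2] with y h3 h4 h5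
  rw [← h4, ← h5, h3]

end Roots

section Cancel

lemma eq_of_pow_mul_eq_pow_mul {m n : ℕ} {a b : ℂ → ℂ} (ha : ContinuousAt a 0)
    (hb : ContinuousAt b 0) (ha0 : a 0 ≠ 0) (hb0 : b 0 ≠ 0)
    (h : ∀ᶠ z in 𝓝[≠] (0 : ℂ), z ^ m * a z = z ^ n * b z) : m = n ∧ a 0 = b 0 := by
  have aux : ∀ {m n : ℕ} {a b : ℂ → ℂ}, ContinuousAt a 0 → ContinuousAt b 0 → b 0 ≠ 0 →
      (∀ᶠ z in 𝓝[≠] (0 : ℂ), z ^ m * a z = z ^ n * b z) → m ≤ n → m = n ∧ a 0 = b 0 ∨ a 0 = 0 := by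
    intro m n a b ha hb hb0 h hmn
    have h1 : ∀ᶠ z in 𝓝[≠] (0 : ℂ), a z = z ^ (n - m) * b z := by
      filter_upwards [h, self_mem_nhdsWithin] with z hz hz0
      have hz0' : z ≠ 0 := hz0
      refine mul_left_cancel₀ (pow_ne_zero m hz0') ?_
      rw [hz, ← mul_assoc, ← pow_add, Nat.add_sub_cancel' hmn]
    have hc : ContinuousAt (fun z => z ^ (n - m) * b z) 0 := by fun_prop
    have h2 := tendsto_nhds_unique ((ha.tendsto.mono_left nhdsWithin_le_nhds).congr' h1)
      (hc.tendsto.mono_left nhdsWithin_le_nhds)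
    rcases hmn.eq_or_lt with rfl | hlt
    · left
      simpa using h2
    · right
      rw [h2, zero_pow (by omega), zero_mul]
  rcases le_total m n with hmn | hmn
  · exact (aux ha hb hb0 h hmn).resolve_right ha0
  · have := (aux hb ha ha0 (h.mono fun z hz => hz.symm) hmn).resolve_right hb0
    exact ⟨this.1.symm, this.2.symm⟩

end Cancel

section Segre

/-- Derivative of `q` in its first variable. -/
def dZ (q : ℂ × ℂ × ℂ → ℂ) (p : ℂ × ℂ × ℂ) : ℂ := fderiv ℂ q p (1, 0, 0)

/-- Derivative of `q` in its second variable. -/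
def dX (q : ℂ × ℂ × ℂ → ℂ) (p : ℂ × ℂ × ℂ) : ℂ := fderiv ℂ q p (0, 1, 0)

/-- Derivative of `q` in its third variable. -/
def dT (q : ℂ × ℂ × ℂ → ℂ) (p : ℂ × ℂ × ℂ) : ℂ := fderiv ℂ q p (0, 0, 1)

lemma AnalyticAt.fderiv_apply_const {E : Type*} [NormedAddCommGroup E] [NormedSpace ℂ E]
    {f : E → ℂ} {x : E} (hf : AnalyticAt ℂ f x) (v : E) :
    AnalyticAt ℂ (fun y => fderiv ℂ f y v) x :=
  ((ContinuousLinearMap.apply ℂ ℂ v).analyticAt _).comp hf.fderiv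

lemma AnalyticAt.dZ {q : ℂ × ℂ × ℂ → ℂ} {p : ℂ × ℂ × ℂ} (h : AnalyticAt ℂ q p) :
    AnalyticAt ℂ (dZ q) p := h.fderiv_apply_const _

lemma AnalyticAt.dX {q : ℂ × ℂ × ℂ → ℂ} {p : ℂ × ℂ × ℂ} (h : AnalyticAt ℂ q p) :
    AnalyticAt ℂ (dX q) p := h.fderiv_apply_const _

lemma AnalyticAt.dT {q : ℂ × ℂ × ℂ → ℂ} {p : ℂ × ℂ × ℂ} (h : AnalyticAt ℂ q p) :
    AnalyticAt ℂ (dT q) p := h.fderiv_apply_const _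

lemma fderiv_apply_eq_add {q : ℂ × ℂ × ℂ → ℂ} (p : ℂ × ℂ × ℂ) (x y w : ℂ) :
    fderiv ℂ q p (x, y, w) = x * dZ q p + y * dX q p + w * dT q p := by
  have : (x, y, w) = x • ((1 : ℂ), (0 : ℂ), (0 : ℂ)) + y • ((0 : ℂ), (1 : ℂ), (0 : ℂ)) +
      w • ((0 : ℂ), (0 : ℂ), (1 : ℂ)) := by simp
  rw [this, map_add, map_add, map_smul, map_smul, map_smul]
  rfl

/-- The normal form of the Segre family `q (z, χ, 0)` along the curves `z = t * χ ^ k`. -/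
structure IsSegreForm (q : ℂ × ℂ × ℂ → ℂ) (m k : ℕ) (R U W : ℂ × ℂ → ℂ) : Prop where
  m_ne : m ≠ 0
  k_ne : k ≠ 0
  analyticAt_R : AnalyticAt ℂ R 0
  analyticAt_U : AnalyticAt ℂ U 0
  analyticAt_W : AnalyticAt ℂ W 0
  eq_R : ∀ᶠ p : ℂ × ℂ in 𝓝 0, q (p.1, p.2, 0) = p.1 ^ m * R p
  R_zero : ∀ᶠ χ in 𝓝 (0 : ℂ), R (0, χ) = χ ^ k * U (0, χ)
  eq_U : ∀ᶠ p : ℂ × ℂ in 𝓝 0, q (p.1 * p.2 ^ k, p.2, 0) = p.1 ^ m * p.2 ^ (k * m + k) * U p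
  eq_W : ∀ᶠ p : ℂ × ℂ in 𝓝 0,
    dX q (p.1 * p.2 ^ k, p.2, 0) = p.1 ^ m * p.2 ^ (k * m + (k - 1)) * W p
  U_ne : U 0 ≠ 0
  W_ne : W 0 ≠ 0

lemma eventually_eq_pow_mul_iterate {f : ℂ × ℂ → ℂ} {m : ℕ}
    (h : ∀ j < m, ∀ᶠ χ in 𝓝 (0 : ℂ), coeffAt j f χ = 0) :
    ∀ᶠ p : ℂ × ℂ in 𝓝 0, f p = p.1 ^ m * (firstQuot^[m] f) p := by
  induction m with
  | zero => simp
  | succ m ih =>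
    have h1 : ∀ᶠ p : ℂ × ℂ in 𝓝 0, coeffAt m f p.2 = 0 :=
      (Continuous.tendsto' continuous_snd (0 : ℂ × ℂ) 0 rfl).eventually (h m (by omega))
    filter_upwards [ih fun j hj => h j (by omega), h1] with p hp hp1
    have := eq_add_mul_firstQuot (firstQuot^[m] f) p.1 p.2
    rw [← coeffAt, hp1, zero_add, ← Function.iterate_succ_apply' firstQuot m f] at this
    rw [hp, this]
    ring

lemma exists_coeffAt_ne_zero {f : ℂ × ℂ → ℂ} (hf : AnalyticAt ℂ f 0)
    (hne : ¬ ∀ᶠ p in 𝓝 (0 : ℂ × ℂ), f p = 0) :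
    ∃ m, ¬ ∀ᶠ χ in 𝓝 (0 : ℂ), coeffAt m f χ = 0 := by
  by_contra! hcon
  obtain ⟨δ, hδ, hball⟩ := Metric.eventually_nhds_iff_ball.mp hf.eventually_analyticAt
  obtain ⟨p₀, hp₀, hfp₀⟩ : ∃ p ∈ Metric.ball (0 : ℂ × ℂ) δ, f p ≠ 0 := by
    by_contra! h
    exact hne (Metric.eventually_nhds_iff_ball.mpr ⟨δ, hδ, h⟩)
  let g : ℂ → ℂ := fun t => f (t • p₀)
  let V : Set ℂ := {t | t • p₀ ∈ Metric.ball (0 : ℂ × ℂ) δ}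
  have hV : IsPreconnected V := by
    have hconv : Convex ℝ V := by
      exact (convex_ball (0 : ℂ × ℂ) δ).linear_preimage
        ((LinearMap.toSpanSingleton ℂ (ℂ × ℂ) p₀).restrictScalars ℝ)
    exact hconv.isPreconnected
  have hline : ∀ t, AnalyticAt ℂ (fun t : ℂ => t • p₀) t := fun t =>
    analyticAt_id.smul analyticAt_const
  have hg : AnalyticOnNhd ℂ g V := fun t ht => (hball _ ht).comp (f := fun t : ℂ => t • p₀) (hline t)
  have h0V : (0 : ℂ) ∈ V := by simp [V, hδ]
  have h1V : (1 : ℂ) ∈ V := by simpa [V] using hp₀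
  have hgne : ¬ ∀ᶠ t in 𝓝 (0 : ℂ), g t = 0 := fun h => by
    have := hg.eqOn_zero_of_preconnected_of_eventuallyEq_zero hV h0V h h1V
    simp [g] at this
    exact hfp₀ this
  obtain ⟨N, h, hh, hh0, hgh⟩ := (hg 0 h0V).exists_eventuallyEq_pow_smul_nonzero_iff.mpr hgne
  have h1 := eventually_eq_pow_mul_iterate (f := f) (m := N + 1) fun j _ => hcon j
  have htend : Tendsto (fun t : ℂ => t • p₀) (𝓝 0) (𝓝 0) :=
    Continuous.tendsto' (by fun_prop) _ _ (by simp)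
  have h2 := htend.eventually h1
  have hc : ContinuousAt (fun t : ℂ => t * (p₀.1 ^ (N + 1) * (firstQuot^[N + 1] f) (t • p₀))) 0 := by
    have h3 : ContinuousAt (fun t : ℂ => (firstQuot^[N + 1] f) (t • p₀)) 0 :=
      (analyticAt_iterate_firstQuot (y₀ := (0 : ℂ)) hf (N + 1)).continuousAt.comp_of_eq
        (f := fun t : ℂ => t • p₀) (by fun_prop) (zero_smul ℂ p₀)
    fun_prop
  have key : ∀ᶠ t in 𝓝[≠] (0 : ℂ),
      h t = t * (p₀.1 ^ (N + 1) * (firstQuot^[N + 1] f) (t • p₀)) := by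
    filter_upwards [hgh.filter_mono nhdsWithin_le_nhds, h2.filter_mono nhdsWithin_le_nhds,
      self_mem_nhdsWithin] with t ht1 ht2 ht0
    have ht0' : t ≠ 0 := ht0
    refine mul_left_cancel₀ (pow_ne_zero N ht0') ?_
    rw [sub_zero, smul_eq_mul] at ht1
    rw [← ht1]
    change f (t • p₀) = _
    rw [ht2, Prod.smul_fst, smul_eq_mul]
    ring
  have := tendsto_nhds_unique ((hh.continuousAt.tendsto.mono_left nhdsWithin_le_nhds).congr' key)
    (hc.tendsto.mono_left nhdsWithin_le_nhds)
  rw [zero_mul] at this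
  exact hh0 this

lemma exists_isSegreForm {q : ℂ × ℂ × ℂ → ℂ} (hq : AnalyticAt ℂ q 0)
    (hq1 : ∀ᶠ z in 𝓝 (0 : ℂ), q (z, 0, 0) = 0) (hq2 : ∀ᶠ χ in 𝓝 (0 : ℂ), q (0, χ, 0) = 0)
    (hft : ¬ ∀ᶠ p : ℂ × ℂ in 𝓝 0, q (p.1, p.2, 0) = 0) :
    ∃ (m k : ℕ) (R U W : ℂ × ℂ → ℂ), IsSegreForm q m k R U W := by
  classical
  let f : ℂ × ℂ → ℂ := fun p => q (p.1, p.2, 0)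
  have hf : AnalyticAt ℂ f (0, 0) :=
    hq.comp_of_eq (f := fun p : ℂ × ℂ => (p.1, p.2, (0 : ℂ))) (by fun_prop) rfl
  have hex := exists_coeffAt_ne_zero hf hft
  let m := Nat.find hex
  have hm : ¬ ∀ᶠ χ in 𝓝 (0 : ℂ), coeffAt m f χ = 0 := Nat.find_spec hex
  have hfm := eventually_eq_pow_mul_iterate (f := f) (m := m) fun j hj =>
    not_not.mp (Nat.find_min hex hj)
  have hm0 : m ≠ 0 := by
    intro h0
    rw [h0] at hm
    exact hm hq2
  let R := firstQuot^[m] f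
  have hR : AnalyticAt ℂ R (0, 0) := analyticAt_iterate_firstQuot hf m
  obtain ⟨k, u, hu, hu0, hku⟩ :=
    (analyticAt_coeffAt hf m).exists_eventuallyEq_pow_smul_nonzero_iff.mpr hm
  simp only [sub_zero, smul_eq_mul] at hku
  have hk0 : k ≠ 0 := by
    rintro rfl
    simp only [pow_zero, one_mul] at hku
    have h1 : R (0, 0) = u 0 := hku.self_of_nhds
    have h2 : ContinuousAt (fun z : ℂ => R (z, 0)) 0 :=
      hR.continuousAt.comp_of_eq (f := fun z : ℂ => (z, (0 : ℂ))) (by fun_prop) rfl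
    have h3 : ∀ᶠ z in 𝓝[≠] (0 : ℂ), R (z, 0) = 0 := by
      have h4 := (Continuous.tendsto' (f := fun z : ℂ => (z, (0 : ℂ))) (by fun_prop)
        0 0 rfl).eventually hfm
      filter_upwards [h4.filter_mono nhdsWithin_le_nhds, hq1.filter_mono nhdsWithin_le_nhds,
        self_mem_nhdsWithin] with z hz1 hz2 hz0
      have hz0' : z ≠ 0 := hz0
      change q (z, 0, 0) = _ at hz1
      rw [hz2] at hz1
      exact (mul_eq_zero.mp hz1.symm).resolve_left (pow_ne_zero _ hz0')
    have := tendsto_nhds_unique (h2.tendsto.mono_left nhdsWithin_le_nhds)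
      (tendsto_const_nhds.congr' (h3.mono fun z hz => hz.symm))
    exact hu0 (h1 ▸ this)
  obtain ⟨S, hS, hRS⟩ : ∃ S : ℂ × ℂ → ℂ, AnalyticAt ℂ S (0, 0) ∧
      ∀ᶠ p : ℂ × ℂ in 𝓝 0, R p = p.2 ^ k * u p.2 + p.1 * S p := by
    refine ⟨firstQuot R, analyticAt_firstQuot hR, ?_⟩
    have h1 := (Continuous.tendsto' continuous_snd (0 : ℂ × ℂ) 0 rfl).eventually hku
    filter_upwards [h1] with p hp
    rw [← hp]
    exact eq_add_mul_firstQuot R p.1 p.2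
  have hcurve : Tendsto (fun p : ℂ × ℂ => (p.1 * p.2 ^ k, p.2)) (𝓝 0) (𝓝 0) :=
    Continuous.tendsto' (by fun_prop) _ _ (by simp)
  obtain ⟨S', hS', hSS'⟩ : ∃ S' : ℂ × ℂ → ℂ, AnalyticAt ℂ S' (0, 0) ∧
      ∀ p, S' p = fderiv ℂ S p (0, 1) :=
    ⟨fun p => fderiv ℂ S p (0, 1), hS.fderiv_apply_const _, fun _ => rfl⟩
  have hu2 : AnalyticAt ℂ (fun p : ℂ × ℂ => u p.2) 0 :=
    hu.comp_of_eq (f := fun p : ℂ × ℂ => p.2) (by fun_prop) rfl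
  have hu'2 : AnalyticAt ℂ (fun p : ℂ × ℂ => deriv u p.2) 0 :=
    hu.deriv.comp_of_eq (f := fun p : ℂ × ℂ => p.2) (by fun_prop) rfl
  have hcurve' : AnalyticAt ℂ (fun p : ℂ × ℂ => (p.1 * p.2 ^ k, p.2)) 0 := by fun_prop
  have hS2 : AnalyticAt ℂ (fun p : ℂ × ℂ => S (p.1 * p.2 ^ k, p.2)) 0 :=
    hS.comp_of_eq hcurve' (by simp)
  have hS'2 : AnalyticAt ℂ (fun p : ℂ × ℂ => S' (p.1 * p.2 ^ k, p.2)) 0 :=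
    hS'.comp_of_eq hcurve' (by simp)
  refine ⟨m, k, R, fun p => u p.2 + p.1 * S (p.1 * p.2 ^ k, p.2),
    fun p => k * u p.2 + p.2 * deriv u p.2 + p.1 * p.2 * S' (p.1 * p.2 ^ k, p.2),
    hm0, hk0, hR, hu2.fun_add (analyticAt_fst.fun_mul hS2),
    ((analyticAt_const.fun_mul hu2).fun_add (analyticAt_snd.fun_mul hu'2)).fun_add
      ((analyticAt_fst.fun_mul analyticAt_snd).fun_mul hS'2), hfm, ?_, ?_, ?_, by simpa using hu0,
    by simpa using ⟨hk0, hu0⟩⟩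
  · filter_upwards [hku] with χ hχ
    simp only [zero_mul, add_zero]
    exact hχ
  · filter_upwards [hcurve.eventually hfm, hcurve.eventually hRS] with p hp1 hp2
    change q _ = _ at hp1
    rw [hp1]
    change _ * R _ = _
    rw [hp2]
    ring
  · have e1 : ∀ᶠ p : ℂ × ℂ in 𝓝 0, AnalyticAt ℂ q (p.1, p.2, 0) :=
      (Continuous.tendsto' (f := fun p : ℂ × ℂ => (p.1, p.2, (0 : ℂ))) (by fun_prop)
        0 0 rfl).eventually hq.eventually_analyticAt
    have e2 : ∀ᶠ p : ℂ × ℂ in 𝓝 0, AnalyticAt ℂ u p.2 :=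
      (Continuous.tendsto' continuous_snd (0 : ℂ × ℂ) 0 rfl).eventually hu.eventually_analyticAt
    filter_upwards [hcurve.eventually e1, e2, hcurve.eventually (hfm.and hRS).eventually_nhds,
      hcurve.eventually hS.eventually_analyticAt] with p hp1 hp2 hp3 hp4
    have hl : HasDerivAt (fun χ => q (p.1 * p.2 ^ k, χ, 0)) (dX q (p.1 * p.2 ^ k, p.2, 0)) p.2 :=
      hp1.differentiableAt.hasFDerivAt.comp_hasDerivAt p.2
        (f := fun χ : ℂ => (p.1 * p.2 ^ k, χ, (0 : ℂ)))
        ((hasDerivAt_const _ _).prodMk ((hasDerivAt_id _).prodMk (hasDerivAt_const _ _)))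
    have hSd : HasDerivAt (fun χ => S (p.1 * p.2 ^ k, χ)) (S' (p.1 * p.2 ^ k, p.2)) p.2 :=
      hSS' _ ▸ hp4.differentiableAt.hasFDerivAt.comp_hasDerivAt p.2
        (f := fun χ : ℂ => (p.1 * p.2 ^ k, χ))
        ((hasDerivAt_const _ _).prodMk (hasDerivAt_id _))
    have hr := ((((hasDerivAt_id p.2).pow k).mul hp2.differentiableAt.hasDerivAt).add
      (hSd.const_mul (p.1 * p.2 ^ k))).const_mul ((p.1 * p.2 ^ k) ^ m)
    have heq : ∀ᶠ χ in 𝓝 p.2, q (p.1 * p.2 ^ k, χ, 0) =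
        (p.1 * p.2 ^ k) ^ m * (χ ^ k * u χ + p.1 * p.2 ^ k * S (p.1 * p.2 ^ k, χ)) := by
      have ht : Tendsto (fun χ : ℂ => (p.1 * p.2 ^ k, χ)) (𝓝 p.2) (𝓝 (p.1 * p.2 ^ k, p.2)) :=
        Continuous.tendsto' (by fun_prop) _ _ rfl
      filter_upwards [ht.eventually hp3] with χ hχ
      have hχ1 : q (p.1 * p.2 ^ k, χ, 0) = _ := hχ.1
      rw [hχ1]
      change _ * R _ = _
      rw [hχ.2]
    have h5 := hl.unique (hr.congr_of_eventuallyEq heq)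
    rw [h5]
    obtain ⟨n, rfl⟩ := Nat.exists_eq_succ_of_ne_zero hk0
    simp only [id, Nat.succ_eq_add_one, Nat.add_sub_cancel, Pi.pow_apply]
    push_cast
    ring

end Segre

section Jets

/-- Derivative of `f` in its first variable. -/
def dOne (f : ℂ × ℂ → ℂ) (p : ℂ × ℂ) : ℂ := fderiv ℂ f p (1, 0)

/-- Derivative of `f` in its second variable. -/
def dTwo (f : ℂ × ℂ → ℂ) (p : ℂ × ℂ) : ℂ := fderiv ℂ f p (0, 1)

lemma AnalyticAt.dOne {f : ℂ × ℂ → ℂ} {p : ℂ × ℂ} (h : AnalyticAt ℂ f p) :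
    AnalyticAt ℂ (dOne f) p := h.fderiv_apply_const _

lemma AnalyticAt.dTwo {f : ℂ × ℂ → ℂ} {p : ℂ × ℂ} (h : AnalyticAt ℂ f p) :
    AnalyticAt ℂ (dTwo f) p := h.fderiv_apply_const _

lemma fderiv_apply_eq_add₂ {f : ℂ × ℂ → ℂ} (p : ℂ × ℂ) (x y : ℂ) :
    fderiv ℂ f p (x, y) = x * dOne f p + y * dTwo f p := by
  have : (x, y) = x • ((1 : ℂ), (0 : ℂ)) + y • ((0 : ℂ), (1 : ℂ)) := by simp
  rw [this, map_add, map_smul, map_smul]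
  rfl

lemma hasDerivAt_comp₂ {f : ℂ × ℂ → ℂ} {u v : ℂ → ℂ} {u' v' t : ℂ} {p : ℂ × ℂ}
    (hf : DifferentiableAt ℂ f p) (hu : HasDerivAt u u' t) (hv : HasDerivAt v v' t)
    (hp : p = (u t, v t)) :
    HasDerivAt (fun s => f (u s, v s)) (u' * dOne f p + v' * dTwo f p) t := by
  subst hp
  rw [← fderiv_apply_eq_add₂]
  exact hf.hasFDerivAt.comp_hasDerivAt t (f := fun s => (u s, v s)) (hu.prodMk hv)

lemma hasDerivAt_comp₃ {f : ℂ × ℂ × ℂ → ℂ} {u v w : ℂ → ℂ} {u' v' w' t : ℂ} {p : ℂ × ℂ × ℂ}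
    (hf : DifferentiableAt ℂ f p) (hu : HasDerivAt u u' t) (hv : HasDerivAt v v' t)
    (hw : HasDerivAt w w' t) (hp : p = (u t, v t, w t)) :
    HasDerivAt (fun s => f (u s, v s, w s)) (u' * dZ f p + v' * dX f p + w' * dT f p) t := by
  subst hp
  rw [← fderiv_apply_eq_add]
  exact hf.hasFDerivAt.comp_hasDerivAt t (f := fun s => (u s, v s, w s))
    (hu.prodMk (hv.prodMk hw))

lemma deriv_slice_fst {f : ℂ × ℂ → ℂ} {z w : ℂ} (hf : DifferentiableAt ℂ f (z, w)) :
    deriv (fun s => f (s, w)) z = dOne f (z, w) := by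
  simpa using (hasDerivAt_comp₂ hf (hasDerivAt_id z) (hasDerivAt_const z w) rfl).deriv

lemma deriv_slice_snd {f : ℂ × ℂ → ℂ} {z w : ℂ} (hf : DifferentiableAt ℂ f (z, w)) :
    deriv (fun s => f (z, s)) w = dTwo f (z, w) := by
  simpa using (hasDerivAt_comp₂ hf (hasDerivAt_const w z) (hasDerivAt_id w) rfl).deriv

variable {F : ℂ → ℂ → ℂ}

lemma pd_one_zero (hF : AnalyticAt ℂ (fun p : ℂ × ℂ => F p.1 p.2) 0) :
    pd F 1 0 0 0 = dOne (fun p => F p.1 p.2) 0 :=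
  deriv_slice_fst (f := fun p : ℂ × ℂ => F p.1 p.2) hF.differentiableAt

lemma pd_zero_one (hF : AnalyticAt ℂ (fun p : ℂ × ℂ => F p.1 p.2) 0) :
    pd F 0 1 0 0 = dTwo (fun p => F p.1 p.2) 0 :=
  deriv_slice_snd (f := fun p : ℂ × ℂ => F p.1 p.2) hF.differentiableAt

lemma pd_one_one (hF : AnalyticAt ℂ (fun p : ℂ × ℂ => F p.1 p.2) 0) :
    pd F 1 1 0 0 = dOne (dTwo fun p => F p.1 p.2) 0 := by
  have h1 : ∀ᶠ z : ℂ in 𝓝 0, deriv (F z) 0 = dTwo (fun p => F p.1 p.2) (z, 0) := by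
    have := (Continuous.tendsto' (f := fun z : ℂ => (z, (0 : ℂ))) (by fun_prop) 0 0 rfl).eventually
      hF.eventually_analyticAt
    filter_upwards [this] with z hz
    exact deriv_slice_snd (f := fun p : ℂ × ℂ => F p.1 p.2) hz.differentiableAt
  exact (Filter.EventuallyEq.deriv_eq h1).trans (deriv_slice_fst hF.dTwo.differentiableAt)

lemma pd_zero_two (hF : AnalyticAt ℂ (fun p : ℂ × ℂ => F p.1 p.2) 0) :
    pd F 0 2 0 0 = dTwo (dTwo fun p => F p.1 p.2) 0 := by
  have h1 : ∀ᶠ w : ℂ in 𝓝 0, deriv (F 0) w = dTwo (fun p => F p.1 p.2) (0, w) := by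
    have := (Continuous.tendsto' (f := fun w : ℂ => ((0 : ℂ), w)) (by fun_prop) 0 0 rfl).eventually
      hF.eventually_analyticAt
    filter_upwards [this] with z hz
    exact deriv_slice_snd (f := fun p : ℂ × ℂ => F p.1 p.2) hz.differentiableAt
  exact (Filter.EventuallyEq.deriv_eq h1).trans (deriv_slice_snd hF.dTwo.differentiableAt)

end Jets

section NormalCoordinates

/-- Pairs consisting of a `2`-jet and a candidate for its conjugate. -/
abbrev JetPair := (Fin 10 → ℂ) × (Fin 10 → ℂ)

/-- The `i`-th coordinate of the jet. -/
def jetC (i : Fin 10) (l : JetPair) : ℂ := l.1 i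

/-- The first coordinate of the conjugate jet. -/
def jetB (l : JetPair) : ℂ := l.2 0

@[fun_prop]
lemma AnalyticAt.jetC_comp {E : Type*} [NormedAddCommGroup E] [NormedSpace ℂ E] {f : E → JetPair}
    {x : E} (i : Fin 10) (hf : AnalyticAt ℂ f x) : AnalyticAt ℂ (fun y => jetC i (f y)) x :=
  ((ContinuousLinearMap.proj (R := ℂ) (φ := fun _ : Fin 10 => ℂ) i).analyticAt _).comp hf.fst_comp

@[fun_prop]
lemma AnalyticAt.jetB_comp {E : Type*} [NormedAddCommGroup E] [NormedSpace ℂ E] {f : E → JetPair}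
    {x : E} (hf : AnalyticAt ℂ f x) : AnalyticAt ℂ (fun y => jetB (f y)) x :=
  ((ContinuousLinearMap.proj (R := ℂ) (φ := fun _ : Fin 10 => ℂ) 0).analyticAt _).comp hf.snd_comp

/-- The domain of jet pairs with invertible linear part. -/
def JetDom : Set JetPair := {l | jetC 0 l ≠ 0 ∧ jetC 3 l ≠ 0 ∧ jetB l ≠ 0}

/-- The normality conditions for an analytic function germ at `0`. -/
structure IsNormalGerm (q : ℂ × ℂ × ℂ → ℂ) : Prop where
  an : AnalyticAt ℂ q 0
  mid : ∀ᶠ p : ℂ × ℂ in 𝓝 0, q (p.1, 0, p.2) = p.2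
  left : ∀ᶠ p : ℂ × ℂ in 𝓝 0, q (0, p.1, p.2) = p.2

variable {q : ℂ × ℂ × ℂ → ℂ}

lemma IsNormalGerm.left_zero (h : IsNormalGerm q) : ∀ᶠ χ : ℂ in 𝓝 0, q (0, χ, 0) = 0 :=
  (Continuous.tendsto' (f := fun z : ℂ => (z, (0 : ℂ))) (by fun_prop) 0 0 rfl).eventually h.left

lemma IsNormalGerm.mid_zero (h : IsNormalGerm q) : ∀ᶠ z : ℂ in 𝓝 0, q (z, 0, 0) = 0 :=
  (Continuous.tendsto' (f := fun z : ℂ => (z, (0 : ℂ))) (by fun_prop) 0 0 rfl).eventually h.mid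

lemma IsNormalGerm.zero (h : IsNormalGerm q) : q 0 = 0 := h.left_zero.self_of_nhds

lemma IsNormalGerm.dT_left (h : IsNormalGerm q) : ∀ᶠ χ : ℂ in 𝓝 0, dT q (0, χ, 0) = 1 := by
  have h1 := (Continuous.tendsto' (f := fun z : ℂ => (z, (0 : ℂ))) (by fun_prop) 0 0
    rfl).eventually h.left.eventually_nhds
  have h2 := (Continuous.tendsto' (f := fun z : ℂ => ((0 : ℂ), z, (0 : ℂ))) (by fun_prop) 0 0
    rfl).eventually h.an.eventually_analyticAt
  filter_upwards [h1, h2] with χ h3 h4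
  have h5 := hasDerivAt_comp₃ h4.differentiableAt (hasDerivAt_const (0 : ℂ) (0 : ℂ))
    (hasDerivAt_const (0 : ℂ) χ) (hasDerivAt_id (0 : ℂ)) rfl
  have h6 : ∀ᶠ τ : ℂ in 𝓝 0, q (0, χ, τ) = τ :=
    (Continuous.tendsto' (f := fun τ : ℂ => (χ, τ)) (by fun_prop) 0 _ rfl).eventually h3
  have h7 := h5.unique ((hasDerivAt_id (0 : ℂ)).congr_of_eventuallyEq h6)
  simpa using h7

lemma IsNormalGerm.dT_zero (h : IsNormalGerm q) : dT q 0 = 1 := h.dT_left.self_of_nhds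

lemma IsNormalGerm.dX_left (h : IsNormalGerm q) : ∀ᶠ χ : ℂ in 𝓝 0, dX q (0, χ, 0) = 0 := by
  have h2 := (Continuous.tendsto' (f := fun z : ℂ => ((0 : ℂ), z, (0 : ℂ))) (by fun_prop) 0 0
    rfl).eventually h.an.eventually_analyticAt
  filter_upwards [h.left_zero.eventually_nhds, h2] with χ h3 h4
  have h5 := hasDerivAt_comp₃ h4.differentiableAt (hasDerivAt_const χ (0 : ℂ))
    (hasDerivAt_id χ) (hasDerivAt_const χ (0 : ℂ)) rfl
  have h7 := h5.unique ((hasDerivAt_const χ (0 : ℂ)).congr_of_eventuallyEq h3)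
  simpa using h7

lemma IsNormalGerm.dZ_zero (h : IsNormalGerm q) : dZ q 0 = 0 := by
  have h5 := hasDerivAt_comp₃ h.an.differentiableAt (hasDerivAt_id (0 : ℂ))
    (hasDerivAt_const (0 : ℂ) (0 : ℂ)) (hasDerivAt_const (0 : ℂ) (0 : ℂ)) rfl
  have h7 := h5.unique ((hasDerivAt_const (0 : ℂ) (0 : ℂ)).congr_of_eventuallyEq h.mid_zero)
  simpa using h7

end NormalCoordinates

section SegreMaps

/-- The first-order information on a map between Segre families with jet data `l`. -/
structure IsSegreMap (q q' : ℂ × ℂ × ℂ → ℂ) (l : JetPair) (F G : ℂ × ℂ → ℂ) (fb a : ℂ → ℂ) :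
    Prop where
  mem : l ∈ JetDom
  anF : AnalyticAt ℂ F 0
  anG : AnalyticAt ℂ G 0
  F_zero : F 0 = 0
  G_zero : ∀ᶠ z : ℂ in 𝓝 0, G (z, 0) = 0
  anfb : AnalyticAt ℂ fb 0
  ana : AnalyticAt ℂ a 0
  fb_zero : fb 0 = 0
  deriv_fb : deriv fb 0 = jetB l
  dOneF : dOne F 0 = jetC 0 l
  dTwoF : dTwo F 0 = jetC 1 l
  dTwoG : dTwo G 0 = jetC 3 l
  dOneTwoF : dOne (dTwo F) 0 = jetC 5 l
  dTwoTwoF : dTwo (dTwo F) 0 = jetC 6 l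
  dOneTwoG : dOne (dTwo G) 0 = jetC 8 l
  dTwoTwoG : dTwo (dTwo G) 0 = jetC 9 l
  eq_zero : ∀ᶠ p : ℂ × ℂ in 𝓝 0,
    G (p.1, q (p.1, p.2, 0)) = q' (F (p.1, q (p.1, p.2, 0)), fb p.2, 0)
  eq_chi : ∀ᶠ p : ℂ × ℂ in 𝓝 0,
    (dTwo G (p.1, q (p.1, p.2, 0)) - dZ q' (F (p.1, q (p.1, p.2, 0)), fb p.2, 0) *
      dTwo F (p.1, q (p.1, p.2, 0))) * dX q (p.1, p.2, 0) =
    dX q' (F (p.1, q (p.1, p.2, 0)), fb p.2, 0) * deriv fb p.2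
  eq_tau : ∀ᶠ p : ℂ × ℂ in 𝓝 0,
    (dTwo G (p.1, q (p.1, p.2, 0)) - dZ q' (F (p.1, q (p.1, p.2, 0)), fb p.2, 0) *
      dTwo F (p.1, q (p.1, p.2, 0))) * dT q (p.1, p.2, 0) =
    dX q' (F (p.1, q (p.1, p.2, 0)), fb p.2, 0) * a p.2 +
      dT q' (F (p.1, q (p.1, p.2, 0)), fb p.2, 0) * cj (dTwo G (cj p.2, 0))

lemma cj_cj (z : ℂ) : cj (cj z) = z := Complex.conj_conj z

lemma cj_zero : cj 0 = 0 := map_zero (starRingEnd ℂ)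

@[fun_prop]
lemma continuous_cj : Continuous cj := Complex.continuous_conj

lemma HasDerivAt.cj_cj {f : ℂ → ℂ} {f' z : ℂ} (hf : HasDerivAt f f' (cj z)) :
    HasDerivAt (fun s => cj (f (cj s))) (cj f') z := by
  have := hf.conj_conj
  rwa [show (starRingEnd ℂ) (cj z) = z from Complex.conj_conj z] at this

lemma AnalyticAt.cj_cj {f : ℂ → ℂ} (hf : AnalyticAt ℂ f 0) :
    AnalyticAt ℂ (fun s => cj (f (cj s))) 0 := by
  rw [Complex.analyticAt_iff_eventually_differentiableAt]
  have h := (Continuous.tendsto' continuous_cj 0 0 cj_zero).eventually hf.eventually_analyticAt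
  filter_upwards [h] with z hz
  exact hz.differentiableAt.hasDerivAt.cj_cj.differentiableAt

lemma isSegreMap {Q Q' : ℂ → ℂ → ℂ → ℂ} {F G : ℂ → ℂ → ℂ}
    (hQ : IsNormalGerm fun p => Q p.1 p.2.1 p.2.2)
    (hQ' : IsNormalGerm fun p => Q' p.1 p.2.1 p.2.2)
    (h : SendsInto Q Q' F G) (hJ : JacDet F G ≠ 0) :
    IsSegreMap (fun p => Q p.1 p.2.1 p.2.2) (fun p => Q' p.1 p.2.1 p.2.2)
      (jet10 F G, fun i => cj (jet10 F G i)) (fun p => F p.1 p.2) (fun p => G p.1 p.2)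
      (fun χ => cj (F (cj χ) 0)) (fun χ => cj (dTwo (fun p => F p.1 p.2) (cj χ, 0))) := by
  obtain ⟨hF, hG, hF0, hG0, hid⟩ := h
  set f : ℂ × ℂ → ℂ := fun p => F p.1 p.2 with hf
  set g : ℂ × ℂ → ℂ := fun p => G p.1 p.2 with hg
  set q : ℂ × ℂ × ℂ → ℂ := fun p => Q p.1 p.2.1 p.2.2 with hq
  set q' : ℂ × ℂ × ℂ → ℂ := fun p => Q' p.1 p.2.1 p.2.2 with hq'
  have hid' : ∀ᶠ p : ℂ × ℂ × ℂ in 𝓝 0, g (p.1, q p) =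
      q' (f (p.1, q p), cj (f (cj p.2.1, cj p.2.2)), cj (g (cj p.2.1, cj p.2.2))) := hid
  have hGz : ∀ᶠ z : ℂ in 𝓝 0, g (z, 0) = 0 := by
    have h1 := (Continuous.tendsto' (f := fun z : ℂ => (z, (0 : ℂ), (0 : ℂ))) (by fun_prop) 0 0
      rfl).eventually hid'
    have h2 : Tendsto (fun z : ℂ => (f (z, 0), (0 : ℂ))) (𝓝 0) (𝓝 0) := by
      have h3 : Tendsto (fun z : ℂ => (z, (0 : ℂ))) (𝓝 0) (𝓝 0) :=
        Continuous.tendsto' (by fun_prop) _ _ rfl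
      have h4 := hF.continuousAt.tendsto.comp h3
      rw [show f 0 = 0 from hF0] at h4
      exact h4.prodMk_nhds tendsto_const_nhds
    filter_upwards [h1, h2.eventually hQ'.mid, hQ.mid_zero] with z h3 h4 h5
    simp only [h5, cj_zero] at h3
    rw [h3]
    simp only [hf, hg, hF0, hG0, cj_zero]
    exact h4
  have hfb : AnalyticAt ℂ (fun χ => f (χ, 0)) 0 :=
    hF.comp_of_eq (f := fun z : ℂ => (z, (0 : ℂ))) (by fun_prop) rfl
  have ha : AnalyticAt ℂ (fun χ => dTwo f (χ, 0)) 0 :=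
    hF.dTwo.comp_of_eq (f := fun z : ℂ => (z, (0 : ℂ))) (by fun_prop) rfl
  have hfd : HasDerivAt (fun χ => cj (f (cj χ, 0))) (cj (dOne f 0)) 0 := by
    refine HasDerivAt.cj_cj (f := fun χ => f (χ, 0)) ?_
    rw [cj_zero]
    simpa using hasDerivAt_comp₂ hF.differentiableAt (hasDerivAt_id (0 : ℂ))
      (hasDerivAt_const (0 : ℂ) (0 : ℂ)) rfl
  have hG1 : pd G 1 0 0 0 = 0 := by
    rw [pd_one_zero hG, ← Prod.mk_zero_zero, ← deriv_slice_fst hG.differentiableAt]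
    exact (Filter.EventuallyEq.deriv_eq hGz).trans (deriv_const _ _)
  have hJ' : pd F 1 0 0 0 ≠ 0 ∧ pd G 0 1 0 0 ≠ 0 := by
    rw [JacDet, hG1, mul_zero, sub_zero] at hJ
    exact ⟨left_ne_zero_of_mul hJ, right_ne_zero_of_mul hJ⟩
  have tp : Tendsto (fun p : ℂ × ℂ => (p.1, p.2, (0 : ℂ))) (𝓝 0) (𝓝 0) :=
    Continuous.tendsto' (by fun_prop) _ _ rfl
  have tq : Tendsto (fun p : ℂ × ℂ => (p.1, q (p.1, p.2, 0))) (𝓝 0) (𝓝 0) := by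
    have h1 : Tendsto (fun p : ℂ × ℂ => q (p.1, p.2, 0)) (𝓝 0) (𝓝 0) := by
      have h2 := hQ.an.continuousAt.tendsto.comp tp
      rwa [show q 0 = 0 from hQ.zero] at h2
    exact (continuous_fst.tendsto (0 : ℂ × ℂ)).prodMk_nhds h1
  have tf : Tendsto (fun p : ℂ × ℂ => (f (p.1, q (p.1, p.2, 0)), cj (f (cj p.2, 0)), (0 : ℂ)))
      (𝓝 0) (𝓝 0) := by
    have c1 : Tendsto (fun p : ℂ × ℂ => f (p.1, q (p.1, p.2, 0))) (𝓝 0) (𝓝 0) := by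
      have := hF.continuousAt.tendsto.comp tq
      rwa [show f 0 = 0 from hF0] at this
    have c2 : Tendsto (fun p : ℂ × ℂ => cj (f (cj p.2, 0))) (𝓝 0) (𝓝 0) := by
      have c3 : Tendsto (fun p : ℂ × ℂ => (cj p.2, (0 : ℂ))) (𝓝 0) (𝓝 0) :=
        Continuous.tendsto' (by fun_prop) _ _ (by simp [cj_zero])
      have := (continuous_cj.tendsto _).comp (hF.continuousAt.tendsto.comp c3)
      rwa [show f 0 = 0 from hF0, cj_zero] at this
    exact c1.prodMk_nhds (c2.prodMk_nhds tendsto_const_nhds)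
  have tc : Tendsto (fun p : ℂ × ℂ => (cj p.2, (0 : ℂ))) (𝓝 0) (𝓝 0) :=
    Continuous.tendsto' (by fun_prop) _ _ (by simp [cj_zero])
  have hg0' : ∀ᶠ p : ℂ × ℂ in 𝓝 0, cj (g (cj p.2, 0)) = 0 := by
    have t1 : Tendsto (fun p : ℂ × ℂ => cj p.2) (𝓝 0) (𝓝 0) :=
      Continuous.tendsto' (by fun_prop) _ _ (by simp [cj_zero])
    filter_upwards [t1.eventually hGz] with p hp
    rw [hp, cj_zero]
  refine
    { mem := ⟨hJ'.1, hJ'.2, ?_⟩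
      anF := hF
      anG := hG
      F_zero := hF0
      G_zero := hGz
      anfb := hfb.cj_cj
      ana := ha.cj_cj
      fb_zero := ?_
      deriv_fb := ?_
      dOneF := (pd_one_zero hF).symm
      dTwoF := (pd_zero_one hF).symm
      dTwoG := (pd_zero_one hG).symm
      dOneTwoF := (pd_one_one hF).symm
      dTwoTwoF := (pd_zero_two hF).symm
      dOneTwoG := (pd_one_one hG).symm
      dTwoTwoG := (pd_zero_two hG).symm
      eq_zero := ?_
      eq_chi := ?_
      eq_tau := ?_ }
  · change cj (pd F 1 0 0 0) ≠ 0
    intro h0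
    apply hJ'.1
    rw [← cj_cj (pd F 1 0 0 0), h0, cj_zero]
  · simp only [cj_zero, hF0]
  · rw [hfd.deriv, ← pd_one_zero hF]
    rfl
  · filter_upwards [tp.eventually hid', hg0'] with p hp hp0
    simp only [cj_zero] at hp
    rw [hp, hp0]
  · have hx : ∀ᶠ p : ℂ × ℂ in 𝓝 0, ∀ᶠ χ in 𝓝 p.2, g (p.1, q (p.1, χ, 0)) =
        q' (f (p.1, q (p.1, χ, 0)), cj (f (cj χ, 0)), 0) := by
      have h1 : ∀ᶠ p : ℂ × ℂ in 𝓝 0, g (p.1, q (p.1, p.2, 0)) =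
          q' (f (p.1, q (p.1, p.2, 0)), cj (f (cj p.2, 0)), 0) := by
        filter_upwards [tp.eventually hid', hg0'] with p hp hp0
        simp only [cj_zero] at hp
        rw [hp, hp0]
      filter_upwards [h1.eventually_nhds] with p hp
      exact (Continuous.tendsto' (f := fun χ : ℂ => (p.1, χ)) (by fun_prop) p.2 p rfl).eventually hp
    filter_upwards [hx, tp.eventually hQ.an.eventually_analyticAt,
      tq.eventually hF.eventually_analyticAt, tq.eventually hG.eventually_analyticAt,
      tf.eventually hQ'.an.eventually_analyticAt, tc.eventually hF.eventually_analyticAt]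
      with p h1 h2 h3 h4 h5 h6
    have e1 : HasDerivAt (fun χ => q (p.1, χ, 0)) (dX q (p.1, p.2, 0)) p.2 := by
      simpa using hasDerivAt_comp₃ h2.differentiableAt (hasDerivAt_const p.2 p.1)
        (hasDerivAt_id p.2) (hasDerivAt_const p.2 (0 : ℂ)) rfl
    have e2 := hasDerivAt_comp₂ h3.differentiableAt (hasDerivAt_const p.2 p.1) e1 rfl
    have e3 := hasDerivAt_comp₂ h4.differentiableAt (hasDerivAt_const p.2 p.1) e1 rfl
    have e4 : HasDerivAt (fun χ => cj (f (cj χ, 0))) (cj (dOne f (cj p.2, 0))) p.2 := by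
      refine HasDerivAt.cj_cj (f := fun χ => f (χ, 0)) ?_
      simpa using hasDerivAt_comp₂ h6.differentiableAt (hasDerivAt_id (cj p.2))
        (hasDerivAt_const (cj p.2) (0 : ℂ)) rfl
    have e5 := hasDerivAt_comp₃ h5.differentiableAt e2 e4 (hasDerivAt_const p.2 (0 : ℂ)) rfl
    have e6 := e3.unique (e5.congr_of_eventuallyEq h1)
    change (_ - _) * _ = _ * deriv (fun χ => cj (f (cj χ, 0))) p.2
    rw [e4.deriv]
    linear_combination e6
  · have hx : ∀ᶠ p : ℂ × ℂ in 𝓝 0, ∀ᶠ τ in 𝓝 (0 : ℂ), g (p.1, q (p.1, p.2, τ)) =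
        q' (f (p.1, q (p.1, p.2, τ)), cj (f (cj p.2, cj τ)), cj (g (cj p.2, cj τ))) := by
      filter_upwards [tp.eventually hid'.eventually_nhds] with p hp
      exact (Continuous.tendsto' (f := fun τ : ℂ => (p.1, p.2, τ)) (by fun_prop) 0 _ rfl).eventually
        hp
    filter_upwards [hx, tp.eventually hQ.an.eventually_analyticAt,
      tq.eventually hF.eventually_analyticAt, tq.eventually hG.eventually_analyticAt,
      tf.eventually hQ'.an.eventually_analyticAt, tc.eventually hF.eventually_analyticAt,
      tc.eventually hG.eventually_analyticAt, hg0'] with p h1 h2 h3 h4 h5 h6 h7 h8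
    have e1 : HasDerivAt (fun τ => q (p.1, p.2, τ)) (dT q (p.1, p.2, 0)) 0 := by
      simpa using hasDerivAt_comp₃ h2.differentiableAt (hasDerivAt_const (0 : ℂ) p.1)
        (hasDerivAt_const (0 : ℂ) p.2) (hasDerivAt_id (0 : ℂ)) rfl
    have e2 := hasDerivAt_comp₂ h3.differentiableAt (hasDerivAt_const (0 : ℂ) p.1) e1 rfl
    have e3 := hasDerivAt_comp₂ h4.differentiableAt (hasDerivAt_const (0 : ℂ) p.1) e1 rfl
    have e4 : ∀ {φ : ℂ × ℂ → ℂ}, AnalyticAt ℂ φ (cj p.2, 0) →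
        HasDerivAt (fun τ => cj (φ (cj p.2, cj τ))) (cj (dTwo φ (cj p.2, 0))) 0 := by
      intro φ hφ
      refine HasDerivAt.cj_cj (f := fun τ => φ (cj p.2, τ)) ?_
      rw [cj_zero]
      simpa using hasDerivAt_comp₂ hφ.differentiableAt (hasDerivAt_const (0 : ℂ) (cj p.2))
        (hasDerivAt_id (0 : ℂ)) rfl
    have e5 := hasDerivAt_comp₃ h5.differentiableAt e2 (e4 h6) (e4 h7) (by simp only [cj_zero, h8])
    have e6 := e3.unique (e5.congr_of_eventuallyEq h1)
    linear_combination e6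

end SegreMaps

section SegreMapLemmas

variable {q q' : ℂ × ℂ × ℂ → ℂ} {l : JetPair} {F G : ℂ × ℂ → ℂ} {fb a : ℂ → ℂ}
  {m k m' k' : ℕ} {R U W R' U' W' : ℂ × ℂ → ℂ}

lemma tendsto_slice : Tendsto (fun p : ℂ × ℂ => (p.1, p.2, (0 : ℂ))) (𝓝 0) (𝓝 0) :=
  Continuous.tendsto' (by fun_prop) _ _ rfl

lemma tendsto_left : Tendsto (fun χ : ℂ => ((0 : ℂ), χ)) (𝓝 0) (𝓝 0) :=
  Continuous.tendsto' (by fun_prop) _ _ rfl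

lemma IsNormalGerm.an_slice (h : IsNormalGerm q) :
    AnalyticAt ℂ (fun p : ℂ × ℂ => q (p.1, p.2, 0)) 0 :=
  h.an.comp_of_eq (f := fun p : ℂ × ℂ => (p.1, p.2, (0 : ℂ))) (by fun_prop) rfl

lemma IsSegreMap.an_first (h : IsSegreMap q q' l F G fb a) (hq : IsNormalGerm q) :
    AnalyticAt ℂ (fun p : ℂ × ℂ => F (p.1, q (p.1, p.2, 0))) 0 :=
  h.anF.comp_of_eq (f := fun p : ℂ × ℂ => (p.1, q (p.1, p.2, 0)))
    (analyticAt_fst.prod hq.an_slice) (Prod.ext rfl hq.zero)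

/-- The quotient `F (z, q (z, χ, 0)) / z`. -/
def segreQuot (q : ℂ × ℂ × ℂ → ℂ) (F : ℂ × ℂ → ℂ) : ℂ × ℂ → ℂ :=
  firstQuot fun p : ℂ × ℂ => F (p.1, q (p.1, p.2, 0))

lemma IsSegreMap.an_segreQuot (h : IsSegreMap q q' l F G fb a) (hq : IsNormalGerm q) :
    AnalyticAt ℂ (segreQuot q F) 0 := analyticAt_firstQuot (h.an_first hq)

lemma IsSegreMap.eq_mul_segreQuot (h : IsSegreMap q q' l F G fb a) (hq : IsNormalGerm q) :
    ∀ᶠ p : ℂ × ℂ in 𝓝 0, F (p.1, q (p.1, p.2, 0)) = p.1 * segreQuot q F p := by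
  filter_upwards [(continuous_snd.tendsto (0 : ℂ × ℂ)).eventually hq.left_zero] with p hp
  have := eq_add_mul_firstQuot (fun p : ℂ × ℂ => F (p.1, q (p.1, p.2, 0))) p.1 p.2
  simp only [hp, Prod.mk_zero_zero, h.F_zero, zero_add] at this
  exact this

lemma IsSegreMap.segreQuot_left (h : IsSegreMap q q' l F G fb a) (hq : IsNormalGerm q) :
    ∀ᶠ χ : ℂ in 𝓝 0, segreQuot q F (0, χ) = jetC 0 l + jetC 1 l * dZ q (0, χ, 0) := by
  filter_upwards [hq.left_zero, (tendsto_slice.comp tendsto_left).eventually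
    hq.an.eventually_analyticAt] with χ h1 h2
  have h2' : AnalyticAt ℂ q (0, χ, 0) := h2
  have e1 : HasDerivAt (fun z => q (z, χ, 0)) (dZ q (0, χ, 0)) 0 := by
    simpa using hasDerivAt_comp₃ h2'.differentiableAt (hasDerivAt_id (0 : ℂ))
      (hasDerivAt_const (0 : ℂ) χ) (hasDerivAt_const (0 : ℂ) (0 : ℂ)) rfl
  have e2 := hasDerivAt_comp₂ h.anF.differentiableAt (hasDerivAt_id (0 : ℂ)) e1
    (Prod.ext rfl h1.symm)
  rw [segreQuot, firstQuot, dslope_same]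
  refine e2.deriv.trans ?_
  rw [h.dOneF, h.dTwoF]
  ring

lemma IsSegreMap.tendsto_fb (h : IsSegreMap q q' l F G fb a) : Tendsto fb (𝓝 0) (𝓝 0) := by
  have := h.anfb.continuousAt.tendsto
  rwa [h.fb_zero] at this

lemma IsSegreMap.tendsto_target (h : IsSegreMap q q' l F G fb a) (hq : IsNormalGerm q) :
    Tendsto (fun p : ℂ × ℂ => (F (p.1, q (p.1, p.2, 0)), fb p.2, (0 : ℂ))) (𝓝 0) (𝓝 0) := by
  have h1 := (h.an_first hq).continuousAt.tendsto
  simp only [Prod.fst_zero, Prod.snd_zero, Prod.mk_zero_zero, hq.zero, h.F_zero] at h1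
  exact h1.prodMk_nhds ((h.tendsto_fb.comp (continuous_snd.tendsto (0 : ℂ × ℂ))).prodMk_nhds
    tendsto_const_nhds)

lemma IsSegreMap.dTwoG_conj (h : IsSegreMap q q' l F G fb a) (hq : IsNormalGerm q)
    (hq' : IsNormalGerm q') : ∀ᶠ χ : ℂ in 𝓝 0,
    cj (dTwo G (cj χ, 0)) = jetC 3 l - jetC 1 l * dZ q' (0, fb χ, 0) := by
  filter_upwards [tendsto_left.eventually h.eq_tau, hq.left_zero, hq.dT_left,
    h.tendsto_fb.eventually hq'.dT_left, h.tendsto_fb.eventually hq'.dX_left]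
    with χ h1 h2 h3 h4 h5
  simp only [h2, h3, Prod.mk_zero_zero, h.F_zero, h4, h5, h.dTwoF, h.dTwoG] at h1
  linear_combination -h1

lemma IsSegreForm.left_ne (hS : IsSegreForm q m k R U W) : ∀ᶠ χ : ℂ in 𝓝 0, U (0, χ) ≠ 0 :=
  tendsto_left.eventually (hS.analyticAt_U.continuousAt.eventually_ne hS.U_ne)

lemma IsSegreMap.first_coefficient (h : IsSegreMap q q' l F G fb a) (hq : IsNormalGerm q)
    (hS : IsSegreForm q m k R U W) (hS' : IsSegreForm q' m' k' R' U' W') :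
    m = m' ∧ k = k' ∧ ∀ᶠ χ : ℂ in 𝓝 0, U (0, χ) * jetC 3 l =
      segreQuot q F (0, χ) ^ m * dslope fb 0 χ ^ k * U' (0, fb χ) := by
  obtain ⟨hl0, hl3, hlb⟩ := h.mem
  let g : ℂ × ℂ → ℂ := firstQuot fun p => G (p.2, p.1)
  have hG' : AnalyticAt ℂ (fun p : ℂ × ℂ => G (p.2, p.1)) (0, 0) :=
    h.anG.comp_of_eq (f := fun p : ℂ × ℂ => (p.2, p.1)) (by fun_prop) rfl
  have hg : AnalyticAt ℂ g 0 := analyticAt_firstQuot hG'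
  have hGg : ∀ᶠ p : ℂ × ℂ in 𝓝 0, G p = p.2 * g (p.2, p.1) := by
    filter_upwards [(continuous_fst.tendsto (0 : ℂ × ℂ)).eventually h.G_zero] with p hp
    have := eq_add_mul_firstQuot (fun p : ℂ × ℂ => G (p.2, p.1)) p.2 p.1
    simp only [hp, zero_add] at this
    exact this
  have hg0 : g 0 = jetC 3 l := by
    change firstQuot _ (0, 0) = _
    rw [firstQuot, dslope_same, deriv_slice_snd (f := G) h.anG.differentiableAt]
    exact h.dTwoG
  let vt := dslope fb 0
  have hfbv : ∀ χ, fb χ = χ * vt χ := fun χ => by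
    have := sub_smul_dslope fb 0 χ
    rw [h.fb_zero, sub_zero, sub_zero, smul_eq_mul] at this
    exact this.symm
  have hvt0 : vt 0 = jetB l := by simp only [vt, dslope_same, h.deriv_fb]
  have hvt : ContinuousAt vt 0 := continuousAt_dslope_same.mpr h.anfb.differentiableAt
  let e := segreQuot q F
  have he : AnalyticAt ℂ e 0 := h.an_segreQuot hq
  have he0 : ∀ᶠ χ : ℂ in 𝓝 0, e (0, χ) ≠ 0 := by
    refine tendsto_left.eventually (he.continuousAt.eventually_ne ?_)
    have h1 := (h.segreQuot_left hq).self_of_nhds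
    simp only [Prod.mk_zero_zero, hq.dZ_zero, mul_zero, add_zero] at h1
    simpa only [e, h1] using hl0
  have tq : Tendsto (fun p : ℂ × ℂ => (p.1, q (p.1, p.2, 0))) (𝓝 0) (𝓝 0) := by
    have := (analyticAt_fst.prod hq.an_slice).continuousAt.tendsto
    simpa only [Prod.fst_zero, Prod.snd_zero, Prod.mk_zero_zero, hq.zero] using this
  have t1 : Tendsto (fun p : ℂ × ℂ => (F (p.1, q (p.1, p.2, 0)), fb p.2)) (𝓝 0) (𝓝 0) :=
    (h.tendsto_target hq).fst_nhds.prodMk_nhds (h.tendsto_target hq).snd_nhds.fst_nhds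
  have main : ∀ᶠ p : ℂ × ℂ in 𝓝 0, p.1 ^ m * (R p * g (q (p.1, p.2, 0), p.1)) =
      p.1 ^ m' * (e p ^ m' * R' (p.1 * e p, fb p.2)) := by
    filter_upwards [h.eq_zero, tq.eventually hGg, hS.eq_R, t1.eventually hS'.eq_R,
      h.eq_mul_segreQuot hq] with p h1 h2 h3 h4 h5
    rw [h2, h4, h5] at h1
    simp only [e]
    calc _ = q (p.1, p.2, 0) * g (q (p.1, p.2, 0), p.1) := by rw [h3]; ring
      _ = _ := h1
      _ = _ := by ring
  have tq2 : AnalyticAt ℂ (fun p : ℂ × ℂ => R p * g (q (p.1, p.2, 0), p.1)) 0 :=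
    hS.analyticAt_R.fun_mul (hg.comp_of_eq (f := fun p : ℂ × ℂ => (q (p.1, p.2, 0), p.1))
      (hq.an_slice.prod analyticAt_fst) (Prod.ext hq.zero rfl))
  have tq3 : AnalyticAt ℂ (fun p : ℂ × ℂ => e p ^ m' * R' (p.1 * e p, fb p.2)) 0 :=
    (he.fun_pow _).fun_mul (hS'.analyticAt_R.comp_of_eq
      (f := fun p : ℂ × ℂ => (p.1 * e p, fb p.2))
      ((analyticAt_fst.fun_mul he).prod (h.anfb.comp_of_eq analyticAt_snd rfl))
      (Prod.ext (by simp) (by simp [h.fb_zero])))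
  have step : ∀ᶠ χ : ℂ in 𝓝[≠] 0, m = m' ∧
      χ ^ k * (U (0, χ) * jetC 3 l) =
        χ ^ k' * (e (0, χ) ^ m' * vt χ ^ k' * U' (0, fb χ)) := by
    filter_upwards [(tendsto_left.eventually main.eventually_nhds).filter_mono nhdsWithin_le_nhds,
      (tendsto_left.eventually tq2.eventually_analyticAt).filter_mono nhdsWithin_le_nhds,
      (tendsto_left.eventually tq3.eventually_analyticAt).filter_mono nhdsWithin_le_nhds,
      hS.R_zero.filter_mono nhdsWithin_le_nhds, hq.left_zero.filter_mono nhdsWithin_le_nhds,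
      hS.left_ne.filter_mono nhdsWithin_le_nhds, self_mem_nhdsWithin,
      he0.filter_mono nhdsWithin_le_nhds,
      (hvt.eventually_ne (hvt0 ▸ hlb)).filter_mono nhdsWithin_le_nhds,
      (h.tendsto_fb.eventually hS'.R_zero).filter_mono nhdsWithin_le_nhds,
      (h.tendsto_fb.eventually hS'.left_ne).filter_mono nhdsWithin_le_nhds]
      with χ h1 h2 h3 h4 h5 h6 h7 h8 h9 h10 h11
    have h7' : χ ≠ 0 := h7
    have tz : Tendsto (fun z : ℂ => (z, χ)) (𝓝 0) (𝓝 (0, χ)) :=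
      Continuous.tendsto' (by fun_prop) _ _ rfl
    have v1 : R (0, χ) * g (q (0, χ, 0), 0) = χ ^ k * (U (0, χ) * jetC 3 l) := by
      rw [h4, h5, Prod.mk_zero_zero, hg0]; ring
    have v2 : e (0, χ) ^ m' * R' (0 * e (0, χ), fb χ) =
        χ ^ k' * (e (0, χ) ^ m' * vt χ ^ k' * U' (0, fb χ)) := by
      rw [zero_mul, h10, hfbv χ, mul_pow]; ring
    have := eq_of_pow_mul_eq_pow_mul (m := m) (n := m')
      (a := fun z => R (z, χ) * g (q (z, χ, 0), z))
      (b := fun z => e (z, χ) ^ m' * R' (z * e (z, χ), fb χ))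
      (h2.continuousAt.comp_of_eq (f := fun z : ℂ => (z, χ)) (by fun_prop) rfl)
      (h3.continuousAt.comp_of_eq (f := fun z : ℂ => (z, χ)) (by fun_prop) rfl)
      (by
        simp only [v1]
        exact mul_ne_zero (pow_ne_zero _ h7') (mul_ne_zero h6 hl3))
      (by
        simp only [v2]
        exact mul_ne_zero (pow_ne_zero _ h7') (mul_ne_zero (mul_ne_zero (pow_ne_zero _ h8)
          (pow_ne_zero _ h9)) h11))
      ((tz.eventually h1).filter_mono nhdsWithin_le_nhds)
    simp only [v1, v2] at this
    exact this
  obtain ⟨χ, hmm, -⟩ := step.exists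
  subst hmm
  have cU : ContinuousAt (fun χ : ℂ => U (0, χ)) 0 :=
    hS.analyticAt_U.continuousAt.comp_of_eq (f := fun χ : ℂ => ((0 : ℂ), χ)) (by fun_prop) rfl
  have ce : ContinuousAt (fun χ : ℂ => e (0, χ)) 0 :=
    he.continuousAt.comp_of_eq (f := fun χ : ℂ => ((0 : ℂ), χ)) (by fun_prop) rfl
  have cU' : ContinuousAt (fun χ : ℂ => U' (0, fb χ)) 0 :=
    hS'.analyticAt_U.continuousAt.comp_of_eq (f := fun χ : ℂ => ((0 : ℂ), fb χ))
      (continuousAt_const.prodMk h.anfb.continuousAt) (Prod.ext rfl h.fb_zero)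
  have hkk := eq_of_pow_mul_eq_pow_mul (m := k) (n := k') (a := fun χ => U (0, χ) * jetC 3 l)
    (b := fun χ => e (0, χ) ^ m * vt χ ^ k' * U' (0, fb χ)) (cU.mul continuousAt_const)
    (((ce.pow _).mul (hvt.pow _)).mul cU')
    (mul_ne_zero hS.U_ne hl3)
    (mul_ne_zero (mul_ne_zero (pow_ne_zero _ he0.self_of_nhds)
      (pow_ne_zero _ (hvt0 ▸ hlb))) (by
        rw [h.fb_zero]
        exact hS'.U_ne)) (step.mono fun χ hχ => hχ.2)
  obtain ⟨rfl, h0⟩ := hkk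
  refine ⟨rfl, rfl, ?_⟩
  have step' := eventually_nhdsWithin_iff.mp step
  filter_upwards [step'] with χ hχ
  rcases eq_or_ne χ 0 with rfl | hne
  · exact h0
  · exact mul_left_cancel₀ (pow_ne_zero k hne) (hχ hne).2

end SegreMapLemmas

section ConjugateComponent

variable {q q' : ℂ × ℂ × ℂ → ℂ} {m k : ℕ} {R U W R' U' W' : ℂ × ℂ → ℂ}

lemma exists_conjugate_param (hq : IsNormalGerm q)
    (hS : IsSegreForm q m k R U W) (hS' : IsSegreForm q' m k R' U' W') :
    ∃ v : ℂ × JetPair → ℂ, (∀ l ∈ JetDom, AnalyticAt ℂ v (0, l) ∧ v (0, l) = jetB l) ∧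
      ∀ l F G fb a, IsSegreMap q q' l F G fb a → ∀ᶠ χ in 𝓝 (0 : ℂ), fb χ = χ * v (χ, l) := by
  have hU'l : AnalyticAt ℂ (fun χ : ℂ => U' (0, χ)) 0 :=
    hS'.analyticAt_U.comp_of_eq (f := fun χ : ℂ => ((0 : ℂ), χ)) (by fun_prop) rfl
  have hUl : AnalyticAt ℂ (fun χ : ℂ => U (0, χ)) 0 :=
    hS.analyticAt_U.comp_of_eq (f := fun χ : ℂ => ((0 : ℂ), χ)) (by fun_prop) rfl
  have hq1 : AnalyticAt ℂ (fun χ : ℂ => dZ q (0, χ, 0)) 0 :=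
    hq.an.dZ.comp_of_eq (f := fun χ : ℂ => ((0 : ℂ), χ, (0 : ℂ))) (by fun_prop) rfl
  have hq10 : dZ q (0, 0, 0) = 0 := hq.dZ_zero
  let r : ℂ → ℂ := fun Y => rootNear k (U' (0, Y) / U' 0)
  have hr : AnalyticAt ℂ r 0 :=
    AnalyticAt.rootNear k (hU'l.fun_div analyticAt_const hS'.U_ne) (div_self hS'.U_ne)
  have hr0 : r 0 = 1 := by
    simp only [r, Prod.mk_zero_zero, div_self hS'.U_ne, rootNear_one]
  obtain ⟨s, hs, hs0, hrs⟩ := exists_inverse_fst (h := fun p => r p.1)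
    (hr.comp_of_eq analyticAt_fst rfl) hr0
  let c : ℂ × JetPair → ℂ := fun x => rootNear k (U (0, x.1) / U 0 /
    (1 + jetC 1 x.2 / jetC 0 x.2 * dZ q (0, x.1, 0)) ^ m)
  have hc0 : ∀ l, c (0, l) = 1 := fun l => by
    simp only [c, hq.dZ_zero, mul_zero, add_zero, one_pow, div_one, Prod.mk_zero_zero,
      div_self hS.U_ne, rootNear_one]
  have hc : ∀ l ∈ JetDom, AnalyticAt ℂ c (0, l) := fun l hl => by
    have e1 : AnalyticAt ℂ (fun x : ℂ × JetPair => U (0, x.1)) (0, l) :=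
      hUl.comp_of_eq (f := fun x : ℂ × JetPair => x.1) (by fun_prop) rfl
    have e2 : AnalyticAt ℂ (fun x : ℂ × JetPair => dZ q (0, x.1, 0)) (0, l) :=
      hq1.comp_of_eq (f := fun x : ℂ × JetPair => x.1) (by fun_prop) rfl
    have e3 : AnalyticAt ℂ (fun x : ℂ × JetPair => jetC 1 x.2 / jetC 0 x.2) (0, l) :=
      AnalyticAt.fun_div (by fun_prop) (by fun_prop) hl.1
    refine AnalyticAt.rootNear k ((e1.fun_div analyticAt_const hS.U_ne).fun_div
      ((analyticAt_const.fun_add (e3.fun_mul e2)).fun_pow m) ?_) ?_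
    · simp only [hq10, mul_zero, add_zero, one_pow]
      exact one_ne_zero
    · simp only [hq10, mul_zero, add_zero, one_pow, div_one]
      exact div_self hS.U_ne
  refine ⟨fun x => jetB x.2 * c x * s (jetB x.2 * x.1 * c x, 0), fun l hl => ⟨?_, ?_⟩, ?_⟩
  · have e1 := hc l hl
    refine AnalyticAt.fun_mul (AnalyticAt.fun_mul (by fun_prop) e1) (hs.comp_of_eq
      (f := fun x : ℂ × JetPair => (jetB x.2 * x.1 * c x, (0 : ℂ))) ?_ (by simp))
    exact AnalyticAt.prod (AnalyticAt.fun_mul (by fun_prop) e1) analyticAt_const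
  · simp [hc0, hs0, Prod.mk_zero_zero]
  · intro l F G fb a h
    obtain ⟨hl0, hl3, hlb⟩ := h.mem
    obtain ⟨-, -, hA⟩ := h.first_coefficient hq hS hS'
    have hvt0 : dslope fb 0 0 = jetB l := by simp only [dslope_same, h.deriv_fb]
    have hfbv : ∀ χ, fb χ = χ * dslope fb 0 χ := fun χ => by
      have := sub_smul_dslope fb 0 χ
      rw [h.fb_zero, sub_zero, sub_zero, smul_eq_mul] at this
      exact this.symm
    have hvt : ContinuousAt (dslope fb 0) 0 :=
      continuousAt_dslope_same.mpr h.anfb.differentiableAt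
    have hA0 : U 0 * jetC 3 l = jetC 0 l ^ m * jetB l ^ k * U' 0 := by
      have h1 := hA.self_of_nhds
      have h2 := (h.segreQuot_left hq).self_of_nhds
      rw [hq10, mul_zero, add_zero] at h2
      rwa [h2, hvt0, h.fb_zero] at h1
    have hcl : ContinuousAt (fun χ : ℂ => c (χ, l)) 0 :=
      (hc l h.mem).continuousAt.comp_of_eq (f := fun χ : ℂ => (χ, l)) (by fun_prop) rfl
    have hrc : ContinuousAt (fun χ => r (fb χ)) 0 :=
      hr.continuousAt.comp_of_eq h.anfb.continuousAt h.fb_zero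
    have hne : ∀ᶠ χ : ℂ in 𝓝 0, 1 + jetC 1 l / jetC 0 l * dZ q (0, χ, 0) ≠ 0 := by
      refine ContinuousAt.eventually_ne (g := fun χ : ℂ => 1 + jetC 1 l / jetC 0 l *
        dZ q (0, χ, 0)) (continuousAt_const.add (continuousAt_const.mul hq1.continuousAt)) ?_
      simp only [hq10, mul_zero, add_zero]
      exact one_ne_zero
    have key : ∀ᶠ χ in 𝓝 (0 : ℂ), dslope fb 0 χ / jetB l * r (fb χ) = c (χ, l) := by
      refine eventually_eq_of_pow_eq hS.k_ne ((hvt.div_const _).mul hrc) hcl ?_ (hc0 l) ?_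
      · simp only [hvt0, h.fb_zero, hr0, div_self hlb, mul_one]
      · filter_upwards [hA, h.segreQuot_left hq, hne] with χ h1 h2 h3
        simp only [r, c]
        have hne : (jetC 0 l + jetC 1 l * dZ q (0, χ, 0)) ≠ 0 := by
          have : jetC 0 l + jetC 1 l * dZ q (0, χ, 0) =
            jetC 0 l * (1 + jetC 1 l / jetC 0 l * dZ q (0, χ, 0)) := by
              field_simp
          rw [this]
          exact mul_ne_zero hl0 h3
        rw [mul_pow, rootNear_pow hS.k_ne, rootNear_pow hS.k_ne]
        rw [h2] at h1
        have h4 : 1 + jetC 1 l / jetC 0 l * dZ q (0, χ, 0) =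
            (jetC 0 l + jetC 1 l * dZ q (0, χ, 0)) / jetC 0 l := by field_simp
        rw [h4, div_pow, div_pow]
        have n1 := pow_ne_zero m hne
        have n2 := pow_ne_zero m hl0
        have n3 := pow_ne_zero k hlb
        have n4 := hS.U_ne
        have n5 := hS'.U_ne
        generalize (jetC 0 l + jetC 1 l * dZ q (0, χ, 0)) ^ m = A at *
        generalize jetC 0 l ^ m = B at *
        generalize jetB l ^ k = C at *
        generalize dslope fb 0 χ ^ k = D at *
        field_simp
        refine mul_right_cancel₀ hl3 ?_
        linear_combination (D * A * U' (0, fb χ)) * hA0 - (B * C * U' 0) * h1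
    have hrs' := (h.tendsto_fb.prodMk_nhds (tendsto_const_nhds (x := (0 : ℂ)))).eventually hrs
    filter_upwards [key, hrs'] with χ h1 h2
    have h3 : fb χ * r (fb χ) = jetB l * χ * c (χ, l) := by
      rw [← h1, hfbv χ]
      field_simp
    simp only [h3] at h2
    rw [← h2]
    ring

end ConjugateComponent

section MapComponent

lemma eventually_eq_of_pow_mul_eq {A B : ℂ × ℂ → ℂ} {i j : ℕ} (hA : AnalyticAt ℂ A 0)
    (hB : AnalyticAt ℂ B 0)
    (h : ∀ᶠ p in 𝓝 (0 : ℂ × ℂ), p.1 ^ i * p.2 ^ j * A p = p.1 ^ i * p.2 ^ j * B p) :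
    ∀ᶠ p in 𝓝 (0 : ℂ × ℂ), A p = B p := by
  have hd : Dense {p : ℂ × ℂ | p.1 ≠ 0 ∧ p.2 ≠ 0} := by
    have := (dense_compl_singleton (0 : ℂ)).prod (dense_compl_singleton (0 : ℂ))
    exact this
  filter_upwards [hA.eventually_analyticAt, hB.eventually_analyticAt, h.eventually_nhds]
    with p h1 h2 h3
  have hne : (𝓝[{p : ℂ × ℂ | p.1 ≠ 0 ∧ p.2 ≠ 0}] p).NeBot :=
    mem_closure_iff_nhdsWithin_neBot.mp (hd p)
  refine tendsto_nhds_unique (f := A) (l := 𝓝[{p : ℂ × ℂ | p.1 ≠ 0 ∧ p.2 ≠ 0}] p)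
    (h1.continuousAt.tendsto.mono_left nhdsWithin_le_nhds)
    ((h2.continuousAt.tendsto.mono_left nhdsWithin_le_nhds).congr' ?_)
  filter_upwards [h3.filter_mono nhdsWithin_le_nhds, self_mem_nhdsWithin] with x hx hx0
  exact (mul_left_cancel₀ (mul_ne_zero (pow_ne_zero _ hx0.1) (pow_ne_zero _ hx0.2)) hx).symm

variable {q q' : ℂ × ℂ × ℂ → ℂ} {m k : ℕ} {R U W R' U' W' : ℂ × ℂ → ℂ}
  {l : JetPair} {F G : ℂ × ℂ → ℂ} {fb a w : ℂ → ℂ}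

/-- The determinant `fb' q_τ - q_χ a` along the curves `z = t * χ ^ k`. -/
def segreDet (q : ℂ × ℂ × ℂ → ℂ) (k : ℕ) (fb a : ℂ → ℂ) (p : ℂ × ℂ) : ℂ :=
  deriv fb p.2 * dT q (p.1 * p.2 ^ k, p.2, 0) - dX q (p.1 * p.2 ^ k, p.2, 0) * a p.2

/-- The normalized first component of a map along the curves `z = t * χ ^ k`. -/
def segreEta (q : ℂ × ℂ × ℂ → ℂ) (F : ℂ × ℂ → ℂ) (k : ℕ) (w : ℂ → ℂ) (p : ℂ × ℂ) : ℂ :=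
  segreQuot q F (p.1 * p.2 ^ k, p.2) / w p.2 ^ k

lemma analyticAt_curve (k : ℕ) (p : ℂ × ℂ) :
    AnalyticAt ℂ (fun p : ℂ × ℂ => (p.1 * p.2 ^ k, p.2)) p := by fun_prop

lemma tendsto_curve (hk : k ≠ 0) :
    Tendsto (fun p : ℂ × ℂ => (p.1 * p.2 ^ k, p.2)) (𝓝 0) (𝓝 0) :=
  Continuous.tendsto' (by fun_prop) _ _ (by simp [hk])

lemma IsSegreMap.an_segreEta (h : IsSegreMap q q' l F G fb a) (hq : IsNormalGerm q)
    (hw : AnalyticAt ℂ w 0) (hw0 : w 0 = jetB l) (hk : k ≠ 0) :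
    AnalyticAt ℂ (segreEta q F k w) 0 :=
  ((h.an_segreQuot hq).comp_of_eq (analyticAt_curve k 0) (by simp [hk])).fun_div
    ((hw.comp_of_eq (f := fun p : ℂ × ℂ => p.2) (by fun_prop) rfl).fun_pow k)
    (pow_ne_zero k (by
      rw [Prod.snd_zero, hw0]
      exact h.mem.2.2))

lemma IsSegreMap.segreEta_zero (h : IsSegreMap q q' l F G fb a) (hq : IsNormalGerm q)
    (hw0 : w 0 = jetB l) : segreEta q F k w 0 = jetC 0 l / jetB l ^ k := by
  have h1 := (h.segreQuot_left hq).self_of_nhds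
  simp only [Prod.mk_zero_zero, hq.dZ_zero, mul_zero, add_zero] at h1
  simp only [segreEta, Prod.fst_zero, Prod.snd_zero, zero_mul, Prod.mk_zero_zero, h1, hw0]

lemma IsSegreMap.eq_segreEta (h : IsSegreMap q q' l F G fb a) (hq : IsNormalGerm q)
    (hw : AnalyticAt ℂ w 0) (hw0 : w 0 = jetB l) (hk : k ≠ 0) :
    ∀ᶠ p : ℂ × ℂ in 𝓝 0, F (p.1 * p.2 ^ k, q (p.1 * p.2 ^ k, p.2, 0)) =
      p.1 * segreEta q F k w p * (p.2 * w p.2) ^ k := by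
  have hne := (continuous_snd.tendsto (0 : ℂ × ℂ)).eventually
    (hw.continuousAt.eventually_ne (hw0 ▸ h.mem.2.2))
  filter_upwards [(tendsto_curve hk).eventually (h.eq_mul_segreQuot hq), hne] with p h1 h2
  have := pow_ne_zero k h2
  rw [h1, segreEta, mul_pow]
  field_simp

lemma IsSegreMap.dX_target (h : IsSegreMap q q' l F G fb a) (hq : IsNormalGerm q)
    (hS' : IsSegreForm q' m k R' U' W')
    (hw : AnalyticAt ℂ w 0) (hw0 : w 0 = jetB l) (hfb : ∀ᶠ χ in 𝓝 (0 : ℂ), fb χ = χ * w χ) :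
    ∀ᶠ p : ℂ × ℂ in 𝓝 0,
      dX q' (F (p.1 * p.2 ^ k, q (p.1 * p.2 ^ k, p.2, 0)), fb p.2, 0) =
        p.1 ^ m * p.2 ^ (k * m + (k - 1)) * (segreEta q F k w p ^ m *
          w p.2 ^ (k * m + (k - 1)) * W' (p.1 * segreEta q F k w p, p.2 * w p.2)) := by
  have he := h.an_segreEta hq hw hw0 hS'.k_ne
  have ht : Tendsto (fun p : ℂ × ℂ => (p.1 * segreEta q F k w p, p.2 * w p.2)) (𝓝 0) (𝓝 0) := by
    have : AnalyticAt ℂ (fun p : ℂ × ℂ => (p.1 * segreEta q F k w p, p.2 * w p.2)) 0 :=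
      (analyticAt_fst.fun_mul he).prod
        (analyticAt_snd.fun_mul (hw.comp_of_eq (f := fun p : ℂ × ℂ => p.2) (by fun_prop) rfl))
    have h0 := this.continuousAt.tendsto
    simp only [Prod.fst_zero, Prod.snd_zero, zero_mul, Prod.mk_zero_zero] at h0
    exact h0
  filter_upwards [h.eq_segreEta hq hw hw0 hS'.k_ne, ht.eventually hS'.eq_W,
    (continuous_snd.tendsto (0 : ℂ × ℂ)).eventually hfb] with p h1 h2 h3
  rw [h1, h3, h2, mul_pow, mul_pow]
  ring

/-- The quantity `W g₁ (μ / v) ^ (k m + k - 1)`, normalized to be `1` at the origin. -/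
def slopeFactor (q' : ℂ × ℂ × ℂ → ℂ) (W : ℂ × ℂ → ℂ) (m k : ℕ) (v : ℂ × JetPair → ℂ)
    (x : ℂ × ℂ × JetPair) : ℂ :=
  W (x.1, x.2.1) / W 0 * ((jetC 3 x.2.2 - jetC 1 x.2.2 * dZ q' (0, x.2.1 * v x.2, 0)) /
    jetC 3 x.2.2) * (jetB x.2.2 / v x.2) ^ (k * m + (k - 1))

lemma analyticAt_slopeFactor {v : ℂ × JetPair → ℂ} (hq' : IsNormalGerm q')
    (hS : IsSegreForm q m k R U W) (hl : l ∈ JetDom) (hv : AnalyticAt ℂ v (0, l))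
    (hv0 : v (0, l) = jetB l) :
    AnalyticAt ℂ (slopeFactor q' W m k v) (0, 0, l) ∧ slopeFactor q' W m k v (0, 0, l) = 1 := by
  have e1 : AnalyticAt ℂ (fun x : ℂ × ℂ × JetPair => v x.2) (0, 0, l) :=
    hv.comp_of_eq (f := fun x : ℂ × ℂ × JetPair => x.2) (by fun_prop) rfl
  have e2 : AnalyticAt ℂ (fun x : ℂ × ℂ × JetPair => dZ q' (0, x.2.1 * v x.2, 0)) (0, 0, l) := by
    refine hq'.an.dZ.comp_of_eq
      (f := fun x : ℂ × ℂ × JetPair => ((0 : ℂ), x.2.1 * v x.2, (0 : ℂ))) ?_ (by simp)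
    exact analyticAt_const.prod ((AnalyticAt.fun_mul (by fun_prop) e1).prod analyticAt_const)
  have e3 : AnalyticAt ℂ (fun x : ℂ × ℂ × JetPair => W (x.1, x.2.1)) (0, 0, l) :=
    hS.analyticAt_W.comp_of_eq (f := fun x : ℂ × ℂ × JetPair => (x.1, x.2.1)) (by fun_prop) rfl
  constructor
  · refine ((e3.fun_div analyticAt_const hS.W_ne).fun_mul (AnalyticAt.fun_div
      (AnalyticAt.fun_sub (by fun_prop) (AnalyticAt.fun_mul (by fun_prop) e2))
      (by fun_prop) hl.2.1)).fun_mul ((AnalyticAt.fun_div (by fun_prop) e1 ?_).fun_pow _)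
    rw [hv0]
    exact hl.2.2
  · simp only [slopeFactor, zero_mul, Prod.mk_zero_zero, hq'.dZ_zero, mul_zero, sub_zero, hv0]
    rw [div_self hS.W_ne, div_self hl.2.1, div_self hl.2.2]
    simp

lemma exists_slope_param (hq : IsNormalGerm q) (hq' : IsNormalGerm q')
    (hS : IsSegreForm q m k R U W) (hS' : IsSegreForm q' m k R' U' W')
    (v : ℂ × JetPair → ℂ) (hv : ∀ l ∈ JetDom, AnalyticAt ℂ v (0, l) ∧ v (0, l) = jetB l)
    (hvm : ∀ l F G fb a, IsSegreMap q q' l F G fb a → ∀ᶠ χ in 𝓝 (0 : ℂ), fb χ = χ * v (χ, l)) :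
    ∃ Ω : ℂ × ℂ × JetPair × ℂ → ℂ, (∀ l ∈ JetDom, AnalyticAt ℂ Ω (0, 0, l, jetB l)) ∧
      ∀ l F G fb a, IsSegreMap q q' l F G fb a → ∀ᶠ p : ℂ × ℂ in 𝓝 0,
        F (p.1 * p.2 ^ k, q (p.1 * p.2 ^ k, p.2, 0)) =
          p.1 * Ω (p.1, p.2, l, segreDet q k fb a p) := by
  let K : ℂ × ℂ → ℂ := fun p => W' p / dT q' (p.1 * p.2 ^ k, p.2, 0) / W' 0
  have hdT : AnalyticAt ℂ (fun p : ℂ × ℂ => dT q' (p.1 * p.2 ^ k, p.2, 0)) 0 :=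
    hq'.an.dT.comp_of_eq (f := fun p : ℂ × ℂ => (p.1 * p.2 ^ k, p.2, (0 : ℂ))) (by fun_prop)
      (by simp)
  have hdT0 : dT q' ((0 : ℂ × ℂ).1 * (0 : ℂ × ℂ).2 ^ k, (0 : ℂ × ℂ).2, 0) = 1 := by
    simp only [Prod.fst_zero, Prod.snd_zero, zero_mul, Prod.mk_zero_zero, hq'.dT_zero]
  have hK : AnalyticAt ℂ K 0 :=
    (hS'.analyticAt_W.fun_div hdT (by
      rw [hdT0]
      exact one_ne_zero)).fun_div analyticAt_const hS'.W_ne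
  have hK0 : K 0 = 1 := by
    simp only [K]
    rw [hdT0, div_one, div_self hS'.W_ne]
  obtain ⟨s, hs, hs0, hrs⟩ := exists_inverse_fst (h := fun p => rootNear m (K p))
    (hK.rootNear m hK0) (by simp only [hK0, rootNear_one])
  let ρ : ℂ × ℂ × JetPair × ℂ → ℂ := fun x =>
    rootNear m (slopeFactor q' W m k v (x.1, x.2.1, x.2.2.1) * jetB x.2.2.1 / x.2.2.2)
  have hρ1 : ∀ l ∈ JetDom, slopeFactor q' W m k v (0, 0, l) * jetB l / jetB l = 1 :=
    fun l hl => by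
      rw [(analyticAt_slopeFactor hq' hS hl (hv l hl).1 (hv l hl).2).2, one_mul, div_self hl.2.2]
  have hρ : ∀ l ∈ JetDom, AnalyticAt ℂ ρ (0, 0, l, jetB l) := fun l hl => by
    have e1 := (analyticAt_slopeFactor hq' hS hl (hv l hl).1 (hv l hl).2).1
    refine AnalyticAt.rootNear m (((e1.comp_of_eq
      (f := fun x : ℂ × ℂ × JetPair × ℂ => (x.1, x.2.1, x.2.2.1)) (by fun_prop) rfl).fun_mul
      (by fun_prop)).fun_div (by fun_prop) hl.2.2) (hρ1 l hl)
  refine ⟨fun x => jetC 0 x.2.2.1 / jetB x.2.2.1 ^ k * ρ x *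
    s (x.1 * (jetC 0 x.2.2.1 / jetB x.2.2.1 ^ k * ρ x), x.2.1 * v (x.2.1, x.2.2.1)) *
    (x.2.1 * v (x.2.1, x.2.2.1)) ^ k, fun l hl => ?_, ?_⟩
  · have e1 : AnalyticAt ℂ (fun x : ℂ × ℂ × JetPair × ℂ => jetC 0 x.2.2.1 / jetB x.2.2.1 ^ k * ρ x)
        (0, 0, l, jetB l) :=
      (AnalyticAt.fun_div (f := fun x : ℂ × ℂ × JetPair × ℂ => jetC 0 x.2.2.1)
        (g := fun x => jetB x.2.2.1 ^ k) (by fun_prop) (by fun_prop)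
        (pow_ne_zero k hl.2.2)).fun_mul (hρ l hl)
    have e2 : AnalyticAt ℂ (fun x : ℂ × ℂ × JetPair × ℂ => x.2.1 * v (x.2.1, x.2.2.1))
        (0, 0, l, jetB l) :=
      AnalyticAt.fun_mul (by fun_prop) ((hv l hl).1.comp_of_eq
        (f := fun x : ℂ × ℂ × JetPair × ℂ => (x.2.1, x.2.2.1)) (by fun_prop) rfl)
    refine (e1.fun_mul (hs.comp_of_eq ((analyticAt_fst.fun_mul e1).prod e2) ?_)).fun_mul
      (e2.fun_pow k)
    simp
  · intro l F G fb a h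
    obtain ⟨hl0, hl3, hlb⟩ := h.mem
    obtain ⟨hvl, hv0⟩ := hv l h.mem
    have hfb := hvm l F G fb a h
    have hk := hS.k_ne
    let w : ℂ → ℂ := fun χ => v (χ, l)
    have hw : AnalyticAt ℂ w 0 :=
      hvl.comp_of_eq (f := fun χ : ℂ => (χ, l)) (by fun_prop) rfl
    have hw0 : w 0 = jetB l := hv0
    let η := segreEta q F k w
    have hη : AnalyticAt ℂ η 0 := h.an_segreEta hq hw hw0 hk
    have hη0 : η 0 = jetC 0 l / jetB l ^ k := h.segreEta_zero hq hw0
    have hw2 : AnalyticAt ℂ (fun p : ℂ × ℂ => w p.2) 0 :=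
      hw.comp_of_eq (f := fun p : ℂ × ℂ => p.2) (by fun_prop) rfl
    let Y : ℂ × ℂ → ℂ × ℂ := fun p => (p.1 * η p, p.2 * w p.2)
    have hY : AnalyticAt ℂ Y 0 := (analyticAt_fst.fun_mul hη).prod (analyticAt_snd.fun_mul hw2)
    have hY0 : Y 0 = 0 := by simp [Y]
    have hYt : Tendsto Y (𝓝 0) (𝓝 0) := by
      have := hY.continuousAt.tendsto
      rwa [hY0] at this
    let z3 : ℂ × ℂ → ℂ × ℂ × ℂ := fun p => (p.1 * p.2 ^ k, p.2, 0)
    have hz3 : AnalyticAt ℂ z3 0 := by fun_prop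
    have hz30 : z3 0 = 0 := by simp [z3]
    let L := segreDet q k fb a
    have hL : AnalyticAt ℂ L 0 :=
      ((h.anfb.deriv.comp_of_eq analyticAt_snd rfl).fun_mul
        (hq.an.dT.comp_of_eq hz3 hz30)).fun_sub ((hq.an.dX.comp_of_eq hz3 hz30).fun_mul
        (h.ana.comp_of_eq analyticAt_snd rfl))
    have hL0 : L 0 = jetB l := by
      have := hq.dX_left.self_of_nhds
      simp only [Prod.mk_zero_zero] at this
      simp only [L, segreDet, Prod.fst_zero, Prod.snd_zero, zero_mul, Prod.mk_zero_zero,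
        hq.dT_zero, this, h.deriv_fb]
      ring
    let g : ℂ → ℂ := fun χ => jetC 3 l - jetC 1 l * dZ q' (0, χ * w χ, 0)
    have hg : AnalyticAt ℂ g 0 := by
      refine analyticAt_const.fun_sub (analyticAt_const.fun_mul (hq'.an.dZ.comp_of_eq
        (f := fun χ : ℂ => ((0 : ℂ), χ * w χ, (0 : ℂ))) ?_ (by simp)))
      exact analyticAt_const.prod ((analyticAt_id.fun_mul hw).prod analyticAt_const)
    have hg0 : g 0 = jetC 3 l := by
      simp only [g, zero_mul, Prod.mk_zero_zero, hq'.dZ_zero, mul_zero, sub_zero]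
    have hW0 : W 0 ≠ 0 := hS.W_ne
    have hW'0 : W' 0 ≠ 0 := hS'.W_ne
    have main : ∀ᶠ p : ℂ × ℂ in 𝓝 0,
        η p ^ m * w p.2 ^ (k * m + (k - 1)) * W' (Y p) * L p =
          W p * dT q' ((Y p).1 * (Y p).2 ^ k, (Y p).2, 0) * g p.2 := by
      refine eventually_eq_of_pow_mul_eq (i := m) (j := k * m + (k - 1)) ?_ ?_ ?_
      · exact (((hη.fun_pow _).fun_mul (hw2.fun_pow _)).fun_mul
          (hS'.analyticAt_W.comp_of_eq hY hY0)).fun_mul hL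
      · exact (hS.analyticAt_W.fun_mul (hdT.comp_of_eq hY hY0)).fun_mul
          (hg.comp_of_eq analyticAt_snd rfl)
      · filter_upwards [(tendsto_curve hk).eventually h.eq_chi,
          (tendsto_curve hk).eventually h.eq_tau, hS.eq_W,
          h.dX_target hq hS' hw hw0 hfb, h.eq_segreEta hq hw hw0 hk,
          (continuous_snd.tendsto (0 : ℂ × ℂ)).eventually hfb,
          (continuous_snd.tendsto (0 : ℂ × ℂ)).eventually (h.dTwoG_conj hq hq')]
          with p h1 h2 h3 h4 h5 h6 h7
        rw [h4] at h1 h2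
        rw [h6] at h7
        rw [h3] at h1
        rw [h7, h5, h6] at h2
        rw [h5, h6] at h1
        simp only [L, segreDet, h3, Y, g, η]
        simp only [w] at h1 h2 ⊢
        linear_combination (p.1 ^ m * p.2 ^ (k * m + (k - 1)) * W p) * h2 -
          dT q (p.1 * p.2 ^ k, p.2, 0) * h1
    have main0 := main.self_of_nhds
    simp only [hη0, hY0, hL0, Prod.fst_zero, Prod.snd_zero, hw0, zero_mul, Prod.mk_zero_zero,
      hq'.dT_zero, hg0] at main0
    have hρl : AnalyticAt ℂ (fun p => ρ (p.1, p.2, l, L p)) 0 := by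
      refine (hρ l h.mem).comp_of_eq (f := fun p : ℂ × ℂ => (p.1, p.2, l, L p)) ?_
        (by simp only [hL0, Prod.fst_zero, Prod.snd_zero])
      exact analyticAt_fst.prod (analyticAt_snd.prod (analyticAt_const.prod hL))
    have key : ∀ᶠ p : ℂ × ℂ in 𝓝 0,
        η p / (jetC 0 l / jetB l ^ k) * rootNear m (K (Y p)) = ρ (p.1, p.2, l, L p) := by
      have hKY : AnalyticAt ℂ (fun p => rootNear m (K (Y p))) 0 :=
        (hK.comp_of_eq hY hY0).rootNear m (by rw [Function.comp_apply, hY0, hK0])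
      refine eventually_eq_of_pow_eq hS.m_ne
        ((hη.continuousAt.div_const _).mul hKY.continuousAt) hρl.continuousAt ?_ ?_ ?_
      · rw [hη0, hY0, hK0, rootNear_one, mul_one, div_self]
        exact div_ne_zero hl0 (pow_ne_zero k hlb)
      · simp only [ρ, Prod.fst_zero, Prod.snd_zero, hL0, hρ1 l h.mem, rootNear_one]
      · have hdTY : AnalyticAt ℂ (fun p => dT q' ((Y p).1 * (Y p).2 ^ k, (Y p).2, 0)) 0 :=
          hdT.comp_of_eq hY hY0
        have n1 : ∀ᶠ p in 𝓝 (0 : ℂ × ℂ), dT q' ((Y p).1 * (Y p).2 ^ k, (Y p).2, 0) ≠ 0 := by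
          refine hdTY.continuousAt.eventually_ne ?_
          rw [hY0, hdT0]
          exact one_ne_zero
        filter_upwards [main, n1, hL.continuousAt.eventually_ne (hL0 ▸ hlb),
          hw2.continuousAt.eventually_ne (hw0 ▸ hlb)] with p h1 h2 h3 h4
        simp only [ρ]
        rw [mul_pow, rootNear_pow hS.m_ne, rootNear_pow hS.m_ne]
        simp only [K, slopeFactor]
        change _ = W p / W 0 * (g p.2 / jetC 3 l) * (jetB l / w p.2) ^ _ * jetB l / L p
        rw [div_pow, div_pow (jetB l)]
        have m1 := pow_ne_zero m (div_ne_zero hl0 (pow_ne_zero k hlb))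
        have m2 := pow_ne_zero (k * m + (k - 1)) hlb
        have m3 := pow_ne_zero (k * m + (k - 1)) h4
        generalize (jetC 0 l / jetB l ^ k) ^ m = A at *
        generalize jetB l ^ (k * m + (k - 1)) = B at *
        generalize w p.2 ^ (k * m + (k - 1)) = C at *
        generalize dT q' ((Y p).1 * (Y p).2 ^ k, (Y p).2, 0) = D at *
        generalize η p ^ m = e at *
        rw [div_mul_div_comm, div_mul_div_comm, div_mul_div_comm]
        field_simp
        linear_combination (W 0 * jetC 3 l) * h1 - (W p * D * g p.2) * main0
    filter_upwards [key, hYt.eventually hrs, h.eq_segreEta hq hw hw0 hk] with p h1 h2 h3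
    have h4 : p.1 * (jetC 0 l / jetB l ^ k * ρ (p.1, p.2, l, L p)) =
        (Y p).1 * rootNear m (K (Y p)) := by
      have := div_ne_zero hl0 (pow_ne_zero k hlb)
      rw [← h1]
      simp only [Y]
      generalize jetC 0 l / jetB l ^ k = A at *
      field_simp
    change _ = p.1 * (jetC 0 l / jetB l ^ k * ρ (p.1, p.2, l, L p) *
      s (p.1 * (jetC 0 l / jetB l ^ k * ρ (p.1, p.2, l, L p)), (Y p).2) * (Y p).2 ^ k)
    rw [h3, h4]
    change (Y p).1 * (Y p).2 ^ k = _
    rw [← mul_assoc, ← mul_assoc, h4]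
    exact congrArg (· * (Y p).2 ^ k) h2.symm

end MapComponent

section Asymptotics

open Asymptotics

variable {E : Type*} [NormedAddCommGroup E] [NormedSpace ℂ E]

lemma coeffAt_eq_of_isLittleO {m : ℕ} (hm : m ≠ 0) {f : ℂ × E → ℂ} {g : ℂ → ℂ} {y : E}
    (hg : ContinuousAt g 0)
    (h : (fun t => f (t, y) - t ^ m * g t) =o[𝓝 0] fun t : ℂ => t ^ m) :
    coeffAt m f y = g 0 := by
  let r : ℂ → ℂ := fun t => (f (t, y) - t ^ m * g t) / t ^ m
  have hr : ContinuousAt r 0 := by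
    have := h.tendsto_div_nhds_zero
    have h0 : r 0 = 0 := by simp [r, hm]
    rw [ContinuousAt, h0]
    exact this
  have h1 : coeffAt m f y = g 0 + r 0 := by
    refine coeffAt_eq (g := fun t => g t + r t) (hg.add hr) ?_
    have h0 : f (0, y) = 0 := by
      have := h.bound zero_lt_one
      have := this.self_of_nhds
      simpa [hm] using this
    refine Eventually.of_forall fun t => ?_
    rcases eq_or_ne t 0 with rfl | ht
    · rw [h0, zero_pow hm, zero_mul]
    · have := pow_ne_zero m ht
      simp only [r]
      field_simp
      ring
  rw [h1]
  simp [r, hm]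

lemma AnalyticAt.isBigO_comp_sub {Φ : E → ℂ} {x : E} {u v : ℂ → E} (hΦ : AnalyticAt ℂ Φ x)
    (hu : Tendsto u (𝓝 0) (𝓝 x)) (hv : Tendsto v (𝓝 0) (𝓝 x)) :
    (fun t => Φ (u t) - Φ (v t)) =O[𝓝 0] fun t => u t - v t :=
  hΦ.hasStrictFDerivAt.isBigO_sub.comp_tendsto (hu.prodMk_nhds hv)

lemma AnalyticAt.isLittleO_comp_sub {φ : ℂ × ℂ → ℂ} {u v : ℂ → ℂ × ℂ} (hφ : AnalyticAt ℂ φ 0)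
    (hu : Tendsto u (𝓝 0) (𝓝 0)) (hv : Tendsto v (𝓝 0) (𝓝 0)) :
    (fun t => φ (u t) - φ (v t) - (((u t).1 - (v t).1) * _root_.dOne φ 0 +
      ((u t).2 - (v t).2) * _root_.dTwo φ 0)) =o[𝓝 0] fun t => u t - v t := by
  refine (hφ.hasStrictFDerivAt.isLittleO.comp_tendsto (hu.prodMk_nhds hv)).congr_left fun t => ?_
  simp only [Function.comp_apply]
  rw [← fderiv_apply_eq_add₂]
  rfl

lemma eventually_eventually_slice {P : ℂ × ℂ → Prop} (h : ∀ᶠ p in 𝓝 (0 : ℂ × ℂ), P p) :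
    ∀ᶠ χ in 𝓝 (0 : ℂ), ∀ᶠ t in 𝓝 (0 : ℂ), P (t, χ) := by
  filter_upwards [tendsto_left.eventually h.eventually_nhds] with χ hχ
  exact (Continuous.tendsto' (f := fun t : ℂ => (t, χ)) (by fun_prop) 0 _ rfl).eventually hχ

variable {q q' : ℂ × ℂ × ℂ → ℂ} {m k : ℕ} {R U W R' U' W' : ℂ × ℂ → ℂ}
  {l : JetPair} {F G : ℂ × ℂ → ℂ} {fb a w : ℂ → ℂ}

lemma IsSegreForm.dZ_eq (hq : IsNormalGerm q) (hS : IsSegreForm q m k R U W) :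
    ∀ᶠ p : ℂ × ℂ in 𝓝 0,
      dZ q (p.1, p.2, 0) = p.1 ^ (m - 1) * (m * R p + p.1 * dOne R p) := by
  filter_upwards [hS.eq_R.eventually_nhds, hS.analyticAt_R.eventually_analyticAt,
    tendsto_slice.eventually hq.an.eventually_analyticAt] with p h1 h2 h3
  have e1 := hasDerivAt_comp₃ h3.differentiableAt (hasDerivAt_id p.1)
      (hasDerivAt_const p.1 p.2) (hasDerivAt_const p.1 (0 : ℂ)) rfl
  have e2 := hasDerivAt_comp₂ h2.differentiableAt (hasDerivAt_id p.1)
      (hasDerivAt_const p.1 p.2) rfl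
  have e3 : ∀ᶠ s in 𝓝 p.1, q (s, p.2, 0) = s ^ m * R (s, p.2) :=
    (Continuous.tendsto' (f := fun s : ℂ => (s, p.2)) (by fun_prop) p.1 p rfl).eventually h1
  have e4 := e1.unique (((hasDerivAt_pow m p.1).mul e2).congr_of_eventuallyEq e3)
  obtain ⟨j, rfl⟩ := Nat.exists_eq_succ_of_ne_zero hS.m_ne
  simp only [id, one_mul, zero_mul, add_zero] at e4
  rw [e4, Nat.succ_eq_add_one, Nat.add_sub_cancel, pow_succ]
  push_cast
  ring

/-- For `m ≥ 2`, the transversal derivative is constant along `w = 0`. -/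
lemma IsSegreMap.dTwoG_const (h : IsSegreMap q q' l F G fb a) (hq : IsNormalGerm q)
    (hq' : IsNormalGerm q') (hS' : IsSegreForm q' m k R' U' W') (hm : m ≠ 1) :
    (∀ᶠ z : ℂ in 𝓝 0, dTwo G (z, 0) = jetC 3 l) ∧ jetC 8 l = 0 := by
  have h1 : ∀ᶠ χ : ℂ in 𝓝 0, cj (dTwo G (cj χ, 0)) = jetC 3 l := by
    filter_upwards [h.dTwoG_conj hq hq',
      h.tendsto_fb.eventually (tendsto_left.eventually (hS'.dZ_eq hq'))] with χ h1 h2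
    have : m - 1 ≠ 0 := by
      have := hS'.m_ne
      omega
    simp only [zero_pow this, zero_mul] at h2
    rw [h1, h2, mul_zero, sub_zero]
  have h2 : cj (jetC 3 l) = jetC 3 l := by
    have := h1.self_of_nhds
    rwa [cj_zero, Prod.mk_zero_zero, h.dTwoG] at this
  have h3 : ∀ᶠ z : ℂ in 𝓝 0, dTwo G (z, 0) = jetC 3 l := by
    filter_upwards [(continuous_cj.tendsto' 0 0 cj_zero).eventually h1] with z hz
    rw [cj_cj] at hz
    rw [← cj_cj (dTwo G (z, 0)), hz, h2]
  refine ⟨h3, ?_⟩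
  rw [← h.dOneTwoG, ← Prod.mk_zero_zero, ← deriv_slice_fst h.anG.dTwo.differentiableAt]
  exact (Filter.EventuallyEq.deriv_eq h3).trans (deriv_const _ _)

lemma IsSegreMap.dTwoF_isLittleO (h : IsSegreMap q q' l F G fb a) {z s : ℂ → ℂ}
    (hz : z =O[𝓝 0] fun t : ℂ => t) (hs : s =O[𝓝 0] fun t : ℂ => t) :
    (fun t => jetC 1 l + jetC 5 l * z t + jetC 6 l * s t - dTwo F (z t, s t)) =o[𝓝 0]
      fun t : ℂ => t := by
  have t1 : Tendsto (fun t => (z t, s t)) (𝓝 0) (𝓝 0) :=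
    (hz.trans_tendsto tendsto_id).prodMk_nhds (hs.trans_tendsto tendsto_id)
  have h1 := (h.anF.dTwo.isLittleO_comp_sub t1 tendsto_const_nhds).trans_isBigO
    (g := fun t : ℂ => (z t, s t) - (0 : ℂ × ℂ)) (k := fun t : ℂ => t) ?_
  · refine h1.neg_left.congr_left fun t => ?_
    simp only [h.dOneTwoF, h.dTwoTwoF, h.dTwoF, Prod.fst_zero, Prod.snd_zero]
    ring
  · simp only [sub_zero]
    exact hz.prod_left hs

lemma IsSegreMap.dTwoG_isLittleO (h : IsSegreMap q q' l F G fb a) (hq : IsNormalGerm q)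
    (hq' : IsNormalGerm q') (hS' : IsSegreForm q' m k R' U' W') {z s : ℂ → ℂ}
    (hz : z =O[𝓝 0] fun t : ℂ => t) (hs : s =O[𝓝 0] fun t : ℂ => t ^ m) :
    (fun t => jetC 3 l + jetC 8 l * z t + jetC 9 l * s t - dTwo G (z t, s t)) =o[𝓝 0]
      fun t : ℂ => t ^ m := by
  have hm : m ≠ 0 := hS'.m_ne
  have z1 : Tendsto z (𝓝 0) (𝓝 0) := hz.trans_tendsto tendsto_id
  have s1 : Tendsto s (𝓝 0) (𝓝 0) :=
    hs.trans_tendsto (Continuous.tendsto' (by fun_prop) _ _ (by simp [hm]))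
  have t1 : Tendsto (fun t => (z t, s t)) (𝓝 0) (𝓝 0) := z1.prodMk_nhds s1
  have t2 : Tendsto (fun t => (z t, (0 : ℂ))) (𝓝 0) (𝓝 0) := z1.prodMk_nhds tendsto_const_nhds
  have h1 := (h.anG.dTwo.isLittleO_comp_sub t1 t2).trans_isBigO
    (g := fun t : ℂ => (z t, s t) - (z t, (0 : ℂ))) (k := fun t : ℂ => t ^ m) (by
      simp only [Prod.mk_sub_mk, sub_self, sub_zero]
      exact (isBigO_zero _ _).prod_left hs)
  have h2 : (fun t => dTwo G (z t, 0) - (jetC 3 l + jetC 8 l * z t)) =o[𝓝 0]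
      fun t : ℂ => t ^ m := by
    by_cases hm1 : m = 1
    · have h3 := (h.anG.dTwo.isLittleO_comp_sub t2 tendsto_const_nhds).trans_isBigO
        (g := fun t : ℂ => (z t, (0 : ℂ)) - (0 : ℂ × ℂ)) (k := fun t : ℂ => t ^ m) (by
          simp only [sub_zero, hm1, pow_one]
          exact hz.prod_left (isBigO_zero _ _))
      refine h3.congr_left fun t => ?_
      simp only [h.dOneTwoG, h.dTwoG, Prod.fst_zero, Prod.snd_zero]
      ring
    · obtain ⟨h3, h4⟩ := h.dTwoG_const hq hq' hS' hm1
      refine (isLittleO_zero _ _).congr' ?_ EventuallyEq.rfl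
      filter_upwards [z1.eventually h3] with t ht
      rw [ht, h4]
      ring
  refine (h1.add h2).neg_left.congr_left fun t => ?_
  simp only [h.dTwoTwoG]
  ring

end Asymptotics

section FirstComponent

open Asymptotics

variable {q q' : ℂ × ℂ × ℂ → ℂ} {m k : ℕ} {R U W R' U' W' : ℂ × ℂ → ℂ}
  {l : JetPair} {F G : ℂ × ℂ → ℂ} {fb a w : ℂ → ℂ}
  {v : ℂ × JetPair → ℂ} {Ω : ℂ × ℂ × JetPair × ℂ → ℂ}

/-- The point `(t χ ^ k, χ, 0)` attached to the parameters `(t, χ, l)`. -/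
def curvePoint (k : ℕ) (x : ℂ × ℂ × JetPair) : ℂ × ℂ × ℂ := (x.1 * x.2.1 ^ k, x.2.1, 0)

/-- The derivative of `χ * v (χ, l)` in `χ`. -/
def conjDeriv (v : ℂ × JetPair → ℂ) (y : ℂ × JetPair) : ℂ :=
  fderiv ℂ (fun y : ℂ × JetPair => y.1 * v y) y (1, 0)

/-- The leading part of the determinant `segreDet`. -/
def slopeZero (q : ℂ × ℂ × ℂ → ℂ) (k : ℕ) (v : ℂ × JetPair → ℂ) (x : ℂ × ℂ × JetPair) : ℂ :=
  conjDeriv v x.2 * dT q (curvePoint k x)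

/-- The first component of a map, computed from a value of the determinant. -/
def firstOf (v : ℂ × JetPair → ℂ) (Ω : ℂ × ℂ × JetPair × ℂ → ℂ) (L : ℂ × ℂ × JetPair → ℂ)
    (x : ℂ × ℂ × JetPair) : ℂ × ℂ × ℂ :=
  (x.1 * Ω (x.1, x.2.1, x.2.2, L x), x.2.1 * v x.2, 0)

/-- The transversal derivative of the conjugate map. -/
def conjSecond (q' : ℂ × ℂ × ℂ → ℂ) (v : ℂ × JetPair → ℂ) (y : ℂ × JetPair) : ℂ :=
  jetC 3 y.2 - jetC 1 y.2 * dZ q' (0, y.1 * v y, 0)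

/-- The second order approximation of `q'_χ a` along the curves `z = t χ ^ k`. -/
def transApprox (q q' : ℂ × ℂ × ℂ → ℂ) (k : ℕ) (v : ℂ × JetPair → ℂ)
    (Ω : ℂ × ℂ × JetPair × ℂ → ℂ) (x : ℂ × ℂ × JetPair) : ℂ :=
  (jetC 3 x.2.2 + jetC 8 x.2.2 * (curvePoint k x).1 + jetC 9 x.2.2 * q (curvePoint k x) -
    dZ q' (firstOf v Ω (slopeZero q k v) x) * (jetC 1 x.2.2 + jetC 5 x.2.2 * (curvePoint k x).1 +
      jetC 6 x.2.2 * q (curvePoint k x))) * dT q (curvePoint k x) -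
    dT q' (firstOf v Ω (slopeZero q k v) x) * conjSecond q' v x.2

/-- The factor relating the leading coefficient of `transApprox` to `a`. -/
def leadFactor (q : ℂ × ℂ × ℂ → ℂ) (W' : ℂ × ℂ → ℂ) (m k : ℕ) (v : ℂ × JetPair → ℂ)
    (y : ℂ × JetPair) : ℂ :=
  (jetC 0 y.2 + jetC 1 y.2 * dZ q (0, y.1, 0)) ^ m * v y ^ (k - 1) * W' (0, y.1 * v y)

/-- The determinant `segreDet` expressed through the jet. -/
def slopeParam (q q' : ℂ × ℂ × ℂ → ℂ) (W W' : ℂ × ℂ → ℂ) (m k : ℕ) (v : ℂ × JetPair → ℂ)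
    (Ω : ℂ × ℂ × JetPair × ℂ → ℂ) (x : ℂ × ℂ × JetPair) : ℂ :=
  slopeZero q k v x - x.1 ^ m * W (x.1, x.2.1) *
    (coeffAt m (transApprox q q' k v Ω) x.2 / leadFactor q W' m k v x.2)

lemma analyticAt_curvePoint (k : ℕ) (x : ℂ × ℂ × JetPair) : AnalyticAt ℂ (curvePoint k) x := by
  unfold curvePoint
  fun_prop

lemma curvePoint_zero (k : ℕ) (l : JetPair) : curvePoint k (0, 0, l) = 0 := by
  simp [curvePoint]

lemma analyticAt_conjDeriv (hv : AnalyticAt ℂ v (0, l)) : AnalyticAt ℂ (conjDeriv v) (0, l) :=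
  (analyticAt_fst.fun_mul hv).fderiv_apply_const _

lemma conjDeriv_eq {χ : ℂ} (hv : AnalyticAt ℂ v (χ, l)) (hfb : ∀ᶠ χ in 𝓝 χ, fb χ = χ * v (χ, l)) :
    conjDeriv v (χ, l) = deriv fb χ := by
  have h1 : DifferentiableAt ℂ (fun y : ℂ × JetPair => y.1 * v y) (χ, l) :=
    (analyticAt_fst.fun_mul hv).differentiableAt
  have h2 : HasDerivAt (fun s : ℂ => (s, l)) ((1 : ℂ), (0 : JetPair)) χ :=
    (hasDerivAt_id χ).prodMk (hasDerivAt_const χ l)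
  have h3 := h1.hasFDerivAt.comp_hasDerivAt χ h2
  exact (h3.congr_of_eventuallyEq hfb).deriv.symm

lemma conjDeriv_zero (hv : AnalyticAt ℂ v (0, l)) : conjDeriv v (0, l) = v (0, l) := by
  have h1 : HasDerivAt (fun s : ℂ => (s, l)) ((1 : ℂ), (0 : JetPair)) 0 :=
    (hasDerivAt_id 0).prodMk (hasDerivAt_const 0 l)
  have h2 := (hasDerivAt_id (0 : ℂ)).mul (hv.differentiableAt.hasFDerivAt.comp_hasDerivAt 0 h1)
  rw [conjDeriv_eq hv (fb := fun χ => χ * v (χ, l)) (Eventually.of_forall fun _ => rfl)]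
  refine h2.deriv.trans ?_
  simp

lemma analyticAt_slopeZero (hq : IsNormalGerm q) (hv : AnalyticAt ℂ v (0, l)) :
    AnalyticAt ℂ (slopeZero q k v) (0, 0, l) :=
  ((analyticAt_conjDeriv hv).comp_of_eq (f := fun x : ℂ × ℂ × JetPair => x.2)
    (by fun_prop) rfl).fun_mul
    (hq.an.dT.comp_of_eq (analyticAt_curvePoint k _) (curvePoint_zero k l))

lemma slopeZero_zero (hq : IsNormalGerm q) (hv : AnalyticAt ℂ v (0, l)) :
    slopeZero q k v (0, 0, l) = v (0, l) := by
  rw [slopeZero, curvePoint_zero, hq.dT_zero, mul_one, conjDeriv_zero hv]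

lemma analyticAt_firstOf {L : ℂ × ℂ × JetPair → ℂ} (hv : AnalyticAt ℂ v (0, l))
    (hL : AnalyticAt ℂ L (0, 0, l)) (hΩ : AnalyticAt ℂ Ω (0, 0, l, L (0, 0, l))) :
    AnalyticAt ℂ (firstOf v Ω L) (0, 0, l) := by
  have h1 : AnalyticAt ℂ (fun x : ℂ × ℂ × JetPair => (x.1, x.2.1, x.2.2, L x)) (0, 0, l) :=
    analyticAt_fst.prod (AnalyticAt.prod (by fun_prop) (AnalyticAt.prod (by fun_prop) hL))
  have h2 := hΩ.comp_of_eq h1 rfl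
  have h3 : AnalyticAt ℂ (fun x : ℂ × ℂ × JetPair => v x.2) (0, 0, l) :=
    hv.comp_of_eq (f := fun x : ℂ × ℂ × JetPair => x.2) (by fun_prop) rfl
  exact (analyticAt_fst.fun_mul h2).prod ((AnalyticAt.fun_mul (by fun_prop) h3).prod
    analyticAt_const)

lemma firstOf_zero (L : ℂ × ℂ × JetPair → ℂ) : firstOf v Ω L (0, 0, l) = 0 := by
  simp [firstOf]

lemma analyticAt_conjSecond (hq' : IsNormalGerm q') (hv : AnalyticAt ℂ v (0, l)) :
    AnalyticAt ℂ (conjSecond q' v) (0, l) := by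
  refine AnalyticAt.fun_sub (by fun_prop) (AnalyticAt.fun_mul (by fun_prop) (hq'.an.dZ.comp_of_eq
    (f := fun y : ℂ × JetPair => ((0 : ℂ), y.1 * v y, (0 : ℂ))) ?_ (by simp)))
  exact analyticAt_const.prod ((analyticAt_fst.fun_mul hv).prod analyticAt_const)

lemma analyticAt_transApprox (hq : IsNormalGerm q) (hq' : IsNormalGerm q')
    (hv : AnalyticAt ℂ v (0, l)) (hΩ : AnalyticAt ℂ Ω (0, 0, l, v (0, l))) :
    AnalyticAt ℂ (transApprox q q' k v Ω) (0, 0, l) := by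
  have h1 := analyticAt_firstOf hv (analyticAt_slopeZero (k := k) hq hv)
    (Ω := Ω) (by rwa [slopeZero_zero hq hv])
  have h2 := hq'.an.dZ.comp_of_eq h1 (firstOf_zero _)
  have h3 := hq'.an.dT.comp_of_eq h1 (firstOf_zero _)
  have hc := analyticAt_curvePoint k (0, 0, l)
  have h4 := hq.an.comp_of_eq hc (curvePoint_zero k l)
  have h5 := hq.an.dT.comp_of_eq hc (curvePoint_zero k l)
  have h6 : AnalyticAt ℂ (fun x : ℂ × ℂ × JetPair => conjSecond q' v x.2) (0, 0, l) :=
    (analyticAt_conjSecond hq' hv).comp_of_eq (f := fun x : ℂ × ℂ × JetPair => x.2)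
      (by fun_prop) rfl
  have h7 : AnalyticAt ℂ (fun x => (curvePoint k x).1) (0, 0, l) := hc.fst_comp
  have hj : ∀ i : Fin 10, AnalyticAt ℂ (fun x : ℂ × ℂ × JetPair => jetC i x.2.2) (0, 0, l) :=
    fun i => by fun_prop
  have h8 : ∀ i j n : Fin 10, AnalyticAt ℂ (fun x : ℂ × ℂ × JetPair => jetC i x.2.2 +
      jetC j x.2.2 * (curvePoint k x).1 + jetC n x.2.2 * q (curvePoint k x)) (0, 0, l) :=
    fun i j n => ((hj i).fun_add ((hj j).fun_mul h7)).fun_add ((hj n).fun_mul h4)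
  exact (((h8 3 8 9).fun_sub (h2.fun_mul (h8 1 5 6))).fun_mul h5).fun_sub (h3.fun_mul h6)

lemma analyticAt_leadFactor (hq : IsNormalGerm q) (hS' : IsSegreForm q' m k R' U' W')
    (hv : AnalyticAt ℂ v (0, l)) : AnalyticAt ℂ (leadFactor q W' m k v) (0, l) := by
  have h1 : AnalyticAt ℂ (fun y : ℂ × JetPair => dZ q (0, y.1, 0)) (0, l) :=
    hq.an.dZ.comp_of_eq (f := fun y : ℂ × JetPair => ((0 : ℂ), y.1, (0 : ℂ))) (by fun_prop) rfl
  have h2 : AnalyticAt ℂ (fun y : ℂ × JetPair => W' (0, y.1 * v y)) (0, l) :=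
    hS'.analyticAt_W.comp_of_eq (f := fun y : ℂ × JetPair => ((0 : ℂ), y.1 * v y))
      (analyticAt_const.prod (analyticAt_fst.fun_mul hv)) (by simp)
  exact (((AnalyticAt.fun_add (by fun_prop) (AnalyticAt.fun_mul (by fun_prop) h1)).fun_pow
    m).fun_mul (hv.fun_pow _)).fun_mul h2

lemma leadFactor_ne (hq : IsNormalGerm q) (hS' : IsSegreForm q' m k R' U' W')
    (hl : l ∈ JetDom) (hv0 : v (0, l) = jetB l) : leadFactor q W' m k v (0, l) ≠ 0 := by
  simp only [leadFactor, Prod.mk_zero_zero, hq.dZ_zero, hv0, zero_mul, mul_zero, add_zero]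
  exact mul_ne_zero (mul_ne_zero (pow_ne_zero _ hl.1) (pow_ne_zero _ hl.2.2)) hS'.W_ne

lemma analyticAt_slopeParam (hq : IsNormalGerm q) (hq' : IsNormalGerm q')
    (hS : IsSegreForm q m k R U W) (hS' : IsSegreForm q' m k R' U' W')
    (hl : l ∈ JetDom) (hv : AnalyticAt ℂ v (0, l)) (hv0 : v (0, l) = jetB l)
    (hΩ : AnalyticAt ℂ Ω (0, 0, l, jetB l)) :
    AnalyticAt ℂ (slopeParam q q' W W' m k v Ω) (0, 0, l) := by
  have h1 : AnalyticAt ℂ (fun y : ℂ × JetPair =>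
      coeffAt m (transApprox q q' k v Ω) y / leadFactor q W' m k v y) (0, l) :=
    (analyticAt_coeffAt (analyticAt_transApprox hq hq' hv (by rwa [hv0])) m).fun_div
      (analyticAt_leadFactor hq hS' hv) (leadFactor_ne hq hS' hl hv0)
  have h2 : AnalyticAt ℂ (fun x : ℂ × ℂ × JetPair => W (x.1, x.2.1)) (0, 0, l) :=
    hS.analyticAt_W.comp_of_eq (f := fun x : ℂ × ℂ × JetPair => (x.1, x.2.1)) (by fun_prop) rfl
  exact (analyticAt_slopeZero hq hv).fun_sub ((AnalyticAt.fun_mul (by fun_prop) h2).fun_mul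
    (h1.comp_of_eq (f := fun x : ℂ × ℂ × JetPair => x.2) (by fun_prop) rfl))

lemma slopeParam_zero (hq : IsNormalGerm q) (hS : IsSegreForm q m k R U W)
    (hv : AnalyticAt ℂ v (0, l)) :
    slopeParam q q' W W' m k v Ω (0, 0, l) = v (0, l) := by
  rw [slopeParam, slopeZero_zero hq hv, zero_pow hS.m_ne, zero_mul, zero_mul, sub_zero]

end FirstComponent

section LeadingCoefficient

open Asymptotics

variable {q q' : ℂ × ℂ × ℂ → ℂ} {m k : ℕ} {R U W R' U' W' : ℂ × ℂ → ℂ}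
  {l : JetPair} {F G : ℂ × ℂ → ℂ} {fb a : ℂ → ℂ}
  {v : ℂ × JetPair → ℂ} {Ω : ℂ × ℂ × JetPair × ℂ → ℂ}

lemma eventually_conjDeriv (hv : AnalyticAt ℂ v (0, l))
    (hfb : ∀ᶠ χ in 𝓝 (0 : ℂ), fb χ = χ * v (χ, l)) :
    ∀ᶠ χ in 𝓝 (0 : ℂ), conjDeriv v (χ, l) = deriv fb χ := by
  have h1 := (Continuous.tendsto' (f := fun χ : ℂ => (χ, l)) (by fun_prop) 0 _ rfl).eventually
    hv.eventually_analyticAt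
  filter_upwards [h1, hfb.eventually_nhds] with χ h2 h3
  exact conjDeriv_eq h2 h3

lemma IsSegreMap.transApprox_isLittleO (h : IsSegreMap q q' l F G fb a) (hq : IsNormalGerm q)
    (hq' : IsNormalGerm q') (hS : IsSegreForm q m k R U W) (hS' : IsSegreForm q' m k R' U' W')
    (hv : AnalyticAt ℂ v (0, l)) (hv0 : v (0, l) = jetB l)
    (hfb : ∀ᶠ χ in 𝓝 (0 : ℂ), fb χ = χ * v (χ, l)) (hΩ : AnalyticAt ℂ Ω (0, 0, l, jetB l))
    (hF : ∀ᶠ p : ℂ × ℂ in 𝓝 0, F (p.1 * p.2 ^ k, q (p.1 * p.2 ^ k, p.2, 0)) =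
      p.1 * Ω (p.1, p.2, l, segreDet q k fb a p)) :
    ∀ᶠ χ in 𝓝 (0 : ℂ), (fun t => transApprox q q' k v Ω (t, χ, l) -
      dX q' (F (t * χ ^ k, q (t * χ ^ k, χ, 0)), fb χ, 0) * a χ) =o[𝓝 0] fun t : ℂ => t ^ m := by
  have hm := hS.m_ne
  have hL0 := analyticAt_slopeZero (k := k) hq hv
  have tl : Tendsto (fun χ : ℂ => ((0 : ℂ), χ, l)) (𝓝 0) (𝓝 (0, 0, l)) :=
    Continuous.tendsto' (by fun_prop) _ _ rfl
  have tΩ : Tendsto (fun χ : ℂ => ((0 : ℂ), χ, l, slopeZero q k v (0, χ, l))) (𝓝 0)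
      (𝓝 (0, 0, l, jetB l)) := by
    have h1 := hL0.continuousAt.tendsto.comp tl
    rw [slopeZero_zero hq hv, hv0] at h1
    exact tendsto_const_nhds.prodMk_nhds (tendsto_id.prodMk_nhds
      (tendsto_const_nhds.prodMk_nhds h1))
  filter_upwards [eventually_eventually_slice ((tendsto_curve hS.k_ne).eventually h.eq_tau),
    h.dTwoG_conj hq hq', eventually_eventually_slice hF, eventually_eventually_slice hS.eq_W,
    eventually_eventually_slice hS.eq_U, hfb, eventually_conjDeriv hv hfb,
    tendsto_left.eventually hS.analyticAt_U.eventually_analyticAt,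
    tendsto_left.eventually hS.analyticAt_W.eventually_analyticAt,
    (tendsto_slice.comp tendsto_left).eventually hq.an.eventually_analyticAt,
    (tendsto_slice.comp (tendsto_left.comp h.tendsto_fb)).eventually hq'.an.eventually_analyticAt,
    tΩ.eventually hΩ.eventually_analyticAt,
    tl.eventually hL0.eventually_analyticAt,
    (tendsto_left.comp h.tendsto_fb).eventually hS'.analyticAt_R.eventually_analyticAt,
    h.tendsto_fb.eventually (eventually_eventually_slice (hS'.dZ_eq hq'))]
    with χ e1 e2 e3 e4 e5 e6 e7 anU anW anq anq' anΩ anL anR e8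
  have anq : AnalyticAt ℂ q (0, χ, 0) := anq
  have anq' : AnalyticAt ℂ q' (0, fb χ, 0) := anq'
  have anR : AnalyticAt ℂ R' (0, fb χ) := anR
  have id1 : (fun t : ℂ => t ^ m) =O[𝓝 0] fun t : ℂ => t := by
    have h1 : (fun t : ℂ => t ^ (m - 1)) =O[𝓝 0] fun _ : ℂ => (1 : ℂ) :=
      ((continuous_pow (M := ℂ) (m - 1)).tendsto (0 : ℂ)).isBigO_one ℂ
    have := (isBigO_refl (fun t : ℂ => t) (𝓝 0)).mul h1
    refine (this.congr_left fun t => ?_).congr_right fun t => mul_one t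
    rw [← pow_succ', Nat.sub_add_cancel (Nat.one_le_iff_ne_zero.mpr hm)]
  have tm : Tendsto (fun t : ℂ => t ^ m) (𝓝 0) (𝓝 0) :=
    Continuous.tendsto' (by fun_prop) _ _ (by simp [hm])
  -- the source point
  let z : ℂ → ℂ := fun t => t * χ ^ k
  let s : ℂ → ℂ := fun t => q (z t, χ, 0)
  have hz : z =O[𝓝 0] fun t : ℂ => t :=
    ((isBigO_refl (fun t : ℂ => t) (𝓝 0)).const_mul_left (χ ^ k)).congr_left
      fun t => mul_comm _ _
  have tχ : Tendsto (fun t : ℂ => (t, χ)) (𝓝 0) (𝓝 (0, χ)) :=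
    Continuous.tendsto' (by fun_prop) _ _ rfl
  have hs : s =O[𝓝 0] fun t : ℂ => t ^ m := by
    have h1 := (isBigO_refl (fun t : ℂ => t ^ m) (𝓝 0)).mul
      (((anU.continuousAt.tendsto.comp tχ).const_mul (χ ^ (k * m + k))).isBigO_one ℂ)
    refine (h1.congr' ?_ EventuallyEq.rfl).congr_right fun t => mul_one _
    filter_upwards [e5] with t ht
    simp only [s, z, ht, Function.comp_apply]
    ring
  have tz : Tendsto (fun t => (z t, χ, (0 : ℂ))) (𝓝 0) (𝓝 (0, χ, 0)) :=
    Continuous.tendsto' (by fun_prop) _ _ (by simp [z])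
  have hqτ := (anq.dT.continuousAt.tendsto.comp tz).isBigO_one ℂ
  -- the determinants
  let L₀ : ℂ → ℂ := fun t => slopeZero q k v (t, χ, l)
  let L : ℂ → ℂ := fun t => segreDet q k fb a (t, χ)
  have hLL : (fun t => L t - L₀ t) =O[𝓝 0] fun t : ℂ => t ^ m := by
    have h1 := (isBigO_refl (fun t : ℂ => t ^ m) (𝓝 0)).mul
      (((anW.continuousAt.tendsto.comp tχ).const_mul
        (-(χ ^ (k * m + (k - 1)) * a χ))).isBigO_one ℂ)
    refine (h1.congr' ?_ EventuallyEq.rfl).congr_right fun t => mul_one _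
    filter_upwards [e4] with t ht
    simp only [L, L₀, segreDet, slopeZero, curvePoint, ht, e7, Function.comp_apply]
    ring
  have tL₀ : Tendsto L₀ (𝓝 0) (𝓝 (slopeZero q k v (0, χ, l))) :=
    anL.continuousAt.tendsto.comp (f := fun t : ℂ => (t, χ, l))
      (Continuous.tendsto' (by fun_prop) _ _ rfl)
  have tL : Tendsto L (𝓝 0) (𝓝 (slopeZero q k v (0, χ, l))) := by
    have h1 := tL₀.add (hLL.trans_tendsto tm)
    rw [add_zero] at h1
    exact h1.congr fun t => by ring
  have tP : ∀ M : ℂ → ℂ, Tendsto M (𝓝 0) (𝓝 (slopeZero q k v (0, χ, l))) →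
      Tendsto (fun t => (t, χ, l, M t)) (𝓝 0) (𝓝 (0, χ, l, slopeZero q k v (0, χ, l))) :=
    fun M hM => tendsto_id.prodMk_nhds (tendsto_const_nhds.prodMk_nhds
      (tendsto_const_nhds.prodMk_nhds hM))
  have hΩΩ : (fun t => Ω (t, χ, l, L t) - Ω (t, χ, l, L₀ t)) =O[𝓝 0] fun t : ℂ => t ^ m := by
    refine (anΩ.isBigO_comp_sub (tP L tL) (tP L₀ tL₀)).trans ?_
    simp only [Prod.mk_sub_mk, sub_self]
    exact (isBigO_zero _ _).prod_left ((isBigO_zero _ _).prod_left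
      ((isBigO_zero _ _).prod_left hLL))
  -- the target point
  let Z : ℂ → ℂ := fun t => F (z t, s t)
  let Z₀ : ℂ → ℂ := fun t => t * Ω (t, χ, l, L₀ t)
  have idO := isBigO_refl (fun t : ℂ => t) (𝓝 0)
  have hZ₀ : Z₀ =O[𝓝 0] fun t : ℂ => t :=
    (idO.mul ((anΩ.continuousAt.tendsto.comp (tP L₀ tL₀)).isBigO_one ℂ)).congr_right
      fun t => mul_one t
  have hZZ : (fun t => Z₀ t - Z t) =o[𝓝 0] fun t : ℂ => t ^ m := by
    have h1 : (fun t : ℂ => t) =o[𝓝 0] fun _ : ℂ => (1 : ℂ) := (isLittleO_one_iff ℂ).mpr tendsto_id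
    refine ((h1.mul_isBigO hΩΩ).neg_left.congr' ?_ EventuallyEq.rfl).congr_right
      fun t => one_mul _
    filter_upwards [e3] with t ht
    simp only [Z, z, s, ht, Z₀, L]
    ring
  have hZ : Z =O[𝓝 0] fun t : ℂ => t :=
    (hZ₀.sub (hZZ.isBigO.trans id1)).congr_left fun t => by ring
  have tT : ∀ M : ℂ → ℂ, M =O[𝓝 0] (fun t : ℂ => t) →
      Tendsto (fun t => (M t, fb χ, (0 : ℂ))) (𝓝 0) (𝓝 (0, fb χ, 0)) :=
    fun M hM => (hM.trans_tendsto tendsto_id).prodMk_nhds tendsto_const_nhds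
  have diff : ∀ {φ : ℂ × ℂ × ℂ → ℂ}, AnalyticAt ℂ φ (0, fb χ, 0) →
      (fun t => φ (Z₀ t, fb χ, 0) - φ (Z t, fb χ, 0)) =o[𝓝 0] fun t : ℂ => t ^ m := by
    intro φ hφ
    refine (hφ.isBigO_comp_sub (tT Z₀ hZ₀) (tT Z hZ)).trans_isLittleO ?_
    simp only [Prod.mk_sub_mk, sub_self]
    exact hZZ.prod_left ((isLittleO_zero _ _).prod_left (isLittleO_zero _ _))
  have hdZ : (fun t => dZ q' (Z t, fb χ, 0)) =O[𝓝 0] fun t : ℂ => t ^ (m - 1) := by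
    have tf : Tendsto (fun t => (Z t, fb χ)) (𝓝 0) (𝓝 (0, fb χ)) :=
      (hZ.trans_tendsto tendsto_id).prodMk_nhds tendsto_const_nhds
    have h1 := (((anR.continuousAt.tendsto.comp tf).const_mul (m : ℂ)).add
      ((hZ.trans_tendsto tendsto_id).mul (anR.dOne.continuousAt.tendsto.comp tf))).isBigO_one ℂ
    refine (((hZ.pow (m - 1)).mul h1).congr' ?_ EventuallyEq.rfl).congr_right fun t => mul_one _
    filter_upwards [(hZ.trans_tendsto tendsto_id).eventually e8] with t ht
    exact ht.symm
  have hC := h.dTwoF_isLittleO hz (hs.trans id1)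
  have hD := h.dTwoG_isLittleO hq hq' hS' hz hs
  have hBC : (fun t => dZ q' (Z t, fb χ, 0) * (jetC 1 l + jetC 5 l * z t + jetC 6 l * s t -
      dTwo F (z t, s t))) =o[𝓝 0] fun t : ℂ => t ^ m :=
    (hdZ.mul_isLittleO hC).congr_right fun t => by
      rw [← pow_succ, Nat.sub_add_cancel (Nat.one_le_iff_ne_zero.mpr hm)]
  have hP : (fun t => jetC 1 l + jetC 5 l * z t + jetC 6 l * s t) =O[𝓝 0] fun _ : ℂ => (1 : ℂ) :=
    ((tendsto_const_nhds.add ((hz.trans_tendsto tendsto_id).const_mul (jetC 5 l))).add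
      ((hs.trans_tendsto tm).const_mul (jetC 6 l))).isBigO_one ℂ
  have hAP := ((diff anq'.dZ).mul_isBigO hP).congr_right fun t => mul_one (t ^ m)
  have hQ := ((hD.sub (hAP.add hBC)).mul_isBigO hqτ).congr_right fun t => mul_one (t ^ m)
  have hE := ((diff anq'.dT).mul_isBigO (isBigO_refl (fun _ : ℂ => (1 : ℂ)) (𝓝 0))).congr_right
    fun t => mul_one (t ^ m)
  refine (hQ.sub (hE.const_mul_left (conjSecond q' v (χ, l)))).congr' ?_ EventuallyEq.rfl
  filter_upwards [e1] with t ht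
  rw [e2] at ht
  simp only [transApprox, curvePoint, firstOf, conjSecond, ← e6, Function.comp_apply]
  simp only [Z, Z₀, z, s, L₀]
  linear_combination -ht

end LeadingCoefficient

section CurveParametrization

open Asymptotics

variable {q q' : ℂ × ℂ × ℂ → ℂ} {m k : ℕ} {R U W R' U' W' : ℂ × ℂ → ℂ}
  {l : JetPair} {F G : ℂ × ℂ → ℂ} {fb a : ℂ → ℂ}
  {v : ℂ × JetPair → ℂ} {Ω : ℂ × ℂ × JetPair × ℂ → ℂ}

lemma IsSegreMap.coeffAt_transApprox (h : IsSegreMap q q' l F G fb a) (hq : IsNormalGerm q)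
    (hq' : IsNormalGerm q') (hS : IsSegreForm q m k R U W) (hS' : IsSegreForm q' m k R' U' W')
    (hv : AnalyticAt ℂ v (0, l)) (hv0 : v (0, l) = jetB l)
    (hfb : ∀ᶠ χ in 𝓝 (0 : ℂ), fb χ = χ * v (χ, l)) (hΩ : AnalyticAt ℂ Ω (0, 0, l, jetB l))
    (hF : ∀ᶠ p : ℂ × ℂ in 𝓝 0, F (p.1 * p.2 ^ k, q (p.1 * p.2 ^ k, p.2, 0)) =
      p.1 * Ω (p.1, p.2, l, segreDet q k fb a p)) :
    ∀ᶠ χ in 𝓝 (0 : ℂ), coeffAt m (transApprox q q' k v Ω) (χ, l) =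
      χ ^ (k * m + (k - 1)) * leadFactor q W' m k v (χ, l) * a χ := by
  let w : ℂ → ℂ := fun χ => v (χ, l)
  have hw : AnalyticAt ℂ w 0 := hv.comp_of_eq (f := fun χ : ℂ => (χ, l)) (by fun_prop) rfl
  have hw0 : w 0 = jetB l := hv0
  have hη := h.an_segreEta hq hw hv0 hS.k_ne
  have tW : Tendsto (fun χ : ℂ => ((0 : ℂ), χ * w χ)) (𝓝 0) (𝓝 0) := by
    have h1 := (tendsto_id (α := ℂ) (x := 𝓝 0)).mul hw.continuousAt.tendsto
    rw [zero_mul] at h1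
    exact tendsto_const_nhds.prodMk_nhds h1
  filter_upwards [h.transApprox_isLittleO hq hq' hS hS' hv hv0 hfb hΩ hF,
    eventually_eventually_slice (h.dX_target hq hS' hw hv0 hfb), h.segreQuot_left hq,
    tendsto_left.eventually hη.eventually_analyticAt,
    tW.eventually hS'.analyticAt_W.eventually_analyticAt,
    hw.continuousAt.eventually_ne (hw0 ▸ h.mem.2.2)] with χ h1 h2 h3 h4 h5 h6
  let g : ℂ → ℂ := fun t => χ ^ (k * m + (k - 1)) * (segreEta q F k w (t, χ) ^ m *
    w χ ^ (k * m + (k - 1)) * W' (t * segreEta q F k w (t, χ), χ * w χ)) * a χ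
  have tχ : ContinuousAt (fun t : ℂ => (t, χ)) 0 := by fun_prop
  have c1 : ContinuousAt (fun t : ℂ => segreEta q F k w (t, χ)) 0 :=
    h4.continuousAt.comp (f := fun t : ℂ => (t, χ)) tχ
  have c2 : ContinuousAt (fun t : ℂ => W' (t * segreEta q F k w (t, χ), χ * w χ)) 0 := by
    refine ContinuousAt.comp_of_eq h5.continuousAt
      (f := fun t : ℂ => (t * segreEta q F k w (t, χ), χ * w χ))
      ((continuousAt_id.mul c1).prodMk continuousAt_const) (by simp)
  have hg : ContinuousAt g 0 :=
    (continuousAt_const.mul (((c1.pow m).mul continuousAt_const).mul c2)).mul continuousAt_const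
  have h7 := coeffAt_eq_of_isLittleO hS.m_ne (f := transApprox q q' k v Ω) (y := (χ, l)) hg
    (h1.congr' (by
      filter_upwards [h2] with t ht
      simp only [g, ht]
      ring) EventuallyEq.rfl)
  rw [h7]
  simp only [g, segreEta, leadFactor, zero_mul, h3]
  change _ = _ * (_ * w χ ^ (k - 1) * W' (0, χ * w χ)) * _
  rw [div_pow, ← pow_mul, pow_add (w χ)]
  have := pow_ne_zero (k * m) h6
  field_simp

lemma IsSegreMap.segreDet_eq (h : IsSegreMap q q' l F G fb a) (hq : IsNormalGerm q)
    (hq' : IsNormalGerm q') (hS : IsSegreForm q m k R U W) (hS' : IsSegreForm q' m k R' U' W')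
    (hv : AnalyticAt ℂ v (0, l)) (hv0 : v (0, l) = jetB l)
    (hfb : ∀ᶠ χ in 𝓝 (0 : ℂ), fb χ = χ * v (χ, l)) (hΩ : AnalyticAt ℂ Ω (0, 0, l, jetB l))
    (hF : ∀ᶠ p : ℂ × ℂ in 𝓝 0, F (p.1 * p.2 ^ k, q (p.1 * p.2 ^ k, p.2, 0)) =
      p.1 * Ω (p.1, p.2, l, segreDet q k fb a p)) :
    ∀ᶠ p in 𝓝 (0 : ℂ × ℂ), segreDet q k fb a p =
      slopeParam q q' W W' m k v Ω (p.1, p.2, l) := by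
  have h1 : ∀ᶠ χ in 𝓝 (0 : ℂ), leadFactor q W' m k v (χ, l) ≠ 0 := by
    have h2 := (analyticAt_leadFactor (m := m) hq hS' hv).continuousAt.eventually_ne
      (leadFactor_ne hq hS' h.mem hv0)
    exact (Continuous.tendsto' (f := fun χ : ℂ => (χ, l)) (by fun_prop) 0 _ rfl).eventually h2
  have ts := continuous_snd.tendsto (0 : ℂ × ℂ)
  filter_upwards [ts.eventually h1, ts.eventually (eventually_conjDeriv hv hfb), hS.eq_W,
    ts.eventually (h.coeffAt_transApprox hq hq' hS hS' hv hv0 hfb hΩ hF)] with p h1 h2 h3 h4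
  simp only [slopeParam, slopeZero, curvePoint, segreDet, h2, h3, h4]
  field_simp

/-- Along the curves `z = t χ ^ k`, maps are determined by their jets. -/
lemma exists_curve_param (hq : IsNormalGerm q) (hq' : IsNormalGerm q')
    (hS : IsSegreForm q m k R U W) (hS' : IsSegreForm q' m k R' U' W') :
    ∃ Ψ₁ Ψ₂ : ℂ × ℂ × JetPair → ℂ,
      (∀ l ∈ JetDom, AnalyticAt ℂ Ψ₁ (0, 0, l) ∧ AnalyticAt ℂ Ψ₂ (0, 0, l)) ∧
      ∀ l F G fb a, IsSegreMap q q' l F G fb a → ∀ᶠ p : ℂ × ℂ in 𝓝 0,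
        F (p.1 * p.2 ^ k, q (p.1 * p.2 ^ k, p.2, 0)) = Ψ₁ (p.1, p.2, l) ∧
        G (p.1 * p.2 ^ k, q (p.1 * p.2 ^ k, p.2, 0)) = Ψ₂ (p.1, p.2, l) := by
  obtain ⟨v, hv, hvm⟩ := exists_conjugate_param hq hS hS'
  obtain ⟨Ω, hΩ, hΩm⟩ := exists_slope_param hq hq' hS hS' v hv hvm
  let Y := firstOf v Ω (slopeParam q q' W W' m k v Ω)
  have hY : ∀ l ∈ JetDom, AnalyticAt ℂ Y (0, 0, l) := fun l hl => by
    obtain ⟨hvl, hv0⟩ := hv l hl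
    exact analyticAt_firstOf hvl (analyticAt_slopeParam hq hq' hS hS' hl hvl hv0 (hΩ l hl))
      (by
        rw [slopeParam_zero hq hS hvl, hv0]
        exact hΩ l hl)
  refine ⟨fun x => (Y x).1, fun x => q' (Y x), fun l hl => ⟨(hY l hl).fst_comp,
    hq'.an.comp_of_eq (hY l hl) (firstOf_zero _)⟩, fun l F G fb a h => ?_⟩
  obtain ⟨hvl, hv0⟩ := hv l h.mem
  have hfb := hvm l F G fb a h
  have hF := hΩm l F G fb a h
  filter_upwards [h.segreDet_eq hq hq' hS hS' hvl hv0 hfb (hΩ l h.mem) hF, hF,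
    (tendsto_curve hS.k_ne).eventually h.eq_zero,
    (continuous_snd.tendsto (0 : ℂ × ℂ)).eventually hfb] with p h1 h2 h3 h4
  have h5 : F (p.1 * p.2 ^ k, q (p.1 * p.2 ^ k, p.2, 0)) = (Y (p.1, p.2, l)).1 := by
    rw [h2, h1]
    rfl
  refine ⟨h5, ?_⟩
  rw [h3, h5, h4]
  rfl

end CurveParametrization

section Extraction

variable {q : ℂ × ℂ × ℂ → ℂ} {m k : ℕ} {R U W : ℂ × ℂ → ℂ}

lemma IsSegreForm.exists_straightening (hS : IsSegreForm q m k R U W) :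
    ∃ κ : ℂ × ℂ → ℂ × ℂ, AnalyticAt ℂ κ 0 ∧ κ 0 = 0 ∧
      ∀ᶠ p in 𝓝 (0 : ℂ × ℂ), (κ p).1 * (κ p).2 ^ k = p.1 * p.2 ^ k ∧
        q ((κ p).1 * (κ p).2 ^ k, (κ p).2, 0) = (p.1 * p.2 ^ k) ^ m * p.2 ^ k := by
  have hU := hS.analyticAt_U
  have hU0 := hS.U_ne
  let β : ℂ × ℂ → ℂ := fun p => rootNear k (U 0) * rootNear k (U p / U 0)
  have hβk : ∀ p, β p ^ k = U p := fun p => by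
    simp only [β, mul_pow, rootNear_pow hS.k_ne]
    field_simp
  have hβ : AnalyticAt ℂ β 0 := by
    refine analyticAt_const.fun_mul (AnalyticAt.rootNear k ?_ (div_self hU0))
    exact hU.fun_div analyticAt_const hU0
  have hβ0 : β 0 ≠ 0 := fun h => by
    have := hβk 0
    rw [h, zero_pow hS.k_ne] at this
    exact hU0 this.symm
  obtain ⟨κ, hκ, hκ0, -, hr⟩ := exists_analytic_inverse (hU.fun_inv hU0) hβ (inv_ne_zero hU0) hβ0
  have tκ : Tendsto κ (𝓝 0) (𝓝 0) := by simpa [hκ0] using hκ.continuousAt.tendsto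
  refine ⟨κ, hκ, hκ0, ?_⟩
  filter_upwards [hr, tκ.eventually (hU.continuousAt.eventually_ne hU0), tκ.eventually hS.eq_U]
    with p h1 h2 h3
  have hx : p.1 = (κ p).1 * (U (κ p))⁻¹ := (congrArg Prod.fst h1).symm
  have hy : p.2 ^ k = (κ p).2 ^ k * U (κ p) := by
    rw [← hβk, ← mul_pow]
    exact congrArg (fun x : ℂ × ℂ => x.2 ^ k) h1.symm
  have hxy : (κ p).1 * (κ p).2 ^ k = p.1 * p.2 ^ k := by
    rw [hx, hy]
    field_simp
  refine ⟨hxy, ?_⟩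
  rw [h3, ← hxy, hy]
  ring

lemma IsSegreForm.exists_extension (hS : IsSegreForm q m k R U W) :
    ∃ T : (ℂ × ℂ × JetPair → ℂ) → ℂ × ℂ × JetPair → ℂ, ∀ Ψ l, AnalyticAt ℂ Ψ (0, 0, l) →
      AnalyticAt ℂ (T Ψ) (0, 0, l) ∧
      ∀ f : ℂ × ℂ → ℂ, AnalyticAt ℂ f 0 →
        (∀ᶠ p : ℂ × ℂ in 𝓝 0,
          f (p.1 * p.2 ^ k, q (p.1 * p.2 ^ k, p.2, 0)) = Ψ (p.1, p.2, l)) →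
        ∀ᶠ p : ℂ × ℂ in 𝓝 0, f p = T Ψ (p.2, p.1, l) := by
  obtain ⟨κ, hκ, hκ0, hcurve⟩ := hS.exists_straightening
  have tκ : Tendsto κ (𝓝 0) (𝓝 0) := by simpa [hκ0] using hκ.continuousAt.tendsto
  let A : (ℂ × ℂ × JetPair → ℂ) → ℂ × ℂ × JetPair → ℂ := fun Ψ x =>
    Ψ ((κ (x.1, x.2.1)).1, (κ (x.1, x.2.1)).2, x.2.2)
  let B : (ℂ × ℂ × JetPair → ℂ) → ℂ × ℂ × JetPair → ℂ := fun Ψ x =>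
    descent k k (A Ψ) (x.2.1, x.1, x.2.2)
  refine ⟨fun Ψ => descent m 1 (B Ψ), fun Ψ l hΨ => ?_⟩
  have hA : AnalyticAt ℂ (A Ψ) (0, 0, l) := by
    have hκ' : AnalyticAt ℂ (fun x : ℂ × ℂ × JetPair => κ (x.1, x.2.1)) (0, 0, l) :=
      hκ.comp_of_eq (f := fun x : ℂ × ℂ × JetPair => (x.1, x.2.1)) (by fun_prop) rfl
    refine hΨ.comp_of_eq (f := fun x : ℂ × ℂ × JetPair =>
      ((κ (x.1, x.2.1)).1, (κ (x.1, x.2.1)).2, x.2.2)) ?_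
      (show ((κ 0).1, (κ 0).2, l) = (0, 0, l) by rw [hκ0]; rfl)
    exact hκ'.fst_comp.prod (hκ'.snd_comp.prod (by fun_prop))
  have hB : AnalyticAt ℂ (B Ψ) (0, 0, l) :=
    (analyticAt_descent k k hA).comp_of_eq
      (f := fun x : ℂ × ℂ × JetPair => (x.2.1, x.1, x.2.2)) (by fun_prop) rfl
  refine ⟨analyticAt_descent m 1 hB, fun f hf h => ?_⟩
  have h1 := eventually_eq_descent hS.k_ne hA (h := fun p : ℂ × ℂ => f (p.1, p.1 ^ m * p.2))
    (hf.comp_of_eq (f := fun p : ℂ × ℂ => (p.1, p.1 ^ m * p.2)) (by fun_prop) (by simp)) (by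
      filter_upwards [hcurve, tκ.eventually h] with p hp hp'
      rw [hp.2, hp.1] at hp'
      exact hp')
  have swap : Tendsto (fun p : ℂ × ℂ => (p.2, p.1)) (𝓝 0) (𝓝 0) :=
    Continuous.tendsto' (by fun_prop) _ _ rfl
  have h2 := eventually_eq_descent one_ne_zero hB (a := m) (h := fun p : ℂ × ℂ => f (p.2, p.1))
    (hf.comp_of_eq (f := fun p : ℂ × ℂ => (p.2, p.1)) (by fun_prop) rfl) (by
      filter_upwards [swap.eventually h1] with p hp
      rw [pow_one, mul_comm]
      exact hp)
  exact swap.eventually h2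

end Extraction

lemma IsNormalCoord.isNormalGerm {Q : ℂ → ℂ → ℂ → ℂ} (h : IsNormalCoord Q) :
    IsNormalGerm fun p => Q p.1 p.2.1 p.2.2 := ⟨h.1, h.2.1, h.2.2.1⟩

lemma mem_jetDom {Λ Λ' : Fin 10 → ℂ} (h : Λ ∈ T2Set) (h' : Λ' ∈ T2SetConj) :
    (Λ, Λ') ∈ JetDom := by
  obtain ⟨M, hM, rfl⟩ := h'
  refine ⟨h.2.1, h.2.2, fun h0 => hM.2.1 ?_⟩
  have h1 : cj (M 0) = 0 := h0
  rw [← cj_cj (M 0), h1, cj_zero]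

/-- Theorem 4.1: if `M, M' ⊂ ℂ²` are of finite type at `0`, there is a
holomorphic map `Θ` on a neighborhood `D` of `{(0,0)} × T²(ℂ²) × conj(T²(ℂ²))` in
`ℂ² × ℂ¹⁰ × ℂ¹⁰`, depending only on `Q, Q'`, such that every local biholomorphism `H`
sending `M` into `M'` satisfies `H(z,w) = Θ(z, w, j²₀H, conj j²₀H)` near `0`. -/
theorem two_jet_parametrization
    (Q Q' : ℂ → ℂ → ℂ → ℂ) (hQ : IsNormalCoord Q) (hQ' : IsNormalCoord Q')
    (hFT : FiniteTypeAt Q) (hFT' : FiniteTypeAt Q') :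
    ∃ (D : Set ((ℂ × ℂ) × (Fin 10 → ℂ) × (Fin 10 → ℂ)))
      (Θ : (ℂ × ℂ) × (Fin 10 → ℂ) × (Fin 10 → ℂ) → ℂ × ℂ),
      IsOpen D ∧
      (∀ Λ Λ' : Fin 10 → ℂ, Λ ∈ T2Set → Λ' ∈ T2SetConj → ((0 : ℂ × ℂ), Λ, Λ') ∈ D) ∧
      AnalyticOnNhd ℂ Θ D ∧
      ∀ F G : ℂ → ℂ → ℂ, SendsInto Q Q' F G → JacDet F G ≠ 0 →
        ∀ᶠ p : ℂ × ℂ in 𝓝 0,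
          (p, jet10 F G, fun i => cj (jet10 F G i)) ∈ D ∧
          (F p.1 p.2, G p.1 p.2) = Θ (p, jet10 F G, fun i => cj (jet10 F G i)) := by
  have hq := hQ.isNormalGerm
  have hq' := hQ'.isNormalGerm
  obtain ⟨m, k, R, U, W, hS⟩ := exists_isSegreForm hq.an hq.mid_zero hq.left_zero hFT
  obtain ⟨m', k', R', U', W', hS'⟩ := exists_isSegreForm hq'.an hq'.mid_zero hq'.left_zero hFT'
  by_cases hmk : m = m' ∧ k = k'
  · obtain ⟨rfl, rfl⟩ := hmk
    obtain ⟨Ψ₁, Ψ₂, hΨ, hmap⟩ := exists_curve_param hq hq' hS hS'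
    obtain ⟨T, hT⟩ := hS.exists_extension
    let Θ : (ℂ × ℂ) × JetPair → ℂ × ℂ := fun x =>
      (T Ψ₁ (x.1.2, x.1.1, x.2), T Ψ₂ (x.1.2, x.1.1, x.2))
    have hΘ : ∀ l ∈ JetDom, AnalyticAt ℂ Θ (0, l) := fun l hl => by
      obtain ⟨h1, h2⟩ := hΨ l hl
      exact ((hT Ψ₁ l h1).1.comp_of_eq
          (f := fun x : (ℂ × ℂ) × JetPair => (x.1.2, x.1.1, x.2)) (by fun_prop) rfl).prod
        ((hT Ψ₂ l h2).1.comp_of_eq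
          (f := fun x : (ℂ × ℂ) × JetPair => (x.1.2, x.1.1, x.2)) (by fun_prop) rfl)
    refine ⟨{x | AnalyticAt ℂ Θ x}, Θ, isOpen_analyticAt ℂ Θ,
      fun Λ Λ' h h' => hΘ _ (mem_jetDom h h'), fun _ hx => hx, fun F G h hJ => ?_⟩
    have hH := isSegreMap hq hq' h hJ
    obtain ⟨h1, h2⟩ := hΨ _ hH.mem
    have ht : Tendsto (fun p : ℂ × ℂ =>
        (p, ((jet10 F G, fun i => cj (jet10 F G i)) : JetPair))) (𝓝 0)
        (𝓝 (0, (jet10 F G, fun i => cj (jet10 F G i)))) :=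
      Continuous.tendsto' (by fun_prop) _ _ rfl
    have hc := hmap _ _ _ _ _ hH
    filter_upwards [ht.eventually (hΘ _ hH.mem).eventually_analyticAt,
      (hT Ψ₁ _ h1).2 _ hH.anF (hc.mono fun _ hp => hp.1),
      (hT Ψ₂ _ h2).2 _ hH.anG (hc.mono fun _ hp => hp.2)] with p hp hp1 hp2
    exact ⟨hp, Prod.ext hp1 hp2⟩
  · refine ⟨Set.univ, 0, isOpen_univ, fun _ _ _ _ => trivial, fun _ _ => analyticAt_const,
      fun F G h hJ => (hmk ?_).elim⟩
    have := (isSegreMap hq hq' h hJ).first_coefficient hq hS hS'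
    exact ⟨this.1, this.2.1⟩
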